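/- arXiv:1601.07541 — 2 statements merged into one kernel-verified Lean document; each statement's English description precedes it below -/
import Mathlib

section
/- Let q ≥ 434 be a prime power whose characteristic p satisfies p > 3, and let F_q be the field with q elements. Then there exists a permutation π of F_q that destroys every nonconstant 3-term arithmetic progression (a,b,c) (meaning b − a = c − b ≠ 0, with π(b) − π(a) ≠ π(c) − π(b)) except possibly the triples (1/3, 2/3, 1) and (1, 2/3, 1/3), and which does destroy (0, 3/2, 3) and (3, 3/2, 0). -/
section PartA
open WeierstrassCurve WeierstrassCurve.Affine

/-- The twisted curve. -/
def twCurve {K : Type*} [Field K] (a b l : K) : WeierstrassCurve.Affine K :=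
  { a₁ := 0, a₂ := a * l, a₃ := 0, a₄ := b * l ^ 2, a₆ := 0 }

/-- Projective representative of `x / l`. -/
noncomputable def xr {K : Type*} [Field K] {a b : K} (l : K) : (twCurve a b l).Point → K × K
  | .zero => (1, 0)
  | .some x _ _ => (x / l, 1)

def SumRel {R : Type*} [CommRing R] (a b t : R) (p pp pm : R × R) : Prop :=
  pp.1 * pm.1 * (p.1 - t * p.2) ^ 2 = pp.2 * pm.2 * (t * p.1 - b * p.2) ^ 2 ∧
  (pp.1 * pm.2 + pm.1 * pp.2) * (p.1 - t * p.2) ^ 2 =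
    pp.2 * pm.2 * (2 * ((p.1 + t * p.2) * (t * p.1 + b * p.2) + 2 * a * t * p.1 * p.2)) ∧
  pp.1 * pm.1 * (2 * ((p.1 + t * p.2) * (t * p.1 + b * p.2) + 2 * a * t * p.1 * p.2)) =
    (pp.1 * pm.2 + pm.1 * pp.2) * (t * p.1 - b * p.2) ^ 2

lemma xr_neg {K : Type*} [Field K] {a b l : K} (P : (twCurve a b l).Point) : xr l (-P) = xr l P := by
  cases P <;> rfl

lemma sumRel_swap {R : Type*} [CommRing R] {a b t : R} {p pp pm : R × R}
    (h : SumRel a b t p pp pm) : SumRel a b t p pm pp := by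
  obtain ⟨h1, h2, h3⟩ := h
  refine ⟨?_, ?_, ?_⟩
  · linear_combination h1
  · linear_combination h2
  · linear_combination h3

lemma xr_some {K : Type*} [Field K] {a b l x y : K} (h : (twCurve a b l).Nonsingular x y) :
    xr l (.some x y h) = (x / l, 1) := rfl

section
variable {K : Type*} [Field K] [DecidableEq K] {a b t l : K}

lemma xr_add (hl : l ≠ 0) {x y x' y' z w t e : K} (h : (twCurve a b l).Nonsingular x y)
    (h' : (twCurve a b l).Nonsingular x' y') (hx : x = l * z) (hy : y = l ^ 2 * w)
    (hx' : x' = l * t) (hy' : y' = l ^ 2 * e) (hzt : z ≠ t) :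
    xr l (.some _ _ h + .some _ _ h') =
      ((l * (w - e) ^ 2 - (a + z + t) * (z - t) ^ 2) / (z - t) ^ 2, 1) := by
  have hzt' : z - t ≠ 0 := sub_ne_zero.2 hzt
  have hne : x ≠ x' := by
    rw [hx, hx']
    exact fun hh => hzt (mul_left_cancel₀ hl hh)
  rw [Point.add_of_X_ne hne, xr_some, slope_of_X_ne hne]
  simp only [addX, twCurve]
  rw [hx, hy, hx', hy']
  have : l * z - l * t = l * (z - t) := by ring
  rw [this]
  congr 1
  field_simp
  ring

lemma sumRel_self (h2 : (2 : K) ≠ 0) (hl : l ≠ 0) (hlt : l = t ^ 3 + a * t ^ 2 + b * t)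
    (hQ : (twCurve a b l).Nonsingular (l * t) (l ^ 2)) :
    SumRel a b t (xr l (.some _ _ hQ)) (xr l (.some _ _ hQ + .some _ _ hQ))
      (xr l (.some _ _ hQ - .some _ _ hQ)) := by
  have hy : l ^ 2 ≠ (twCurve a b l).negY (l * t) (l ^ 2) := by
    simp only [negY, twCurve]
    intro h
    have : 2 * l ^ 2 = 0 := by linear_combination h
    exact mul_ne_zero h2 (pow_ne_zero 2 hl) this
  rw [sub_self, Point.add_self_of_Y_ne hy, xr_some, xr_some, slope_of_Y_ne rfl hy]
  simp only [SumRel, xr, addX, twCurve, negY]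
  have hl2 : l ^ 2 - (-(l^2) - 0 * (l * t) - 0) = 2 * l ^ 2 := by ring
  rw [hl2]
  have h0 : l * t / l = t := by field_simp
  rw [h0]
  refine ⟨by ring, by ring, ?_⟩
  field_simp
  rw [hlt]; ring

lemma sumRel_main (h2 : (2 : K) ≠ 0) (hl : l ≠ 0) (hlt : l = t ^ 3 + a * t ^ 2 + b * t)
    (hQ : (twCurve a b l).Nonsingular (l * t) (l ^ 2)) (P : (twCurve a b l).Point) :
    SumRel a b t (xr l P) (xr l (P + .some _ _ hQ)) (xr l (P - .some _ _ hQ)) := by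
  rcases P with _ | ⟨x, y, hP⟩
  · rw [← Point.zero_def, zero_add, zero_sub, xr_neg]
    simp only [SumRel, xr]
    have : l * t / l = t := by field_simp
    rw [this]
    refine ⟨?_, ?_, ?_⟩ <;> ring
  · by_cases hx : x = l * t
    · rcases Point.X_eq_iff (h₁ := hP) (h₂ := hQ) |>.1 hx with h | h
      · rw [h]; exact sumRel_self h2 hl hlt hQ
      · rw [h, xr_neg]
        have e1 : -Point.some _ _ hQ + .some _ _ hQ
          = -(Point.some _ _ hQ - .some _ _ hQ) := by abel
        have e2 : -Point.some _ _ hQ - .some _ _ hQ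
          = -(Point.some _ _ hQ + .some _ _ hQ) := by abel
        rw [e1, e2, xr_neg, xr_neg]
        exact sumRel_swap (sumRel_self h2 hl hlt hQ)
    · have hxs : x - l * t ≠ 0 := sub_ne_zero.2 hx
      have e := (equation_iff x y).1 hP.1
      simp only [twCurve] at e
      set z := x / l with hz
      have hxz : x = l * z := by rw [hz]; field_simp
      set w := y / l ^ 2 with hw
      have hyw : y = l ^ 2 * w := by rw [hw]; field_simp
      rw [hxz, hyw] at e
      have hzt : z - t ≠ 0 := by
        intro h; apply hxs; rw [hxz]; linear_combination l * h
      have e' : l * w ^ 2 = z ^ 3 + a * z ^ 2 + b * z := by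
        have : l ^ 3 * (l * w ^ 2) = l ^ 3 * (z ^ 3 + a * z ^ 2 + b * z) := by linear_combination e
        exact mul_left_cancel₀ (pow_ne_zero 3 hl) this
      rw [sub_eq_add_neg, Point.neg_some,
        xr_add hl hP hQ hxz hyw rfl (mul_one _).symm (sub_ne_zero.1 hzt),
        xr_add (e := -1) hl hP _ hxz hyw rfl (by simp [negY, twCurve]) (sub_ne_zero.1 hzt), xr_some,
        ← hz, sub_neg_eq_add]
      simp only [SumRel]
      have hprod : (l * (w - 1) ^ 2 - (a + z + t) * (z - t) ^ 2) *
          (l * (w + 1) ^ 2 - (a + z + t) * (z - t) ^ 2) = (t * z - b) ^ 2 * (z - t) ^ 2 := by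
        have : (l * (w - 1) ^ 2 - (a + z + t) * (z - t) ^ 2) *
          (l * (w + 1) ^ 2 - (a + z + t) * (z - t) ^ 2) =
          (l * w ^ 2 - l) ^ 2 - 2 * (a + z + t) * (z - t) ^ 2 * (l * w ^ 2 + l)
            + (a + z + t) ^ 2 * (z - t) ^ 4 := by ring
        rw [this, e', hlt]; ring
      have hsum : (l * (w - 1) ^ 2 - (a + z + t) * (z - t) ^ 2) +
          (l * (w + 1) ^ 2 - (a + z + t) * (z - t) ^ 2) =
          2 * ((z + t) * (t * z + b) + 2 * a * t * z) := by
        linear_combination 2 * e' + 2 * hlt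
      refine ⟨?_, ?_, ?_⟩
      · field_simp
        linear_combination hprod
      · field_simp
        linear_combination hsum
      · field_simp
        generalize (l * (w - 1) ^ 2 - (a + z + t) * (z - t) ^ 2) = A at *
        generalize (l * (w + 1) ^ 2 - (a + z + t) * (z - t) ^ 2) = B at *
        linear_combination (2 * ((z + t) * (t * z + b) + 2 * a * t * z)) * hprod -
          (z - t)^2 * (t * z - b) ^ 2 * hsum
end

end PartA

section PartB
open Polynomial

section
variable {R : Type*} [CommRing R]

lemma unimod_prod {N1 D1 N2 D2 : R} (h1 : IsCoprime N1 D1) (h2 : IsCoprime N2 D2) :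
    Ideal.span {N1 * N2, N1 * D2 + N2 * D1, D1 * D2} = ⊤ := by
  by_contra hne
  obtain ⟨M, hM, hle⟩ := Ideal.exists_le_maximal _ hne
  have hp := hM.isPrime
  have hA : N1 * N2 ∈ M := hle (Ideal.subset_span (by simp))
  have hB : N1 * D2 + N2 * D1 ∈ M := hle (Ideal.subset_span (by simp))
  have hC : D1 * D2 ∈ M := hle (Ideal.subset_span (by simp))
  have c1 : ¬ (N1 ∈ M ∧ D1 ∈ M) := by
    rintro ⟨u, v⟩
    obtain ⟨x, y, e⟩ := h1
    exact hp.one_notMem (e ▸ M.add_mem (M.mul_mem_left _ u) (M.mul_mem_left _ v))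
  have c2 : ¬ (N2 ∈ M ∧ D2 ∈ M) := by
    rintro ⟨u, v⟩
    obtain ⟨x, y, e⟩ := h2
    exact hp.one_notMem (e ▸ M.add_mem (M.mul_mem_left _ u) (M.mul_mem_left _ v))
  rcases hp.mem_or_mem hA with h | h
  · have : N2 * D1 ∈ M := (M.add_mem_iff_right (M.mul_mem_right _ h)).1 hB
    rcases hp.mem_or_mem this with h' | h' <;> rcases hp.mem_or_mem hC with h'' | h'' <;> tauto
  · have : N1 * D2 ∈ M := (M.add_mem_iff_left (M.mul_mem_right _ h)).1 hB
    rcases hp.mem_or_mem this with h' | h' <;> rcases hp.mem_or_mem hC with h'' | h'' <;> tauto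

lemma unimod_other {N D a b t : R} (h : IsCoprime N D) (h2 : IsUnit (2 : R)) (hb : IsUnit b)
    (hab : IsUnit (a ^ 2 - 4 * b)) :
    Ideal.span {(t * N - b * D) ^ 2,
      2 * ((N + t * D) * (t * N + b * D) + 2 * a * t * N * D), (N - t * D) ^ 2} = ⊤ := by
  by_contra hne
  obtain ⟨M, hM, hle⟩ := Ideal.exists_le_maximal _ hne
  have hp := hM.isPrime
  have un : ∀ u : R, IsUnit u → u ∉ M := fun u hu hm => hM.ne_top (M.eq_top_of_isUnit_mem hm hu)
  have hA : (t * N - b * D) ^ 2 ∈ M := hle (Ideal.subset_span (by simp))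
  have hB : 2 * ((N + t * D) * (t * N + b * D) + 2 * a * t * N * D) ∈ M :=
    hle (Ideal.subset_span (by simp))
  have hC : (N - t * D) ^ 2 ∈ M := hle (Ideal.subset_span (by simp))
  replace hA := hp.mem_of_pow_mem _ hA
  replace hC := hp.mem_of_pow_mem _ hC
  replace hB := (hp.mem_or_mem hB).resolve_left (un _ h2)
  have c1 : D ∉ M := by
    intro v
    have u : N ∈ M := by
      have := M.add_mem hC (M.mul_mem_left t v)
      simpa using this
    obtain ⟨x, y, e⟩ := h
    exact hp.one_notMem (e ▸ M.add_mem (M.mul_mem_left _ u) (M.mul_mem_left _ v))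
  have k1 : (t ^ 2 - b) * D ∈ M := by
    have := M.sub_mem hA (M.mul_mem_left t hC)
    convert this using 1; ring
  replace k1 := (hp.mem_or_mem k1).resolve_right c1
  have k2 : 2 * t * (t ^ 2 + a * t + b) * D ^ 2 ∈ M := by
    have := M.sub_mem hB (M.mul_mem_left (t * N + b * D + 2 * t ^ 2 * D + 2 * a * t * D) hC)
    convert this using 1; ring
  replace k2 := (hp.mem_or_mem k2).resolve_right (fun hh => c1 (hp.mem_of_pow_mem _ hh))
  rcases hp.mem_or_mem k2 with h' | h'
  · have ht := (hp.mem_or_mem h').resolve_left (un _ h2)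
    apply un b hb
    have := M.sub_mem (M.mul_mem_left t ht) k1
    convert this using 1; ring
  · have ht : t ∉ M := by
      intro ht
      apply un b hb
      have := M.sub_mem (M.mul_mem_left t ht) k1
      convert this using 1; ring
    have k3 : t * (2 * t + a) ∈ M := by
      convert M.add_mem h' k1 using 1; ring
    replace k3 := (hp.mem_or_mem k3).resolve_left ht
    apply un _ hab
    have := M.sub_mem (M.mul_mem_left a k3) (M.mul_mem_left 2 (M.sub_mem h' k1))
    convert this using 1; ring

lemma assoc_triple {A B C V W U : R} (h1 : Ideal.span {A, B, C} = ⊤)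
    (h2 : Ideal.span {V, W, U} = ⊤) (e1 : A * U = C * V) (e2 : B * U = C * W)
    (e3 : A * W = B * V) : ∃ k, IsUnit k ∧ V = A * k ∧ W = B * k ∧ U = C * k := by
  have : (1 : R) ∈ Ideal.span {A, B, C} := by rw [h1]; trivial
  obtain ⟨x, y, z, e⟩ := (Submodule.mem_span_triple).1 this
  simp only [smul_eq_mul] at e
  have hV : V = A * (x * V + y * W + z * U) := by
    linear_combination -V * e + y * (-e3) + z * (-e1)
  have hW : W = B * (x * V + y * W + z * U) := by
    linear_combination -W * e + x * (e3) + z * (-e2)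
  have hU : U = C * (x * V + y * W + z * U) := by
    linear_combination -U * e + x * (e1) + y * (e2)
  refine ⟨x * V + y * W + z * U, ?_, hV, hW, hU⟩
  have : (1 : R) ∈ Ideal.span {V, W, U} := by rw [h2]; trivial
  obtain ⟨x', y', z', e'⟩ := (Submodule.mem_span_triple).1 this
  simp only [smul_eq_mul] at e'
  refine IsUnit.of_mul_eq_one (x' * A + y' * B + z' * C) ?_
  generalize x * V + y * W + z * U = k at *
  rw [← e']
  linear_combination -x' * hV - y' * hW - z' * hU
end

section
variable {F : Type*} [Field F]

lemma poly_step {a b : F} (h2 : (2 : F) ≠ 0) (hb : b ≠ 0) (hab : a ^ 2 ≠ 4 * b)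
    {N D N1 D1 N2 D2 : F[X]} (h : IsCoprime N D) (h1 : IsCoprime N1 D1) (h2' : IsCoprime N2 D2)
    (hs : SumRel (C a) (C b) X (N, D) (N1, D1) (N2, D2)) (hd : D.degree < N.degree) :
    D1.degree < N1.degree ∧ D2.degree < N2.degree ∧
      N1.natDegree + N2.natDegree = 2 * N.natDegree + 2 := by
  have hN : N ≠ 0 := by rintro rfl; simp at hd
  obtain ⟨e1, e2, e3⟩ := hs
  simp only at e1 e2 e3
  have u2 : IsUnit (2 : F[X]) := by
    have : (2 : F[X]) = C 2 := (map_ofNat C 2).symm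
    rw [this]; exact isUnit_C.2 h2.isUnit
  have ub : IsUnit (C b : F[X]) := isUnit_C.2 hb.isUnit
  have uab : IsUnit ((C a : F[X]) ^ 2 - 4 * C b) := by
    have : (C a : F[X]) ^ 2 - 4 * C b = C (a ^ 2 - 4 * b) := by
      simp [map_ofNat C 4]
    rw [this]; exact isUnit_C.2 (sub_ne_zero.2 hab).isUnit
  obtain ⟨k, hk, hV, hW, hU⟩ := assoc_triple (unimod_prod h1 h2')
    (unimod_other (t := X) h u2 ub uab) e1 e2 e3
  have kd : k.degree = 0 := degree_eq_zero_of_isUnit hk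
  have kd' : ∀ P : F[X], (P * k).degree = P.degree := fun P => by rw [degree_mul, kd, add_zero]
  set n := N.natDegree with hn
  have hNn : N.degree = n := degree_eq_natDegree hN
  -- degree facts
  have dX : ∀ P : F[X], P.degree < n → (X * P).degree < ((n + 1 : ℕ) : WithBot ℕ) := by
    intro P hP
    by_cases h0 : P = 0
    · rw [h0, mul_zero, degree_zero]; exact WithBot.bot_lt_coe _
    · rw [degree_eq_natDegree h0] at hP
      rw [degree_eq_natDegree (mul_ne_zero X_ne_zero h0), natDegree_X_mul h0]
      norm_cast at hP ⊢; omega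
  have dXN : (X * N).degree = ((n + 1 : ℕ) : WithBot ℕ) := by
    rw [degree_eq_natDegree (mul_ne_zero X_ne_zero hN), natDegree_X_mul hN]
  have hDn : D.degree < n := by rw [← hNn]; exact hd
  have dCD : ∀ c : F, (C c * D).degree < n := by
    intro c
    by_cases hc : c = 0
    · rw [hc, C_0, zero_mul, degree_zero]; exact WithBot.bot_lt_coe _
    · rw [degree_C_mul hc]; exact hDn
  have dV0 : (X * N - C b * D).degree = ((n + 1 : ℕ) : WithBot ℕ) := by
    rw [degree_sub_eq_left_of_degree_lt, dXN]
    rw [dXN]; exact (dCD b).trans (by norm_cast; omega)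
  have dV : (N1 * N2).degree = ((2 * n + 2 : ℕ) : WithBot ℕ) := by
    rw [← kd' (N1 * N2), ← hV, degree_pow, dV0]
    norm_cast
  have nD : D.natDegree ≤ n := natDegree_le_of_degree_le hDn.le
  have nXD : (X * D).natDegree ≤ n := by
    have := dX D hDn
    by_cases h0 : X * D = 0
    · simp [h0]
    · rw [degree_eq_natDegree h0] at this
      norm_cast at this; omega
  have dU : (D1 * D2).natDegree ≤ 2 * n := by
    rw [← natDegree_eq_of_degree_eq (kd' (D1 * D2)), ← hU]
    refine natDegree_pow_le.trans ?_
    have : (N - X * D).natDegree ≤ n := natDegree_sub_le_of_le hn.ge nXD |>.trans (by simp)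
    omega
  have dW : (N1 * D2 + N2 * D1).natDegree ≤ 2 * n + 1 := by
    rw [← natDegree_eq_of_degree_eq (kd' (N1 * D2 + N2 * D1)), ← hW]
    have t1 : (N + X * D).natDegree ≤ n := natDegree_add_le_of_degree_le hn.ge nXD
    have t2 : (X * N + C b * D).natDegree ≤ n + 1 :=
      natDegree_add_le_of_degree_le (by rw [natDegree_X_mul hN])
        ((natDegree_C_mul_le _ _).trans (by omega))
    have t3 : (2 * C a * X * N * D).natDegree ≤ n + n := by
      have : 2 * C a * X * N * D = C (2 * a) * (N * (X * D)) := by simp [map_ofNat C 2]; ring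
      rw [this]
      exact (natDegree_C_mul_le _ _).trans (natDegree_mul_le.trans (by omega))
    have : ∀ P : F[X], (2 * P).natDegree ≤ P.natDegree := fun P => by
      have : (2 : F[X]) = C 2 := (map_ofNat C 2).symm
      rw [this]; exact natDegree_C_mul_le _ _
    refine (this _).trans ?_
    exact natDegree_add_le_of_degree_le (natDegree_mul_le.trans (by omega)) (by omega)
  have hA0 : N1 * N2 ≠ 0 := by intro h0; rw [h0, degree_zero] at dV; cases dV
  have hN1 : N1 ≠ 0 := left_ne_zero_of_mul hA0
  have hN2 : N2 ≠ 0 := right_ne_zero_of_mul hA0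
  have hsum : N1.natDegree + N2.natDegree = 2 * n + 2 := by
    rw [← natDegree_mul hN1 hN2]; exact natDegree_eq_of_degree_eq_some dV
  -- key
  have key : ∀ P1 P2 E1 E2 : F[X], P1 ≠ 0 → P2 ≠ 0 → P1.natDegree + P2.natDegree = 2 * n + 2 →
      (E1 * E2).natDegree ≤ 2 * n → (P1 * E2 + P2 * E1).natDegree ≤ 2 * n + 1 →
      E1.degree < P1.degree := by
    intro P1 P2 E1 E2 hP1 hP2 hs hE hB
    by_contra hlt
    push Not at hlt
    have hE1 : E1 ≠ 0 := by
      rintro rfl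
      rw [degree_zero, le_bot_iff, degree_eq_bot] at hlt; exact hP1 hlt
    have hle := natDegree_le_natDegree hlt
    have q1 : (P2 * E1).natDegree = P2.natDegree + E1.natDegree := natDegree_mul hP2 hE1
    by_cases hE2 : E2 = 0
    · rw [hE2, mul_zero, zero_add] at hB; omega
    · have q2 := natDegree_mul hP1 hE2
      have q3 := natDegree_mul hE1 hE2
      have : (P1 * E2).natDegree < (P2 * E1).natDegree := by omega
      have := natDegree_add_eq_right_of_natDegree_lt this
      omega
  refine ⟨key N1 N2 D1 D2 hN1 hN2 hsum dU dW, key N2 N1 D2 D1 hN2 hN1 (by omega)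
    (by rwa [mul_comm]) (by rwa [add_comm]), hsum⟩
end

end PartB

section PartC
open Polynomial

section
open WeierstrassCurve WeierstrassCurve.Affine

lemma sumRel_scale {R : Type*} [CommRing R] {a b t : R} {p pp pm p' pp' pm' : R × R} {u v w : R}
    (h : SumRel a b t p pp pm) (h1 : p'.1 = u * p.1) (h1' : p'.2 = u * p.2)
    (h2 : pp'.1 = v * pp.1) (h2' : pp'.2 = v * pp.2)
    (h3 : pm'.1 = w * pm.1) (h3' : pm'.2 = w * pm.2) : SumRel a b t p' pp' pm' := by
  obtain ⟨e1, e2, e3⟩ := h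
  simp only [SumRel, h1, h1', h2, h2', h3, h3']
  refine ⟨?_, ?_, ?_⟩
  · linear_combination v * w * u ^ 2 * e1
  · linear_combination v * w * u ^ 2 * e2
  · linear_combination v * w * u ^ 2 * e3

lemma sumRel_of_map {R S : Type*} [CommRing R] [CommRing S] (g : R →+* S)
    (hg : Function.Injective g) {a b t : R} {p pp pm : R × R}
    (h : SumRel (g a) (g b) (g t) (g p.1, g p.2) (g pp.1, g pp.2) (g pm.1, g pm.2)) :
    SumRel a b t p pp pm := by
  obtain ⟨e1, e2, e3⟩ := h
  refine ⟨hg ?_, hg ?_, hg ?_⟩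
  · simpa using e1
  · simpa [map_ofNat g 2] using e2
  · simpa [map_ofNat g 2] using e3

variable {F : Type*} [Field F]

/-- numerator and denominator of the reduced x-coordinate -/
noncomputable def nd {a b : RatFunc F} (l : RatFunc F) : (twCurve a b l).Point → F[X] × F[X]
  | .zero => (1, 0)
  | .some x _ _ => (RatFunc.num (x / l), RatFunc.denom (x / l))

lemma nd_coprime {a b l : RatFunc F} (P : (twCurve a b l).Point) :
    IsCoprime (nd l P).1 (nd l P).2 := by
  cases P with
  | zero => exact isCoprime_one_left
  | some x y h => exact RatFunc.isCoprime_num_denom _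

lemma nd_xr {a b l : RatFunc F} (P : (twCurve a b l).Point) :
    ∃ u : RatFunc F, algebraMap F[X] (RatFunc F) (nd l P).1 = u * (xr l P).1 ∧
      algebraMap F[X] (RatFunc F) (nd l P).2 = u * (xr l P).2 := by
  cases P with
  | zero => exact ⟨1, by simp [nd, xr], by simp [nd, xr]⟩
  | some x y h =>
    refine ⟨algebraMap F[X] (RatFunc F) (RatFunc.denom (x / l)), ?_, by simp [nd, xr]⟩
    simp only [nd, xr]
    have h0 : algebraMap F[X] (RatFunc F) (RatFunc.denom (x / l)) ≠ 0 :=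
      RatFunc.algebraMap_ne_zero (RatFunc.denom_ne_zero _)
    have h1 := RatFunc.num_div_denom (x / l)
    rw [div_eq_iff h0] at h1
    rw [h1, mul_comm]

lemma nd_of_xr {a b l : RatFunc F} (P : (twCurve a b l).Point) {N : RatFunc F}
    (h : xr l P = (N, 1)) : nd l P = (RatFunc.num N, RatFunc.denom N) := by
  cases P with
  | zero => simp [xr] at h
  | some x y h' =>
    simp only [xr, Prod.mk.injEq, and_true] at h
    simp only [nd, h]

noncomputable def fc (a b : F) : F[X] := X ^ 3 + C a * X ^ 2 + C b * X

variable [DecidableEq (RatFunc F)]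

local notation "ι" => algebraMap F[X] (RatFunc F)

lemma height_rec {a b : F} (h2 : (2 : F) ≠ 0) (hb : b ≠ 0) (hab : a ^ 2 ≠ 4 * b)
    (hl : ι (fc a b) ≠ 0)
    (hQ : (twCurve (ι (C a)) (ι (C b)) (ι (fc a b))).Nonsingular
      (ι (fc a b) * ι X) (ι (fc a b) ^ 2))
    (P : (twCurve (ι (C a)) (ι (C b)) (ι (fc a b))).Point)
    (hP : (nd _ P).2.degree < (nd _ P).1.degree) (n : ℤ) :
    (nd _ (P + (n + 1) • .some _ _ hQ)).1.natDegree +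
    (nd _ (P + (n - 1) • .some _ _ hQ)).1.natDegree =
      2 * (nd _ (P + n • .some _ _ hQ)).1.natDegree + 2 := by
  set Q := Point.some _ _ hQ with hQdef
  have h2K : (2 : RatFunc F) ≠ 0 := by
    have : (2 : RatFunc F) = ι (C 2) := by
      rw [map_ofNat C 2, map_ofNat]
    rw [this]
    exact RatFunc.algebraMap_ne_zero (C_ne_zero.2 h2)
  have step : ∀ P : (twCurve (ι (C a)) (ι (C b)) (ι (fc a b))).Point,
      (nd _ P).2.degree < (nd _ P).1.degree →
      (nd _ (P + Q)).2.degree < (nd _ (P + Q)).1.degree ∧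
      (nd _ (P - Q)).2.degree < (nd _ (P - Q)).1.degree ∧
      (nd _ (P + Q)).1.natDegree + (nd _ (P - Q)).1.natDegree = 2 * (nd _ P).1.natDegree + 2 := by
    intro P hP
    refine poly_step h2 hb hab (nd_coprime P) (nd_coprime (P + Q)) (nd_coprime (P - Q)) ?_ hP
    apply sumRel_of_map ι (RatFunc.algebraMap_injective F)
    obtain ⟨u, e1, e1'⟩ := nd_xr P
    obtain ⟨v, e2, e2'⟩ := nd_xr (P + Q)
    obtain ⟨w, e3, e3'⟩ := nd_xr (P - Q)
    refine sumRel_scale (sumRel_main h2K hl (by simp [fc]) hQ P) e1 e1' e2 e2' e3 e3'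
  have hsub : ∀ n : ℤ, P + n • Q - Q = P + (n - 1) • Q := by
    intro n; rw [sub_zsmul, one_zsmul, add_sub_assoc, sub_eq_add_neg]
  have all : ∀ n : ℤ, (nd _ (P + n • Q)).2.degree < (nd _ (P + n • Q)).1.degree := by
    intro n
    induction n using Int.induction_on with
    | zero => rw [zero_zsmul, add_zero]; exact hP
    | succ i ih =>
      have := (step _ ih).1
      rwa [add_assoc, ← add_one_zsmul] at this
    | pred i ih =>
      have := (step _ ih).2.1
      rwa [hsub] at this
  have := (step _ (all n)).2.2
  rwa [add_assoc, ← add_one_zsmul, hsub] at this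
end

lemma numeric {h : ℤ → ℕ} {q S : ℤ} (hr : ∀ n, h (n + 1) + h (n - 1) = 2 * h n + 2)
    (h0 : (h 0 : ℤ) = q) (h1 : (h 1 : ℤ) ≤ q + 1 - S) (h1' : (h (-1) : ℤ) ≤ q + 1 + S) :
    S ^ 2 ≤ 4 * q + 1 := by
  have e1 : (h 1 : ℤ) = q + 1 - S := by
    have := hr 0
    simp only [zero_add, zero_sub] at this
    omega
  have e2 : (h (-1) : ℤ) = q + 1 + S := by
    have := hr 0
    simp only [zero_add, zero_sub] at this
    omega
  have hrz : ∀ n, (h (n + 1) : ℤ) + h (n - 1) = 2 * h n + 2 := fun n => by exact_mod_cast hr n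
  have key : ∀ n : ℤ, (h n : ℤ) = n ^ 2 - S * n + q ∧ (h (n + 1) : ℤ) = (n + 1) ^ 2 - S * (n + 1) + q := by
    intro n
    induction n using Int.induction_on with
    | zero => constructor <;> simp <;> linarith
    | succ i ih =>
      refine ⟨ih.2, ?_⟩
      have := hrz (i + 1)
      rw [add_sub_cancel_right] at this
      linear_combination this + 2 * ih.2 - ih.1
    | pred i ih =>
      have := hrz (-i)
      rw [sub_add_cancel]
      refine ⟨?_, ih.1⟩
      linear_combination this + 2 * ih.1 - ih.2
  rcases Int.even_or_odd' S with ⟨k, hk | hk⟩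
  · have := (key k).1
    have : (0 : ℤ) ≤ h k := by positivity
    nlinarith
  · have := (key k).1
    have : (0 : ℤ) ≤ h k := by positivity
    nlinarith

end PartC

section PartD
open Polynomial

section
open WeierstrassCurve WeierstrassCurve.Affine
variable {F : Type*} [Field F] [Fintype F] [DecidableEq F]

noncomputable def Zp (s : Finset F) : F[X] := ∏ x ∈ s, (X - C x)

lemma Zp_dvd {s : Finset F} {p : F[X]} (h : ∀ x ∈ s, p.eval x = 0) : Zp s ∣ p := by
  refine Finset.prod_dvd_of_coprime ?_ ?_
  · intro x _ y _ hxy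
    exact pairwise_coprime_X_sub_C Function.injective_id hxy
  · intro x hx
    exact dvd_iff_isRoot.2 (h x hx)

lemma Zp_natDegree (s : Finset F) : (Zp s).natDegree = s.card := by
  simp [Zp, natDegree_finsetProd_X_sub_C_eq_card]

lemma Zp_monic (s : Finset F) : (Zp s).Monic := monic_prod_X_sub_C _ _

lemma fc_eval (a b x : F) : (fc a b).eval x = x ^ 3 + a * x ^ 2 + b * x := by simp [fc]

lemma fc_natDegree (a b : F) : (fc a b).natDegree = 3 := by
  unfold fc; compute_degree!

lemma fc_pow_card (a b : F) : (fc a b) ^ Fintype.card F =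
    (X ^ Fintype.card F) ^ 3 + C a * (X ^ Fintype.card F) ^ 2 + C b * X ^ Fintype.card F := by
  rw [← FiniteField.expand_card]
  simp [fc]

/-- The unreduced numerator. -/
noncomputable def Rp (a b : F) (e : F) : F[X] :=
  fc a b * (fc a b ^ (Fintype.card F / 2) - C e) ^ 2 -
    (C a + X ^ Fintype.card F + X) * (X ^ Fintype.card F - X) ^ 2

lemma Rp_natDegree (hF : ringChar F ≠ 2) (a b e : F) :
    (Rp a b e).natDegree ≤ 2 * Fintype.card F + 1 := by
  have hodd := FiniteField.odd_card_of_char_ne_two hF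
  have hq : 1 < Fintype.card F := Fintype.one_lt_card
  have h1 := fc_pow_card a b
  set q := Fintype.card F with hqd
  set k := q / 2 with hk
  have hqk : q = 2 * k + 1 := by omega
  have h1' : fc a b * (fc a b ^ k) ^ 2 = fc a b ^ q := by rw [hqk]; ring
  have : Rp a b e = C b * X ^ q + C (e ^ 2) * fc a b - C (2 * e) * fc a b ^ (k + 1) +
      C (2 * a) * X ^ (q + 1) - C a * X ^ 2 + X ^ (2 * q + 1) + X ^ (q + 2) - X ^ 3 := by
    simp only [Rp, ← hqd, ← hk, C_mul, C_pow, map_ofNat C 2]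
    linear_combination h1' + h1
  rw [this]
  have d := fc_natDegree a b
  have c1 : (C (e ^ 2) * fc a b).natDegree ≤ 2 * q + 1 :=
    (natDegree_C_mul_le _ _).trans (by omega)
  have c2 : (C (2 * e) * fc a b ^ (k + 1)).natDegree ≤ 2 * q + 1 :=
    (natDegree_C_mul_le _ _).trans (natDegree_pow_le.trans (by rw [d]; omega))
  have c3 : ∀ (c : F) (n : ℕ), n ≤ 2 * q + 1 → (C c * X ^ n).natDegree ≤ 2 * q + 1 :=
    fun c n hn => (natDegree_C_mul_X_pow_le c n).trans hn
  have c4 : ∀ (n : ℕ), n ≤ 2 * q + 1 → (X ^ n : F[X]).natDegree ≤ 2 * q + 1 :=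
    fun n hn => (natDegree_X_pow_le n).trans hn
  have add : ∀ {p r : F[X]}, p.natDegree ≤ 2 * q + 1 → r.natDegree ≤ 2 * q + 1 →
    (p + r).natDegree ≤ 2 * q + 1 := fun h h' => natDegree_add_le_of_degree_le h h'
  have sub : ∀ {p r : F[X]}, p.natDegree ≤ 2 * q + 1 → r.natDegree ≤ 2 * q + 1 →
    (p - r).natDegree ≤ 2 * q + 1 := fun h h' => natDegree_sub_le_of_le h h' |>.trans (by simp)
  exact sub (add (add (sub (add (sub (add (c3 _ _ (by omega)) c1) c2) (c3 _ _ (by omega)))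
    (c3 _ _ (by omega))) (c4 _ (by omega))) (c4 _ (by omega))) (c4 _ (by omega))

lemma height_bound (hF : ringChar F ≠ 2) (a b : F) (e : ℤ) (he : e = 1 ∨ e = -1) :
    (RatFunc.num (algebraMap F[X] (RatFunc F) (Rp a b e) /
      algebraMap F[X] (RatFunc F) ((X ^ Fintype.card F - X) ^ 2))).natDegree ≤
      Fintype.card F + 1 - e * ∑ x : F, quadraticChar F ((fc a b).eval x) := by
  have hq : 1 < Fintype.card F := Fintype.one_lt_card
  have hRd := Rp_natDegree hF a b e
  set q := Fintype.card F with hqd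
  set χ := quadraticChar F with hχ
  set s := Finset.univ.filter (fun x => χ ((fc a b).eval x) = e) with hs
  set s0 := Finset.univ.filter (fun x => χ ((fc a b).eval x) = 0) with hs0
  have hT0 : (X ^ q - X : F[X]) ≠ 0 := FiniteField.X_pow_card_sub_X_ne_zero F hq
  have hd : Disjoint s s0 := by
    rw [Finset.disjoint_left]
    intro x hx hx0
    simp only [hs, hs0, Finset.mem_filter, Finset.mem_univ, true_and] at hx hx0
    omega
  have hT : Zp s * Zp s0 ∣ X ^ q - X := by
    have : Zp s * Zp s0 = Zp (s ∪ s0) := by simp only [Zp]; rw [Finset.prod_union hd]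
    rw [this]
    apply Zp_dvd
    intro x _
    simp [hqd, FiniteField.pow_card]
  have hf : Zp s0 ∣ fc a b := by
    apply Zp_dvd
    intro x hx
    simp only [hs0, Finset.mem_filter, Finset.mem_univ, true_and] at hx
    exact quadraticChar_eq_zero_iff.1 hx
  have hfk : Zp s ∣ fc a b ^ (q / 2) - C (e : F) := by
    apply Zp_dvd
    intro x hx
    simp only [hs, Finset.mem_filter, Finset.mem_univ, true_and] at hx
    have := quadraticChar_eq_pow_of_char_ne_two' hF ((fc a b).eval x)
    rw [← hχ, hx] at this
    simp only [eval_sub, eval_pow, eval_C, this, sub_self, hqd]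
  have hT2 : Zp s ^ 2 * Zp s0 ∣ (X ^ q - X) ^ 2 := by
    refine dvd_trans ?_ (pow_dvd_pow_of_dvd hT 2)
    exact ⟨Zp s0, by ring⟩
  have hR : Zp s ^ 2 * Zp s0 ∣ Rp a b e := by
    unfold Rp
    refine dvd_sub ?_ (dvd_mul_of_dvd_right hT2 _)
    rw [mul_comm]
    exact mul_dvd_mul hf (pow_dvd_pow_of_dvd hfk 2)
  have hcm : (Zp s ^ 2 * Zp s0).Monic := ((Zp_monic s).pow 2).mul (Zp_monic s0)
  have hdeg : (Zp s ^ 2 * Zp s0).natDegree = 2 * s.card + s0.card := by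
    rw [((Zp_monic s).pow 2).natDegree_mul (Zp_monic s0), (Zp_monic s).natDegree_pow,
      Zp_natDegree, Zp_natDegree]
  have hcard : (2 * s.card + s0.card : ℤ) = q + e * ∑ x : F, χ ((fc a b).eval x) := by
    have e1 : (s.card : ℤ) = ∑ x : F, if χ ((fc a b).eval x) = e then 1 else 0 := by
      rw [hs, Finset.card_filter]; push_cast; rfl
    have e2 : (s0.card : ℤ) = ∑ x : F, if χ ((fc a b).eval x) = 0 then 1 else 0 := by
      rw [hs0, Finset.card_filter]; push_cast; rfl
    have e3 : (q : ℤ) = ∑ x : F, 1 := by simp [hqd]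
    rw [e1, e2, e3, Finset.mul_sum, Finset.mul_sum, ← Finset.sum_add_distrib,
      ← Finset.sum_add_distrib]
    refine Finset.sum_congr rfl fun x _ => ?_
    have h3 : χ ((fc a b).eval x) = 0 ∨ χ ((fc a b).eval x) = 1 ∨ χ ((fc a b).eval x) = -1 := by
      by_cases h0 : (fc a b).eval x = 0
      · left; rw [h0]; exact quadraticChar_zero
      · right; exact quadraticChar_dichotomy h0
    rcases h3 with h | h | h <;> rcases he with rfl | rfl <;> simp [h]
  have hsc : s.card + s0.card ≤ q := by
    rw [← Finset.card_union_of_disjoint hd]; exact Finset.card_le_univ _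
  have hsc' : s.card ≤ q := by omega
  obtain ⟨T', hT'⟩ := hT2
  obtain ⟨R', hR'⟩ := hR
  have hT'0 : T' ≠ 0 := by
    rintro rfl
    rw [mul_zero] at hT'
    exact hT0 (pow_eq_zero_iff two_ne_zero |>.1 hT')
  have : algebraMap F[X] (RatFunc F) (Rp a b e) /
      algebraMap F[X] (RatFunc F) ((X ^ q - X) ^ 2) =
      algebraMap F[X] (RatFunc F) R' / algebraMap F[X] (RatFunc F) T' := by
    rw [hR', hT', map_mul _ _ R', map_mul _ _ T', mul_div_mul_left]
    exact RatFunc.algebraMap_ne_zero hcm.ne_zero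
  rw [this]
  have hdv := RatFunc.num_div_dvd R' hT'0
  have hle : (RatFunc.num (algebraMap F[X] (RatFunc F) R' / algebraMap F[X] (RatFunc F) T')).natDegree
      + (2 * s.card + s0.card) ≤ 2 * q + 1 := by
    by_cases h0 : R' = 0
    · rw [h0]; simp; omega
    · have h1 := natDegree_le_of_dvd hdv h0
      have h2 : (Rp a b e).natDegree = 2 * s.card + s0.card + R'.natDegree := by
        rw [hR', hcm.natDegree_mul' h0, hdeg]
      omega
  omega

theorem hasse_bound (hF : ringChar F ≠ 2) {a b : F} (hb : b ≠ 0) (hab : a ^ 2 ≠ 4 * b) :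
    (∑ x : F, quadraticChar F (x ^ 3 + a * x ^ 2 + b * x)) ^ 2 ≤ 4 * (Fintype.card F : ℤ) + 1 := by
  classical
  have h2 : (2 : F) ≠ 0 := Ring.two_ne_zero hF
  set ι := algebraMap F[X] (RatFunc F) with hι
  have hf0 : fc a b ≠ 0 := by
    intro h
    have := fc_natDegree a b
    rw [h] at this; simp at this
  have hl : ι (fc a b) ≠ 0 := RatFunc.algebraMap_ne_zero hf0
  have hodd := FiniteField.odd_card_of_char_ne_two hF
  have hq : 1 < Fintype.card F := Fintype.one_lt_card
  set q := Fintype.card F with hqd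
  set k := q / 2 with hk
  have hqk : q = 2 * k + 1 := by omega
  have h2K : (2 : RatFunc F) ≠ 0 := by
    have : (2 : RatFunc F) = ι (C 2) := by rw [map_ofNat C 2, map_ofNat]
    rw [this]
    exact RatFunc.algebraMap_ne_zero (C_ne_zero.2 h2)
  have hQ : (twCurve (ι (C a)) (ι (C b)) (ι (fc a b))).Nonsingular
      (ι (fc a b) * ι X) (ι (fc a b) ^ 2) := by
    rw [nonsingular_iff', equation_iff]
    refine ⟨?_, Or.inr ?_⟩
    · simp only [twCurve]
      have : ι (fc a b) = ι X ^ 3 + ι (C a) * ι X ^ 2 + ι (C b) * ι X := by simp [fc]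
      linear_combination ι (fc a b) ^ 3 * this
    · simp only [twCurve, zero_mul, add_zero]
      exact mul_ne_zero h2K (pow_ne_zero 2 hl)
  have hfq : ι (fc a b) ^ q = (ι X ^ q) ^ 3 + ι (C a) * (ι X ^ q) ^ 2 + ι (C b) * ι X ^ q := by
    have := congrArg ι (fc_pow_card a b)
    simpa using this
  have hP : (twCurve (ι (C a)) (ι (C b)) (ι (fc a b))).Nonsingular
      (ι (fc a b) * ι X ^ q) (ι (fc a b) ^ 2 * ι (fc a b) ^ k) := by
    rw [nonsingular_iff', equation_iff]
    refine ⟨?_, Or.inr ?_⟩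
    · simp only [twCurve]
      have e1 : ι (fc a b) ^ q = ι (fc a b) * (ι (fc a b) ^ k) ^ 2 := by rw [hqk]; ring
      rw [e1] at hfq
      linear_combination ι (fc a b) ^ 3 * hfq
    · simp only [twCurve, zero_mul, add_zero]
      exact mul_ne_zero h2K (mul_ne_zero (pow_ne_zero 2 hl) (pow_ne_zero k hl))
  set Q := Point.some _ _ hQ with hQd
  set P := Point.some _ _ hP with hPd
  have hndP : nd _ P = (X ^ q, 1) := by
    have : xr _ P = (ι (X ^ q), 1) := by
      rw [hPd, xr_some, mul_div_cancel_left₀ _ hl, map_pow]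
    rw [nd_of_xr P this, hι, RatFunc.num_algebraMap, RatFunc.denom_algebraMap]
  have hne : ι X ^ q ≠ ι X := by
    rw [← map_pow]
    intro h
    have := RatFunc.algebraMap_injective F h
    exact FiniteField.X_pow_card_sub_X_ne_zero F hq (sub_eq_zero.2 this)
  have hn1 : nd _ (P + Q) = (RatFunc.num (ι (Rp a b (1 : ℤ)) / ι ((X ^ q - X) ^ 2)),
      RatFunc.denom (ι (Rp a b (1 : ℤ)) / ι ((X ^ q - X) ^ 2))) := by
    apply nd_of_xr
    rw [hPd, hQd, xr_add hl hP hQ rfl rfl rfl (mul_one _).symm hne]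
    simp [Rp, hqd, hk]
  have hn2 : nd _ (P - Q) = (RatFunc.num (ι (Rp a b (-1 : ℤ)) / ι ((X ^ q - X) ^ 2)),
      RatFunc.denom (ι (Rp a b (-1 : ℤ)) / ι ((X ^ q - X) ^ 2))) := by
    apply nd_of_xr
    rw [hPd, hQd, sub_eq_add_neg, Point.neg_some,
      xr_add (e := -1) hl hP _ rfl rfl rfl (by simp [negY, twCurve]) hne]
    simp [Rp, hqd, hk]
  have hrec := height_rec h2 hb hab hl hQ P (by
    rw [hndP, degree_X_pow, degree_one]; exact_mod_cast (by omega : 0 < q))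
  have b1 := height_bound hF a b 1 (Or.inl rfl)
  have b2 := height_bound hF a b (-1) (Or.inr rfl)
  simp only [fc_eval] at b1 b2
  refine numeric (h := fun n => (nd _ (P + n • Q)).1.natDegree) hrec ?_ ?_ ?_
  · simp only [zero_zsmul, add_zero, hndP, natDegree_X_pow]
  · simp only [one_zsmul, hn1]
    linarith
  · simp only [neg_zsmul, one_zsmul, ← sub_eq_add_neg, hn2]
    linarith
end

end PartD

section PartE
section
variable {F : Type*} [Field F] [Fintype F] [DecidableEq F]

lemma sum_shift {M : Type*} [AddCommMonoid M] (f : F → M) (c : F) : ∑ x, f x = ∑ x, f (x + c) :=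
  (Equiv.sum_comp (Equiv.addRight c) f).symm

lemma cubic_bound (hF : ringChar F ≠ 2) {α β γ : F} (c : F) (h1 : α ≠ β) (h2 : α ≠ γ) (h3 : β ≠ γ) :
    (∑ x : F, quadraticChar F (c * ((x - α) * (x - β) * (x - γ)))) ^ 2 ≤
      4 * (Fintype.card F : ℤ) + 1 := by
  have key : (∑ x : F, quadraticChar F ((x - α) * (x - β) * (x - γ))) ^ 2 ≤
      4 * (Fintype.card F : ℤ) + 1 := by
    rw [sum_shift _ α]
    have := hasse_bound hF (a := -((β - α) + (γ - α))) (b := (β - α) * (γ - α))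
      (mul_ne_zero (sub_ne_zero.2 h1.symm) (sub_ne_zero.2 h2.symm)) (by
        intro h
        apply h3
        have : (β - γ) ^ 2 = 0 := by linear_combination h
        exact sub_eq_zero.1 (pow_eq_zero_iff two_ne_zero |>.1 this))
    convert this using 4 with x
    ring
  simp only [map_mul (quadraticChar F) c, ← Finset.mul_sum]
  rw [mul_pow]
  by_cases hc : c = 0
  · rw [hc, quadraticChar_zero]; simp; positivity
  · rw [quadraticChar_sq_one hc, one_mul]; exact key

lemma sum_lin (hF : ringChar F ≠ 2) {a : F} (b : F) (ha : a ≠ 0) :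
    ∑ x : F, quadraticChar F (b - a * x) = 0 := by
  rw [← quadraticChar_sum_zero hF]
  exact Equiv.sum_comp ((Equiv.mulLeft₀ a ha).trans (Equiv.subLeft b)) (quadraticChar F)

lemma conic_sum (hF : ringChar F ≠ 2) {α β : F} (h : α ≠ β) :
    ∑ x : F, quadraticChar F ((x - α) * (x - β)) = -1 := by
  rw [sum_shift _ α]
  have hc : β - α ≠ 0 := sub_ne_zero.2 h.symm
  have e : ∀ x : F, quadraticChar F ((x + α - α) * (x + α - β)) =
      quadraticChar F (1 - (β - α) * x⁻¹) - if x = 0 then 1 else 0 := by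
    intro x
    by_cases hx : x = 0
    · simp [hx]
    · rw [if_neg hx, sub_zero]
      have : (x + α - α) * (x + α - β) = x ^ 2 * (1 - (β - α) * x⁻¹) := by field_simp; ring
      rw [this, map_mul, quadraticChar_sq_one' hx, one_mul]
  simp only [e, Finset.sum_sub_distrib]
  have := Equiv.sum_comp (Equiv.inv F) (fun x => quadraticChar F (1 - (β - α) * x))
  simp only [Equiv.inv_apply] at this
  rw [this, sum_lin hF 1 hc]
  simp

lemma quartic_bound (hF : ringChar F ≠ 2) {m : F} (h3 : (3 : F) ≠ 0) (hm0 : m ≠ 0) (hm1 : m ≠ 1)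
    (hm9 : 9 * m ≠ 1) (hm81 : 81 * m ≠ 1) :
    (1 + ∑ x : F, quadraticChar F ((1 - x) * (1 - 9 * x) * ((x - m) * (x - 9 * m)))) ^ 2 ≤
      4 * (Fintype.card F : ℤ) + 1 := by
  have h2 : (2 : F) ≠ 0 := Ring.two_ne_zero hF
  have h8 : (8 : F) ≠ 0 := by
    have : (8 : F) = 2 ^ 3 := by norm_num
    rw [this]; exact pow_ne_zero 3 h2
  have k1 : 1 - m ≠ 0 := sub_ne_zero.2 hm1.symm
  have k9 : 1 - 9 * m ≠ 0 := sub_ne_zero.2 hm9.symm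
  have e0 := Equiv.sum_comp ((Equiv.inv F).trans (Equiv.addLeft 1))
    (fun x : F => quadraticChar F ((1 - x) * (1 - 9 * x) * ((x - m) * (x - 9 * m))))
  rw [← e0]
  have e : ∀ u : F, quadraticChar F ((1 - (1 + u⁻¹)) * (1 - 9 * (1 + u⁻¹)) *
      ((1 + u⁻¹ - m) * (1 + u⁻¹ - 9 * m))) =
      quadraticChar F (8 * (1 - m) * (1 - 9 * m) *
        ((u - (-(9 / 8))) * (u - (-(1 / (1 - m)))) * (u - (-(1 / (1 - 9 * m)))))) -
      if u = 0 then 1 else 0 := by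
    intro u
    have e1 : 8 * (1 - m) * (1 - 9 * m) *
        ((u - (-(9 / 8))) * (u - (-(1 / (1 - m)))) * (u - (-(1 / (1 - 9 * m))))) =
        (8 * u + 9) * ((1 - m) * u + 1) * ((1 - 9 * m) * u + 1) := by
      have r1 : 8 * (u - (-(9 / 8))) = 8 * u + 9 := by field_simp; ring
      have r2 : (1 - m) * (u - (-(1 / (1 - m)))) = (1 - m) * u + 1 := by
        rw [sub_neg_eq_add, mul_add, mul_one_div_cancel k1]
      have r3 : (1 - 9 * m) * (u - (-(1 / (1 - 9 * m)))) = (1 - 9 * m) * u + 1 := by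
        rw [sub_neg_eq_add, mul_add, mul_one_div_cancel k9]
      rw [← r1, ← r2, ← r3]; ring
    rw [e1]
    by_cases hu : u = 0
    · have : quadraticChar F 9 = 1 := by
        have : (9 : F) = 3 ^ 2 := by norm_num
        rw [this, quadraticChar_sq_one' h3]
      simp [hu, this]
    · rw [if_neg hu, sub_zero]
      have : (1 - (1 + u⁻¹)) * (1 - 9 * (1 + u⁻¹)) * ((1 + u⁻¹ - m) * (1 + u⁻¹ - 9 * m)) =
        ((u⁻¹) ^ 2) ^ 2 * ((8 * u + 9) * ((1 - m) * u + 1) * ((1 - 9 * m) * u + 1)) := by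
        field_simp; ring
      rw [this, map_mul, quadraticChar_sq_one' (pow_ne_zero 2 (inv_ne_zero hu)), one_mul]
  simp only [Equiv.trans_apply, Equiv.inv_apply, Equiv.coe_addLeft, e, Finset.sum_sub_distrib]
  simp only [Finset.sum_ite_eq', Finset.mem_univ, if_true]
  rw [add_sub_cancel]
  apply cubic_bound hF
  · rw [Ne, neg_inj, div_eq_div_iff h8 k1]
    intro h; apply hm9; linear_combination -h
  · rw [Ne, neg_inj, div_eq_div_iff h8 k9]
    intro h; apply hm81; linear_combination -h
  · rw [Ne, neg_inj, div_eq_div_iff k1 k9]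
    intro h
    have : 8 * m = 0 := by linear_combination -h
    exact mul_ne_zero h8 hm0 this

lemma small_of_sq {q s : ℤ} (hq : 434 ≤ q) (h : s ^ 2 ≤ 4 * q + 1) : 3 * s ≤ q - 241 ∧ -(q - 241) ≤ 3 * s := by
  constructor
  · by_contra hc
    push Not at hc
    nlinarith
  · by_contra hc
    push Not at hc
    nlinarith

lemma exists_good (hF : ringChar F ≠ 2) {m : F} (h3 : (3 : F) ≠ 0) (hm0 : m ≠ 0) (hm1 : m ≠ 1)
    (hm9 : 9 * m ≠ 1) (hm81 : 81 * m ≠ 1) (hq : 434 ≤ Fintype.card F)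
    (s : Finset F) (hs : s.card ≤ 30) :
    ∃ x, x ∉ s ∧ quadraticChar F (1 - x) ≠ 1 ∧ quadraticChar F (1 - 9 * x) ≠ -1 ∧
      quadraticChar F ((x - m) * (x - 9 * m)) ≠ 1 := by
  have h2 : (2 : F) ≠ 0 := Ring.two_ne_zero hF
  have h8 : (8 : F) ≠ 0 := by
    have : (8 : F) = 2 ^ 3 := by norm_num
    rw [this]; exact pow_ne_zero 3 h2
  have h9 : (9 : F) ≠ 0 := by
    have : (9 : F) = 3 ^ 2 := by norm_num
    rw [this]; exact pow_ne_zero 2 h3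
  have hm99 : m ≠ 9 * m := by
    intro h
    have : 8 * m = 0 := by linear_combination -h
    exact mul_ne_zero h8 hm0 this
  by_contra hno
  push Not at hno
  have hq' : (434 : ℤ) ≤ Fintype.card F := by exact_mod_cast hq
  set χ := quadraticChar F with hχ
  have tri : ∀ y : F, χ y = 0 ∨ χ y = 1 ∨ χ y = -1 := by
    intro y
    by_cases h0 : y = 0
    · left; rw [h0]; exact quadraticChar_zero
    · right; exact quadraticChar_dichotomy h0
  have sD : ∑ x : F, χ (1 - x) = 0 := by
    have := sum_lin hF (1 : F) one_ne_zero
    simpa only [one_mul] using this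
  have sF : ∑ x : F, χ (1 - 9 * x) = 0 := sum_lin hF (1 : F) h9
  have sC : ∑ x : F, χ ((x - m) * (x - 9 * m)) = -1 := conic_sum hF hm99
  have sDF : ∑ x : F, χ (1 - x) * χ (1 - 9 * x) = -1 := by
    rw [← conic_sum hF (α := (1 : F)) (β := 1 / 9) (by
      rw [Ne, eq_div_iff h9]; intro h; apply h8; linear_combination h)]
    refine Finset.sum_congr rfl fun x _ => ?_
    have : (1 - x) * (1 - 9 * x) = 3 ^ 2 * ((x - 1) * (x - 1 / 9)) := by field_simp; ring
    rw [← map_mul, this, map_mul, quadraticChar_sq_one' h3, one_mul]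
  have sDC : (∑ x : F, χ (1 - x) * χ ((x - m) * (x - 9 * m))) ^ 2 ≤
      4 * (Fintype.card F : ℤ) + 1 := by
    convert cubic_bound hF (α := 1) (β := m) (γ := 9 * m) (-1) hm1.symm hm9.symm hm99 using 4 with x
    rw [← map_mul]; congr 1; ring
  have sFC : (∑ x : F, χ (1 - 9 * x) * χ ((x - m) * (x - 9 * m))) ^ 2 ≤
      4 * (Fintype.card F : ℤ) + 1 := by
    convert cubic_bound hF (α := 1 / 9) (β := m) (γ := 9 * m) (-9)
      (by rw [Ne, div_eq_iff h9]; intro h; apply hm9; linear_combination -h)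
      (by rw [Ne, div_eq_iff h9]; intro h; apply hm81; linear_combination -h) hm99 using 4 with x
    rw [← map_mul]; congr 1; field_simp; ring
  have sDFC := quartic_bound hF h3 hm0 hm1 hm9 hm81
  simp only [map_mul χ ((1 - _) * (1 - 9 * _)), map_mul χ (1 - _) (1 - 9 * _), ← hχ] at sDFC
  have b1 := small_of_sq hq' sDC
  have b2 := small_of_sq hq' sFC
  have b3 := small_of_sq hq' sDFC
  have total : ∑ x : F, (1 - χ (1 - x)) * (1 + χ (1 - 9 * x)) * (1 - χ ((x - m) * (x - 9 * m))) =
      Fintype.card F - ∑ x : F, χ (1 - x) + ∑ x : F, χ (1 - 9 * x)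
      - ∑ x : F, χ ((x - m) * (x - 9 * m)) - ∑ x : F, χ (1 - x) * χ (1 - 9 * x)
      + ∑ x : F, χ (1 - x) * χ ((x - m) * (x - 9 * m))
      - ∑ x : F, χ (1 - 9 * x) * χ ((x - m) * (x - 9 * m))
      + ∑ x : F, χ (1 - x) * χ (1 - 9 * x) * χ ((x - m) * (x - 9 * m)) := by
    have : (Fintype.card F : ℤ) = ∑ x : F, 1 := by simp
    rw [this]
    simp only [← Finset.sum_sub_distrib, ← Finset.sum_add_distrib]
    refine Finset.sum_congr rfl fun x _ => ?_
    ring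
  have upper : ∑ x : F, (1 - χ (1 - x)) * (1 + χ (1 - 9 * x)) * (1 - χ ((x - m) * (x - 9 * m))) ≤
      ∑ x : F, if x ∈ s then 8 else 0 := by
    refine Finset.sum_le_sum fun x _ => ?_
    by_cases hx : x ∈ s
    · rw [if_pos hx]
      rcases tri (1 - x) with h | h | h <;> rcases tri (1 - 9 * x) with h' | h' | h' <;>
        rcases tri ((x - m) * (x - 9 * m)) with h'' | h'' | h'' <;> rw [h, h', h''] <;> norm_num
    · rw [if_neg hx]
      have := hno x hx
      by_cases g1 : χ (1 - x) = 1
      · rw [g1]; simp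
      · by_cases g2 : χ (1 - 9 * x) = -1
        · rw [g2]; simp
        · rw [this g1 g2]; simp
  have hcount : (∑ x : F, if x ∈ s then (8 : ℤ) else 0) = s.card * 8 := by
    simp
  have hs' : (s.card : ℤ) ≤ 30 := by exact_mod_cast hs
  linarith [b1.1, b1.2, b2.1, b2.2, b3.1, b3.2]

lemma lin_list (L : List (F × F)) (hL : ∀ p ∈ L, p.1 ≠ 0 ∨ p.2 ≠ 0) :
    ∃ s : Finset F, s.card ≤ L.length ∧ ∀ p ∈ L, ∀ x, p.1 * x + p.2 = 0 → x ∈ s := by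
  induction L with
  | nil => exact ⟨∅, by simp, by simp⟩
  | cons p L ih =>
    obtain ⟨s, hs, h⟩ := ih (fun p hp => hL p (List.mem_cons_of_mem _ hp))
    refine ⟨insert (-p.2 / p.1) s, (Finset.card_insert_le _ _).trans (by simpa using hs), ?_⟩
    intro r hr x hx
    rcases List.mem_cons.1 hr with rfl | hr
    · apply Finset.mem_insert.2; left
      have h0 : r.1 ≠ 0 := by
        intro h0
        rw [h0, zero_mul, zero_add] at hx
        rcases hL r (by simp) with h | h
        · exact h h0
        · exact h hx
      rw [eq_div_iff h0]; linear_combination hx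
    · exact Finset.mem_insert_of_mem (h r hr x hx)

open Polynomial in
lemma quad_list (L : List (F × F × F)) (hL : ∀ p ∈ L, p.1 ≠ 0) :
    ∃ s : Finset F, s.card ≤ 2 * L.length ∧
      ∀ p ∈ L, ∀ x, p.1 * x ^ 2 + p.2.1 * x + p.2.2 = 0 → x ∈ s := by
  induction L with
  | nil => exact ⟨∅, by simp, by simp⟩
  | cons p L ih =>
    obtain ⟨s, hs, h⟩ := ih (fun p hp => hL p (List.mem_cons_of_mem _ hp))
    have hp := hL p (by simp)
    have hd : (C p.1 * X ^ 2 + C p.2.1 * X + C p.2.2).natDegree = 2 := natDegree_quadratic hp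
    have h0 : (C p.1 * X ^ 2 + C p.2.1 * X + C p.2.2) ≠ 0 := by
      intro h0; rw [h0] at hd; simp at hd
    refine ⟨(C p.1 * X ^ 2 + C p.2.1 * X + C p.2.2).roots.toFinset ∪ s, ?_, ?_⟩
    · refine (Finset.card_union_le _ _).trans ?_
      have h1 := Multiset.toFinset_card_le (C p.1 * X ^ 2 + C p.2.1 * X + C p.2.2).roots
      have h2 := card_roots' (C p.1 * X ^ 2 + C p.2.1 * X + C p.2.2)
      rw [hd] at h2
      simp only [List.length_cons]
      omega
    · intro r hr x hx
      rcases List.mem_cons.1 hr with rfl | hr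
      · apply Finset.mem_union_left
        rw [Multiset.mem_toFinset, mem_roots h0]
        simpa [IsRoot] using hx
      · exact Finset.mem_union_right _ (h r hr x hx)
end

end PartE

section PartG
lemma ap_cases {F : Type*} [Field F] {x xi m mi a b c va vb vc : F}
    (h2 : (2 : F) ≠ 0) (h3 : (3 : F) ≠ 0) (hxi : x * xi = 1) (hmi : m * mi = 1)
    (hm : m = 3 ∨ 2 * m = 3) (m1 : 2 * m + 1 ≠ 0) (m4 : m ≠ 4) (m0 : m ≠ 0) (mne1 : m ≠ 1)
    (sq1 : ∀ d, d ^ 2 ≠ 1 - x) (sq2 : ∀ d, d ^ 2 ≠ (1 - x) * (1 - 9 * x))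
    (sq3 : ∀ d, d ^ 2 ≠ (x - m) * (x - 9 * m))
    (x0 : x ≠ 0) (x1 : x ≠ 1) (xm : x ≠ m)
    (e1 : 3 * x - 1 ≠ 0) (e2 : x * (1 - 2 * m) - m ≠ 0) (e3 : 3 * x - 4 ≠ 0)
    (e4 : x ^ 2 - 2 * x - 3 * m * x + 4 * m ≠ 0) (e5 : x - 2 * (2 - m) ≠ 0)
    (e6 : (4 - 2 * m) * x - m ≠ 0) (e7 : 2 * x * (2 * x - 1) - m * (3 * x - 1) ≠ 0)
    (e8 : 4 * x - 3 * m ≠ 0) (e9 : x - (1 - 2 * m) ≠ 0) (e10 : x - 3 * m ≠ 0)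
    (e11 : (1 + m) * x - 4 * m ≠ 0) (e12 : (m + x) * (1 + x) - 4 * m * x ≠ 0)
    (e13 : 4 * x - (1 + m) ≠ 0) (e14 : x + 1 ≠ 0) (e15 : x - 2 ≠ 0) (e16 : 2 * x - 1 ≠ 0)
    (e17 : x + m ≠ 0) (e18 : x - 2 * m ≠ 0) (e19 : 2 * x - m ≠ 0) (e20 : x - (2 - m) ≠ 0)
    (e21 : x - (2 * m - 1) ≠ 0) (e22 : 2 * x - (1 + m) ≠ 0)
    (Ha : (a = 0 ∧ va = 1) ∨ (a = 1 ∧ va = xi) ∨ (a = x ∧ va = mi) ∨ (a = m ∧ va = 0) ∨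
      (a ≠ 1 ∧ a ≠ m ∧ a * va = 1))
    (Hb : (b = 0 ∧ vb = 1) ∨ (b = 1 ∧ vb = xi) ∨ (b = x ∧ vb = mi) ∨ (b = m ∧ vb = 0) ∨
      (b ≠ 1 ∧ b ≠ m ∧ b * vb = 1))
    (Hc : (c = 0 ∧ vc = 1) ∨ (c = 1 ∧ vc = xi) ∨ (c = x ∧ vc = mi) ∨ (c = m ∧ vc = 0) ∨
      (c ≠ 1 ∧ c ≠ m ∧ c * vc = 1))
    (hab : a ≠ b) (hap : a + c = 2 * b) (hv : va + vc = 2 * vb) :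
    b = x ∧ (b - a) ^ 2 = x ^ 2 - m * x := by
  have hac : a ≠ c := by
    rintro rfl
    exact hab (mul_left_cancel₀ h2 (by linear_combination hap))
  have hbc : b ≠ c := by
    rintro rfl
    exact hab (by linear_combination hap)
  obtain ⟨d, hd⟩ : ∃ d, d = b - a := ⟨_, rfl⟩
  have hb' : b = a + d := by rw [hd]; ring
  have hc' : c = a + 2 * d := by linear_combination hap + 2 * hb'
  rcases Hb with ⟨tb, ub⟩ | ⟨tb, ub⟩ | ⟨tb, ub⟩ | ⟨tb, ub⟩ | ⟨tb, tb', ub⟩ <;>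
  rcases Ha with ⟨ta, ua⟩ | ⟨ta, ua⟩ | ⟨ta, ua⟩ | ⟨ta, ua⟩ | ⟨ta, ta', ua⟩ <;>
  first
  | exact absurd (ta.trans tb.symm) hab
  | skip
  all_goals
    rcases Hc with ⟨tc, uc⟩ | ⟨tc, uc⟩ | ⟨tc, uc⟩ | ⟨tc, uc⟩ | ⟨tc, tc', uc⟩ <;>
    first
    | exact absurd (ta.trans tc.symm) hac
    | exact absurd (tb.trans tc.symm) hbc
    | (exfalso; clear sq1 sq2 sq3
       try subst ta
       try subst tb
       try subst ua
       try subst ub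
       try subst tc
       try subst uc
       grind)
    | skip
  · refine absurd ?_ e4
    rw [ua, ub] at hv
    have k : x * c + m * x = 2 * m * c := by
      linear_combination (m * x * c) * hv - x * c * hmi - m * x * uc + 2 * m * c * hxi
    have kc : c = 2 - x := by linear_combination hap - ta + 2 * tb
    rw [kc] at k
    linear_combination -k
  · refine absurd ?_ (sq1 (1 - a))
    rw [ub] at hv
    have k : c * x + a * x = 2 * a * c := by
      linear_combination (a * x * c) * hv - x * c * ua - a * x * uc + 2 * a * c * hxi
    have kc : c = 2 - a := by linear_combination hap + 2 * tb
    rw [kc] at k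
    refine mul_left_cancel₀ h2 ?_
    linear_combination k
  · refine ⟨tb, ?_⟩
    rw [ub] at hv
    have k : c * m + a * m = 2 * a * c := by
      linear_combination (a * m * c) * hv - m * c * ua - a * m * uc + 2 * a * c * hmi
    have kc : c = 2 * x - a := by linear_combination hap + 2 * tb
    rw [kc] at k
    rw [tb]
    refine mul_left_cancel₀ h2 ?_
    linear_combination k
  · exfalso
    rw [ua] at hv
    have kc : c = 2 * b := by linear_combination hap - ta
    have k : c * b + b = 2 * c := by linear_combination c * b * hv - b * uc + 2 * c * ub
    rw [kc] at k
    have b0 : b ≠ 0 := left_ne_zero_of_mul_eq_one ub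
    have k' : 2 * b = 3 := mul_left_cancel₀ b0 (by linear_combination k)
    rcases hm with hm | hm
    · exact tc' (by rw [kc, k', hm])
    · exact tb' (mul_left_cancel₀ h2 (k'.trans hm.symm))
  · refine absurd ?_ (sq2 (4 * d + 3 * (1 - x)))
    rw [ua] at hv
    have k : b * c + b * x = 2 * c * x := by
      linear_combination b * c * x * hv - b * c * hxi - b * x * uc + 2 * c * x * ub
    rw [hb', hc', ta] at k
    linear_combination 8 * k
  · refine absurd ?_ e12
    rw [ua, uc] at hv
    have k : b * x + b * m = 2 * m * x := by
      linear_combination b * m * x * hv - b * x * hmi - b * m * hxi + 2 * m * x * ub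
    have kb : 2 * b = x + 1 := by linear_combination -hap + ta + tc
    linear_combination 2 * k - (m + x) * kb
  · refine absurd ?_ (sq3 (4 * d + 3 * (x - m)))
    rw [ua] at hv
    have k : b * c + b * m = 2 * c * m := by
      linear_combination b * c * m * hv - b * c * hmi - b * m * uc + 2 * c * m * ub
    rw [hb', hc', ta] at k
    linear_combination 8 * k
  · exfalso
    rw [ua] at hv
    have k : b = 2 * c := by linear_combination b * c * hv - b * uc + 2 * c * ub
    have k3 : 3 * c = m := by linear_combination -hap + ta - 2 * k
    rcases hm with hm | hm
    · exact tc (mul_left_cancel₀ h3 (by linear_combination k3 + hm))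
    · exact tb (mul_left_cancel₀ h3 (by linear_combination 3 * k + 2 * k3 + hm))
  · exfalso
    rw [uc] at hv
    have ka : a = 2 * b := by linear_combination hap - tc
    have k : a * b + b = 2 * a := by linear_combination a * b * hv - b * ua + 2 * a * ub
    rw [ka] at k
    have b0 : b ≠ 0 := left_ne_zero_of_mul_eq_one ub
    have k' : 2 * b = 3 := mul_left_cancel₀ b0 (by linear_combination k)
    rcases hm with hm | hm
    · exact ta' (by rw [ka, k', hm])
    · exact tb' (mul_left_cancel₀ h2 (k'.trans hm.symm))
  · refine absurd ?_ (sq2 (-4 * d + 3 * (1 - x)))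
    rw [uc] at hv
    have k : b * a + b * x = 2 * a * x := by
      linear_combination b * a * x * hv - b * a * hxi - b * x * ua + 2 * a * x * ub
    have ka : a = 1 - 2 * d := by linear_combination tc - hc'
    have kb : b = 1 - d := by linear_combination hb' + ka
    rw [ka, kb] at k
    linear_combination 8 * k
  · refine absurd ?_ (sq3 (-4 * d + 3 * (x - m)))
    rw [uc] at hv
    have k : b * a + b * m = 2 * a * m := by
      linear_combination b * a * m * hv - b * a * hmi - b * m * ua + 2 * a * m * ub
    have ka : a = x - 2 * d := by linear_combination tc - hc'
    have kb : b = x - d := by linear_combination hb' + ka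
    rw [ka, kb] at k
    linear_combination 8 * k
  · exfalso
    rw [uc] at hv
    have k : b = 2 * a := by linear_combination b * a * hv - b * ua + 2 * a * ub
    have k3 : 3 * a = m := by linear_combination -hap + tc - 2 * k
    rcases hm with hm | hm
    · exact ta (mul_left_cancel₀ h3 (by linear_combination k3 + hm))
    · exact tb (mul_left_cancel₀ h3 (by linear_combination 3 * k + 2 * k3 + hm))

end PartG

section PartH
section
variable {F : Type*} [Field F]

lemma exists_m (h2 : (2 : F) ≠ 0) (h3 : (3 : F) ≠ 0) : ∃ m : F, (m = 3 ∨ 2 * m = 3) ∧ m ≠ 0 ∧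
    2 * m + 1 ≠ 0 ∧ m ≠ 4 ∧ m ≠ 1 ∧ 9 * m ≠ 1 ∧ 81 * m ≠ 1 := by
  by_cases h : (5 : F) = 0 ∨ (241 : F) = 0
  · refine ⟨3, Or.inl rfl, h3, ?_, ?_, ?_, ?_, ?_⟩
    · intro h7
      rcases h with h | h
      · exact one_ne_zero (α := F) (by linear_combination 3 * h7 - 4 * h)
      · exact h3 (by linear_combination h - 34 * h7)
    · intro h4
      exact one_ne_zero (α := F) (by linear_combination -h4)
    · intro h4
      exact h2 (by linear_combination h4)
    · intro h26
      rcases h with h | h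
      · exact one_ne_zero (α := F) (by linear_combination h26 - 5 * h)
      · exact one_ne_zero (α := F) (by linear_combination 102 * h26 - 11 * h)
    · intro h242
      rcases h with h | h
      · exact h2 (by linear_combination h242 - 48 * h)
      · exact one_ne_zero (α := F) (by linear_combination h242 - h)
  · push Not at h
    obtain ⟨h5, h241⟩ := h
    have k : 2 * ((3 : F) / 2) = 3 := by field_simp
    refine ⟨3 / 2, Or.inr k, div_ne_zero h3 h2, ?_, ?_, ?_, ?_, ?_⟩
    · rw [k]; intro h4
      exact mul_ne_zero h2 h2 (by linear_combination h4)
    · intro h; exact h5 (by linear_combination k - 2 * h)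
    · intro h; exact one_ne_zero (α := F) (by linear_combination 2 * h - k)
    · intro h; exact mul_ne_zero h5 h5 (by linear_combination 2 * h - 9 * k)
    · intro h; exact h241 (by linear_combination 2 * h - 81 * k)

/-- The four-cycle `0 → 1 → x → m → 0`. -/
def cyc [DecidableEq F] (x m y : F) : F :=
  if y = 0 then 1 else if y = 1 then x else if y = x then m else if y = m then 0 else y

lemma cyc_inj [DecidableEq F] {x m : F} (x0 : x ≠ 0) (x1 : x ≠ 1) (xm : x ≠ m) (m0 : m ≠ 0)
    (m1 : m ≠ 1) : Function.Injective (cyc x m) := by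
  intro y z h
  unfold cyc at h
  grind

lemma cyc_cases [DecidableEq F] {x m : F} (y : F) :
    (y = 0 ∧ (cyc x m y)⁻¹ = 1) ∨ (y = 1 ∧ (cyc x m y)⁻¹ = x⁻¹) ∨ (y = x ∧ (cyc x m y)⁻¹ = m⁻¹) ∨
      (y = m ∧ (cyc x m y)⁻¹ = 0) ∨ (y ≠ 1 ∧ y ≠ m ∧ y * (cyc x m y)⁻¹ = 1) := by
  unfold cyc
  by_cases h0 : y = 0
  · simp [h0]
  by_cases h1 : y = 1
  · simp [h1]
  by_cases hx : y = x
  · subst hx; simp [h0, h1]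
  by_cases hm : y = m
  · subst hm; simp [h0, h1, hx]
  · simp [h0, h1, hx, hm]

lemma exists_x_m [Fintype F] [DecidableEq F] (hF : ringChar F ≠ 2) (h3 : (3 : F) ≠ 0)
    (hq : 434 ≤ Fintype.card F) :
    ∃ x m : F, x ≠ 0 ∧ x ≠ 1 ∧ x ≠ m ∧ m ≠ 0 ∧ m ≠ 1 ∧
      ∀ a b c : F, a ≠ b → a + c = 2 * b →
        (cyc x m a)⁻¹ + (cyc x m c)⁻¹ = 2 * (cyc x m b)⁻¹ →
        b = x ∧ (b - a) ^ 2 = x ^ 2 - m * x := by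
  have h2 : (2 : F) ≠ 0 := Ring.two_ne_zero hF
  have h4 : (4 : F) ≠ 0 := by
    have : (4 : F) = 2 * 2 := by norm_num
    rw [this]; exact mul_ne_zero h2 h2
  obtain ⟨m, hm, m0, m21, m4, m1, m9, m81⟩ := exists_m h2 h3
  obtain ⟨s1, hs1, H1⟩ := lin_list
    [(1, 0), (1, -1), (1, -m), (9, -1), (1, -(9 * m)), (3, -1), (1 - 2 * m, -m), (3, -4),
      (1, -(2 * (2 - m))), (4 - 2 * m, -m), (4, -(3 * m)), (1, -(1 - 2 * m)), (1, -(3 * m)),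
      (1 + m, -(4 * m)), (4, -(1 + m)), (1, 1), (1, -2), (2, -1), (1, m), (1, -(2 * m)), (2, -m),
      (1, -(2 - m)), (1, -(2 * m - 1)), (2, -(1 + m))] (by
        simp [m0, h2, h3, h4])
  obtain ⟨s2, hs2, H2⟩ := quad_list
    [((1 : F), -2 - 3 * m, 4 * m), (4, -2 - 3 * m, m), (1, 1 + m - 4 * m, m)] (by simp [h4])
  obtain ⟨x, hx, c1, c2, c3⟩ := exists_good hF h3 m0 m1 m9 m81 hq (s1 ∪ s2)
    ((Finset.card_union_le _ _).trans (by simp only [List.length_cons, List.length_nil] at hs1 hs2; omega))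
  rw [Finset.mem_union, not_or] at hx
  replace H1 := fun p hp hh => hx.1 (H1 p hp x hh)
  replace H2 := fun p hp hh => hx.2 (H2 p hp x hh)
  simp only [List.forall_mem_cons, List.not_mem_nil, false_imp_iff, imp_true_iff, and_true,
    forall_const] at H1 H2
  obtain ⟨l1, l2, l3, l4, l5, l6, l7, l8, l9, l10, l11, l12, l13, l14, l15, l16, l17, l18, l19, l20,
    l21, l22, l23, l24⟩ := H1
  obtain ⟨q1, q2, q3⟩ := H2
  have x0 : x ≠ 0 := fun h => l1 (by linear_combination h)
  have x1 : x ≠ 1 := fun h => l2 (by linear_combination h)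
  have xm : x ≠ m := fun h => l3 (by linear_combination h)
  have n1 : 1 - x ≠ 0 := fun h => l2 (by linear_combination -h)
  have n2 : 1 - 9 * x ≠ 0 := fun h => l4 (by linear_combination -h)
  have n3 : (x - m) * (x - 9 * m) ≠ 0 := mul_ne_zero (fun h => l3 (by linear_combination h))
    (fun h => l5 (by linear_combination h))
  have c1' := (quadraticChar_dichotomy n1).resolve_left c1
  have c2' := (quadraticChar_dichotomy n2).resolve_right c2
  have sqne : ∀ y : F, y ≠ 0 → quadraticChar F y ≠ 1 → ∀ d, d ^ 2 ≠ y := by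
    rintro y hy hc d rfl
    exact hc (quadraticChar_sq_one' (by rintro rfl; simp at hy))
  refine ⟨x, m, x0, x1, xm, m0, m1, fun a b c hab hap hv => ?_⟩
  refine ap_cases h2 h3 (mul_inv_cancel₀ x0) (mul_inv_cancel₀ m0) hm m21 m4 m0 m1
    (sqne _ n1 c1) (sqne _ (mul_ne_zero n1 n2) (by rw [map_mul, c1', c2']; norm_num))
    (sqne _ n3 c3) x0 x1 xm ?_ ?_ ?_ ?_ ?_ ?_ ?_ ?_ ?_ ?_ ?_ ?_ ?_ ?_ ?_ ?_ ?_ ?_ ?_ ?_ ?_ ?_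
    (cyc_cases a) (cyc_cases b) (cyc_cases c) hab hap hv
  · exact fun h => l6 (by linear_combination h)
  · exact fun h => l7 (by linear_combination h)
  · exact fun h => l8 (by linear_combination h)
  · exact fun h => q1 (by linear_combination h)
  · exact fun h => l9 (by linear_combination h)
  · exact fun h => l10 (by linear_combination h)
  · exact fun h => q2 (by linear_combination h)
  · exact fun h => l11 (by linear_combination h)
  · exact fun h => l12 (by linear_combination h)
  · exact fun h => l13 (by linear_combination h)
  · exact fun h => l14 (by linear_combination h)
  · exact fun h => q3 (by linear_combination h)
  · exact fun h => l15 (by linear_combination h)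
  · exact fun h => l16 (by linear_combination h)
  · exact fun h => l17 (by linear_combination h)
  · exact fun h => l18 (by linear_combination h)
  · exact fun h => l19 (by linear_combination h)
  · exact fun h => l20 (by linear_combination h)
  · exact fun h => l21 (by linear_combination h)
  · exact fun h => l22 (by linear_combination h)
  · exact fun h => l23 (by linear_combination h)
  · exact fun h => l24 (by linear_combination h)
end

/-- For a finite field `F_q` with `q ≥ 434` of characteristic `p > 3`, there is a
permutation of `F_q` destroying every nonconstant 3-term arithmetic progression
except possibly `(1/3, 2/3, 1)` and `(1, 2/3, 1/3)`, and which does destroy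
`(0, 3/2, 3)` and `(3, 3/2, 0)`. -/
theorem exists_perm_destroying_all_but_one_ap
    (F : Type*) [Field F] [Fintype F]
    (p : ℕ) [CharP F p] (hp : 3 < p)
    (hq : 434 ≤ Fintype.card F) :
    ∃ π : Equiv.Perm F,
      (∀ a b c : F, b - a = c - b → b - a ≠ 0 →
        (a, b, c) ≠ ((1 : F) / 3, (2 : F) / 3, (1 : F)) →
        (a, b, c) ≠ ((1 : F), (2 : F) / 3, (1 : F) / 3) →
        π b - π a ≠ π c - π b) ∧
      π ((3 : F) / 2) - π 0 ≠ π 3 - π ((3 : F) / 2) ∧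
      π ((3 : F) / 2) - π 3 ≠ π 0 - π ((3 : F) / 2) := by
  classical
  have hF : ringChar F ≠ 2 := by
    rw [ringChar.eq F p]; omega
  have h2 : (2 : F) ≠ 0 := Ring.two_ne_zero hF
  have h3 : (3 : F) ≠ 0 := by
    intro h
    have h' : ((3 : ℕ) : F) = 0 := by exact_mod_cast h
    have := Nat.le_of_dvd (by norm_num) ((CharP.cast_eq_zero_iff F p 3).1 h')
    omega
  obtain ⟨x, m, x0, x1, xm, m0, m1, H⟩ := exists_x_m hF h3 hq
  obtain ⟨d0, hd0, hd⟩ : ∃ d0 : F, d0 ≠ 0 ∧ ∀ d, d ≠ 0 → d ^ 2 = x ^ 2 - m * x → d ^ 2 = d0 ^ 2 := by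
    by_cases h : ∃ d : F, d ≠ 0 ∧ d ^ 2 = x ^ 2 - m * x
    · obtain ⟨d, hd, hd'⟩ := h
      exact ⟨d, hd, fun e _ he => he.trans hd'.symm⟩
    · exact ⟨1, one_ne_zero, fun e h0 he => absurd ⟨e, h0, he⟩ h⟩
  have hinj : Function.Injective (fun y : F => (cyc x m (x + (y - 2 / 3) * (3 * d0)))⁻¹) := by
    intro y z h
    have h1 := cyc_inj x0 x1 xm m0 m1 (inv_injective h)
    have h2 := mul_right_cancel₀ (mul_ne_zero h3 hd0) (add_left_cancel h1)
    exact sub_left_injective h2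
  let π : Equiv.Perm F := Equiv.ofBijective _ (Finite.injective_iff_bijective.1 hinj)
  have hπ : ∀ y, π y = (cyc x m (x + (y - 2 / 3) * (3 * d0)))⁻¹ := fun y => rfl
  have main : ∀ a b c : F, b - a = c - b → b - a ≠ 0 →
        (a, b, c) ≠ ((1 : F) / 3, (2 : F) / 3, (1 : F)) →
        (a, b, c) ≠ ((1 : F), (2 : F) / 3, (1 : F) / 3) →
        π b - π a ≠ π c - π b := by
    intro a b c hap hne n1 n2 hv
    rw [hπ, hπ, hπ] at hv
    obtain ⟨e1, e2⟩ := H (x + (a - 2 / 3) * (3 * d0)) (x + (b - 2 / 3) * (3 * d0))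
      (x + (c - 2 / 3) * (3 * d0))
      (by
        intro h
        have := mul_right_cancel₀ (mul_ne_zero h3 hd0) (add_left_cancel h)
        exact hne (by linear_combination -this))
      (by linear_combination -(3 * d0) * hap) (by linear_combination -hv)
    have hb : b = 2 / 3 := by
      have : (b - 2 / 3) * (3 * d0) = 0 := by linear_combination e1
      exact sub_eq_zero.1 ((mul_eq_zero.1 this).resolve_right (mul_ne_zero h3 hd0))
    have e3 : x + (b - 2 / 3) * (3 * d0) - (x + (a - 2 / 3) * (3 * d0)) = (3 * (b - a)) * d0 := by
      ring
    rw [e3] at e2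
    have e4 := hd _ (mul_ne_zero (mul_ne_zero h3 hne) hd0) e2
    rw [mul_pow] at e4
    have e5 : (3 * (b - a)) ^ 2 = 1 :=
      mul_right_cancel₀ (pow_ne_zero 2 hd0) (by rw [e4, one_mul])
    have hb3 : 3 * b = 2 := by rw [hb]; field_simp
    rcases (sq_eq_sq_iff_eq_or_eq_neg.1 (e5.trans (one_pow 2).symm)) with h | h
    · apply n1
      have ha : a = 1 / 3 := by rw [eq_div_iff h3]; linear_combination hb3 - h
      have hc : c = 1 := mul_left_cancel₀ h3 (by linear_combination -3 * hap + hb3 + h)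
      rw [ha, hb, hc]
    · apply n2
      have ha : a = 1 := mul_left_cancel₀ h3 (by linear_combination hb3 - h)
      have hc : c = 1 / 3 := by rw [eq_div_iff h3]; linear_combination -3 * hap + hb3 + h
      rw [ha, hb, hc]
  refine ⟨π, main, ?_, ?_⟩
  · refine main _ _ _ (by field_simp; norm_num) ?_ ?_ ?_
    · rw [sub_zero]; exact div_ne_zero h3 h2
    · intro h
      simp only [Prod.mk.injEq] at h
      exact div_ne_zero one_ne_zero h3 h.1.symm
    · intro h
      simp only [Prod.mk.injEq] at h
      exact zero_ne_one h.1
  · refine main _ _ _ (by field_simp; norm_num) ?_ ?_ ?_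
    · intro h
      apply div_ne_zero h3 h2
      have k : 2 * ((3 : F) / 2) = 3 := by field_simp
      linear_combination -h + k
    · intro h
      simp only [Prod.mk.injEq] at h
      exact zero_ne_one h.2.2
    · intro h
      simp only [Prod.mk.injEq] at h
      exact div_ne_zero one_ne_zero h3 h.2.2.symm

end PartH
end

section
/- Let q ≥ 1307 be a prime power whose characteristic p satisfies p > 3, and let F_q be the field with q elements. Then there exists an AP-destroying permutation of the additive group of F_q. -/
open Polynomial

namespace APD

section Alg
variable {F : Type*} [Field F]

lemma scale_of_primitive {α β M₁ M₂ M₃ N₁ N₂ N₃ : F[X]} (hβ : β ≠ 0)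
    (h₁ : α * M₁ = β * N₁) (h₂ : α * M₂ = β * N₂) (h₃ : α * M₃ = β * N₃)
    (hM : ∃ c₁ c₂ c₃, c₁ * M₁ + c₂ * M₂ + c₃ * M₃ = 1)
    (hN : ∃ c₁ c₂ c₃, c₁ * N₁ + c₂ * N₂ + c₃ * N₃ = 1) :
    ∃ c : F, c ≠ 0 ∧ N₁ = C c * M₁ ∧ N₂ = C c * M₂ ∧ N₃ = C c * M₃ := by
  obtain ⟨c₁, c₂, c₃, hc⟩ := hM
  obtain ⟨d₁, d₂, d₃, hd⟩ := hN
  have hab : β ∣ α := ⟨c₁ * N₁ + c₂ * N₂ + c₃ * N₃, by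
    linear_combination (-α) * hc + c₁ * h₁ + c₂ * h₂ + c₃ * h₃⟩
  have hba : α ∣ β := ⟨d₁ * M₁ + d₂ * M₂ + d₃ * M₃, by
    linear_combination (-β) * hd - d₁ * h₁ - d₂ * h₂ - d₃ * h₃⟩
  obtain ⟨u, hu⟩ := associated_of_dvd_dvd hab hba
  obtain ⟨c, hc0, hcu⟩ := Polynomial.isUnit_iff.1 u.isUnit
  refine ⟨c, hc0.ne_zero, ?_, ?_, ?_⟩ <;> rw [hcu] <;> apply mul_left_cancel₀ hβ
  · rw [← h₁, ← hu]; ring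
  · rw [← h₂, ← hu]; ring
  · rw [← h₃, ← hu]; ring

lemma primitive_of_maximal {M₁ M₂ M₃ : F[X]}
    (h : ∀ I : Ideal F[X], I.IsPrime → M₁ ∈ I → M₂ ∈ I → M₃ ∈ I → False) :
    ∃ c₁ c₂ c₃, c₁ * M₁ + c₂ * M₂ + c₃ * M₃ = 1 := by
  by_cases ht : Ideal.span {M₁, M₂, M₃} = ⊤
  · have h1 : (1 : F[X]) ∈ Ideal.span {M₁, M₂, M₃} := by rw [ht]; trivial
    obtain ⟨a, b, c, h2⟩ := Submodule.mem_span_triple.1 h1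
    exact ⟨a, b, c, by simpa using h2⟩
  · exfalso
    obtain ⟨I, hI, hle⟩ := Ideal.exists_le_maximal _ ht
    refine h I hI.isPrime ?_ ?_ ?_ <;> apply hle <;> apply Ideal.subset_span <;> simp

lemma coprime_not_both {I : Ideal F[X]} (hI : I.IsPrime) {u v : F[X]} (h : IsCoprime u v)
    (hu : u ∈ I) (hv : v ∈ I) : False := by
  obtain ⟨s, t, hst⟩ := h
  apply hI.ne_top
  rw [Ideal.eq_top_iff_one, ← hst]
  exact I.add_mem (I.mul_mem_left _ hu) (I.mul_mem_left _ hv)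

lemma primitive_M {u v u' v' : F[X]} (h : IsCoprime u v) (h' : IsCoprime u' v') :
    ∃ c₁ c₂ c₃, c₁ * (u * u') + c₂ * (u * v' + u' * v) + c₃ * (v * v') = 1 := by
  apply primitive_of_maximal
  intro I hI h₁ h₂ h₃
  rcases hI.mem_or_mem h₁ with hu | hu
  · have hv : v ∉ I := fun hv => coprime_not_both hI h hu hv
    have : u' * v ∈ I := (I.add_mem_iff_right (I.mul_mem_right _ hu)).1 h₂
    have hu' := (hI.mem_or_mem this).resolve_right hv
    exact coprime_not_both hI h' hu' ((hI.mem_or_mem h₃).resolve_left hv)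
  · have hv : v' ∉ I := fun hv => coprime_not_both hI h' hu hv
    have : u * v' ∈ I := (I.add_mem_iff_left (I.mul_mem_right _ hu)).1 h₂
    have hu' := (hI.mem_or_mem this).resolve_right hv
    exact coprime_not_both hI h hu' ((hI.mem_or_mem h₃).resolve_right hv)

lemma C_notMem {I : Ideal F[X]} (hI : I.IsPrime) {c : F} (hc : c ≠ 0) : C c ∉ I := by
  intro h
  apply hI.ne_top
  exact Ideal.eq_top_of_isUnit_mem _ h (Polynomial.isUnit_C.2 (isUnit_iff_ne_zero.2 hc))

/-- The cubic polynomial. -/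
noncomputable def ff (a b : F) : F[X] := X ^ 3 + C a * X ^ 2 + C b * X

lemma primitive_N (h2 : (2 : F) ≠ 0) {a b : F} (hb : b ≠ 0) (hab : a ^ 2 - 4 * b ≠ 0)
    {u v : F[X]} (h : IsCoprime u v) :
    ∃ c₁ c₂ c₃, c₁ * (u * X - C b * v) ^ 2 +
      c₂ * (2 * ((u * X + C b * v) * (u + v * X) + 2 * C a * u * v * X)) +
      c₃ * (u - v * X) ^ 2 = 1 := by
  apply primitive_of_maximal
  intro I hI h₁ h₂ h₃
  replace h₁ := hI.mem_of_pow_mem _ h₁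
  replace h₃ := hI.mem_of_pow_mem _ h₃
  have hv : v ∉ I := by
    intro hv
    refine coprime_not_both hI h ?_ hv
    have := I.add_mem h₃ (I.mul_mem_right X hv)
    simpa using this
  have e1 : v * (X ^ 2 - C b) ∈ I := by
    have := I.sub_mem h₁ (I.mul_mem_left X h₃)
    convert this using 1; ring
  have e1' := (hI.mem_or_mem e1).resolve_left hv
  have h2' : (2 : F[X]) ∉ I := by
    have := C_notMem hI h2
    rwa [show (C (2:F)) = 2 from rfl] at this
  have e2 := (hI.mem_or_mem h₂).resolve_left h2'
  have e3 : (2 * v ^ 2) * (X * (X ^ 2 + C a * X + C b)) ∈ I := by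
    have := I.sub_mem e2 (I.mul_mem_left
      (u * X + v * X * X + C b * v + v * X * X + 2 * C a * v * X) h₃)
    convert this using 1; ring
  have hv2 : (2 * v ^ 2) ∉ I := by
    intro h
    rcases hI.mem_or_mem h with h | h
    · exact h2' h
    · exact hv (hI.mem_of_pow_mem _ h)
  have e4 := (hI.mem_or_mem e3).resolve_left hv2
  have hX : X ∉ I := by
    intro hX
    refine C_notMem hI hb ?_
    have := I.sub_mem (I.mul_mem_left X hX) e1'
    convert this using 1; ring
  have e5 := (hI.mem_or_mem e4).resolve_left hX
  -- X^2 = b, X^2 + aX + b = 0  => 2b + aX = 0, => (a X)^2 = 4b^2 => b(a^2-4b) = 0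
  refine C_notMem hI (mul_ne_zero hb hab) ?_
  have e6 : C a * X + 2 * C b ∈ I := by
    have := I.sub_mem e5 e1'
    convert this using 1; ring
  have e7 := I.sub_mem (I.mul_mem_left (C a * X - 2 * C b) e6) (I.mul_mem_left (C a ^ 2) e1')
  convert e7 using 1
  simp only [C_mul, C_sub, C_pow]
  have : (C (4 : F)) = 4 := rfl
  rw [this]; ring

/-- naive height of a coprime pair -/
def TopDeg (u v : F[X]) (h : ℕ) : Prop :=
  u.natDegree ≤ h ∧ v.natDegree ≤ h ∧ (u.coeff h ≠ 0 ∨ v.coeff h ≠ 0)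

lemma exists_topDeg {u v : F[X]} (h : IsCoprime u v) : ∃ n, TopDeg u v n := by
  refine ⟨max u.natDegree v.natDegree, le_max_left _ _, le_max_right _ _, ?_⟩
  by_contra! hh
  have key : ∀ w : F[X], w.natDegree ≤ max u.natDegree v.natDegree →
      w.natDegree = max u.natDegree v.natDegree →
      w.coeff (max u.natDegree v.natDegree) = 0 → w = 0 := by
    intro w _ h1 h2
    rw [← h1] at h2
    exact leadingCoeff_eq_zero.1 h2
  rcases le_total u.natDegree v.natDegree with hl | hl
  · have hv : v = 0 := key v (le_max_right _ _) (max_eq_right hl).symm hh.2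
    subst hv
    have hu : u = 0 := key u (le_max_left _ _) (by simp) hh.1
    subst hu
    exact not_isCoprime_zero_zero h
  · have hv : u = 0 := key u (le_max_left _ _) (max_eq_left hl).symm hh.1
    subst hv
    have hu : v = 0 := key v (le_max_right _ _) (by simp) hh.2
    subst hu
    exact not_isCoprime_zero_zero h

lemma parallelogram_poly (h2 : (2 : F) ≠ 0) {a b : F} (hb : b ≠ 0) (hab : a ^ 2 - 4 * b ≠ 0)
    {u v u₁ v₁ u₂ v₂ : F[X]} {h h₁ h₂ : ℕ}
    (hc : IsCoprime u v) (hc₁ : IsCoprime u₁ v₁) (hc₂ : IsCoprime u₂ v₂)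
    (ht : TopDeg u v h) (ht₁ : TopDeg u₁ v₁ h₁) (ht₂ : TopDeg u₂ v₂ h₂)
    {α β : F[X]} (hβ : β ≠ 0)
    (e₁ : α * (u₁ * u₂) = β * (u * X - C b * v) ^ 2)
    (e₂ : α * (u₁ * v₂ + u₂ * v₁) =
      β * (2 * ((u * X + C b * v) * (u + v * X) + 2 * C a * u * v * X)))
    (e₃ : α * (v₁ * v₂) = β * (u - v * X) ^ 2) : h₁ + h₂ = 2 * h + 2 := by
  obtain ⟨c, hc0, E₁, E₂, E₃⟩ := scale_of_primitive hβ e₁ e₂ e₃ (primitive_M hc₁ hc₂)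
    (primitive_N h2 hb hab hc)
  obtain ⟨du, dv, hne⟩ := ht
  obtain ⟨du₁, dv₁, hne₁⟩ := ht₁
  obtain ⟨du₂, dv₂, hne₂⟩ := ht₂
  have dX : (X : F[X]).natDegree ≤ 1 := natDegree_X_le
  have duX : (u * X).natDegree ≤ h + 1 := natDegree_mul_le_of_le du dX
  have dvX : (v * X).natDegree ≤ h + 1 := natDegree_mul_le_of_le dv dX
  have dbv : (C b * v).natDegree ≤ h := (natDegree_C_mul_le _ _).trans dv
  have dA : (u * X - C b * v).natDegree ≤ h + 1 :=
    (natDegree_sub_le_of_le duX (dbv.trans (Nat.le_succ _))).trans (by simp)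
  have dB : (u - v * X).natDegree ≤ h + 1 :=
    (natDegree_sub_le_of_le (du.trans (Nat.le_succ _)) dvX).trans (by simp)
  have dA' : (u * X + C b * v).natDegree ≤ h + 1 :=
    (natDegree_add_le_of_le duX (dbv.trans (Nat.le_succ _))).trans (by simp)
  have dB' : (u + v * X).natDegree ≤ h + 1 :=
    (natDegree_add_le_of_le (du.trans (Nat.le_succ _)) dvX).trans (by simp)
  have dN₁ : ((u * X - C b * v) ^ 2).natDegree ≤ 2 * h + 2 := by
    rw [sq]; exact (natDegree_mul_le_of_le dA dA).trans (by omega)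
  have dN₃ : ((u - v * X) ^ 2).natDegree ≤ 2 * h + 2 := by
    rw [sq]; exact (natDegree_mul_le_of_le dB dB).trans (by omega)
  have dN₂ : (2 * ((u * X + C b * v) * (u + v * X) + 2 * C a * u * v * X)).natDegree
      ≤ 2 * h + 2 := by
    have t1 : ((u * X + C b * v) * (u + v * X)).natDegree ≤ 2 * h + 2 :=
      (natDegree_mul_le_of_le dA' dB').trans (by omega)
    have t2 : (2 * C a * u * v * X).natDegree ≤ 2 * h + 2 := by
      have : 2 * C a * u * v * X = C (2 * a) * (u * (v * X)) := by
        rw [C_mul, show (C (2:F)) = 2 from rfl]; ring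
      rw [this]
      refine (natDegree_C_mul_le _ _).trans ?_
      exact (natDegree_mul_le_of_le du dvX).trans (by omega)
    have t3 : (2 : F[X]) = C 2 := rfl
    rw [t3]
    refine (natDegree_C_mul_le _ _).trans ?_
    rw [← t3]
    exact (natDegree_add_le_of_le t1 t2).trans (by simp)
  have dM₁ : (u₁ * u₂).natDegree ≤ h₁ + h₂ := natDegree_mul_le_of_le du₁ du₂
  have dM₃ : (v₁ * v₂).natDegree ≤ h₁ + h₂ := natDegree_mul_le_of_le dv₁ dv₂
  have dM₂ : (u₁ * v₂ + u₂ * v₁).natDegree ≤ h₁ + h₂ :=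
    (natDegree_add_le_of_le (natDegree_mul_le_of_le du₁ dv₂)
      (natDegree_mul_le_of_le du₂ dv₁)).trans (by simp; omega)
  have cA : (u * X - C b * v).coeff (h + 1) = u.coeff h := by
    rw [coeff_sub, coeff_mul_X, coeff_eq_zero_of_natDegree_lt (lt_of_le_of_lt dbv (Nat.lt_succ_self _)),
      sub_zero]
  have cB : (u - v * X).coeff (h + 1) = - v.coeff h := by
    rw [coeff_sub, coeff_mul_X, coeff_eq_zero_of_natDegree_lt (lt_of_le_of_lt du (Nat.lt_succ_self _)),
      zero_sub]
  have cN₁ : ((u * X - C b * v) ^ 2).coeff (2 * h + 2) = u.coeff h ^ 2 := by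
    rw [sq, show 2 * h + 2 = (h + 1) + (h + 1) by ring, coeff_mul_add_eq_of_natDegree_le dA dA, cA, sq]
  have cN₃ : ((u - v * X) ^ 2).coeff (2 * h + 2) = v.coeff h ^ 2 := by
    rw [sq, show 2 * h + 2 = (h + 1) + (h + 1) by ring, coeff_mul_add_eq_of_natDegree_le dB dB, cB]; ring
  have cM₁ : (u₁ * u₂).coeff (h₁ + h₂) = u₁.coeff h₁ * u₂.coeff h₂ :=
    coeff_mul_add_eq_of_natDegree_le du₁ du₂
  have cM₃ : (v₁ * v₂).coeff (h₁ + h₂) = v₁.coeff h₁ * v₂.coeff h₂ :=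
    coeff_mul_add_eq_of_natDegree_le dv₁ dv₂
  have cM₂ : (u₁ * v₂ + u₂ * v₁).coeff (h₁ + h₂) =
      u₁.coeff h₁ * v₂.coeff h₂ + u₂.coeff h₂ * v₁.coeff h₁ := by
    rw [coeff_add, coeff_mul_add_eq_of_natDegree_le du₁ dv₂, add_comm h₁ h₂,
      coeff_mul_add_eq_of_natDegree_le du₂ dv₁]
  rcases lt_trichotomy (h₁ + h₂) (2 * h + 2) with hlt | heq | hgt
  · exfalso
    have z1 : u.coeff h = 0 := by
      have := congrArg (fun p => coeff p (2 * h + 2)) E₁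
      simp only [coeff_C_mul] at this
      rw [cN₁, coeff_eq_zero_of_natDegree_lt (lt_of_le_of_lt dM₁ hlt)] at this
      simpa using this
    have z3 : v.coeff h = 0 := by
      have := congrArg (fun p => coeff p (2 * h + 2)) E₃
      simp only [coeff_C_mul] at this
      rw [cN₃, coeff_eq_zero_of_natDegree_lt (lt_of_le_of_lt dM₃ hlt)] at this
      simpa using this
    tauto
  · exact heq
  · exfalso
    have z1 : u₁.coeff h₁ * u₂.coeff h₂ = 0 := by
      have := congrArg (fun p => coeff p (h₁ + h₂)) E₁
      simp only [coeff_C_mul] at this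
      rw [cM₁, coeff_eq_zero_of_natDegree_lt (lt_of_le_of_lt dN₁ hgt)] at this
      simpa [hc0] using this.symm
    have z3 : v₁.coeff h₁ * v₂.coeff h₂ = 0 := by
      have := congrArg (fun p => coeff p (h₁ + h₂)) E₃
      simp only [coeff_C_mul] at this
      rw [cM₃, coeff_eq_zero_of_natDegree_lt (lt_of_le_of_lt dN₃ hgt)] at this
      simpa [hc0] using this.symm
    have z2 : u₁.coeff h₁ * v₂.coeff h₂ + u₂.coeff h₂ * v₁.coeff h₁ = 0 := by
      have := congrArg (fun p => coeff p (h₁ + h₂)) E₂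
      simp only [coeff_C_mul] at this
      rw [cM₂, coeff_eq_zero_of_natDegree_lt (lt_of_le_of_lt dN₂ hgt)] at this
      rcases mul_eq_zero.1 this.symm with h | h
      · exact absurd h hc0
      · exact h
    rcases mul_eq_zero.1 z1 with k | k <;> rcases mul_eq_zero.1 z3 with k' | k' <;>
      simp_all
end Alg
end APD

open Polynomial

namespace APD
section Curve
variable {F : Type*} [Field F]

/-- the function field -/
local notation "K" => FractionRing F[X]

/-- embedding of polynomials -/
noncomputable abbrev io (p : F[X]) : FractionRing F[X] := algebraMap F[X] (FractionRing F[X]) p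

lemma io_inj {p q : F[X]} : io p = io q ↔ p = q :=
  (IsFractionRing.injective F[X] (FractionRing F[X])).eq_iff

lemma io_ne {p : F[X]} (h : p ≠ 0) : io p ≠ 0 := by
  intro h'
  apply h
  rw [← io_inj, h']
  simp [io]

lemma ff_ne (a b : F) : ff a b ≠ 0 := by
  intro h
  have := congrArg (fun p => coeff p 3) h
  simp [ff] at this

/-- The twisted curve. -/
noncomputable def WW (a b : F) : WeierstrassCurve.Affine (FractionRing F[X]) :=
  ⟨0, io (ff a b * C a), 0, io (ff a b ^ 2 * C b), 0⟩

lemma ww_eq (a b : F) (x y : K) : (WW a b).Equation x y ↔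
    y ^ 2 = x ^ 3 + io (ff a b * C a) * x ^ 2 + io (ff a b ^ 2 * C b) * x := by
  rw [WeierstrassCurve.Affine.equation_iff]
  simp [WW]

lemma ww_disc (h2 : (2 : F) ≠ 0) {a b : F} (hb : b ≠ 0) (hab : a ^ 2 - 4 * b ≠ 0) :
    (WW a b).Δ ≠ 0 := by
  have : (WW a b).Δ = io (C (16 * b ^ 2 * (a ^ 2 - 4 * b)) * ff a b ^ 6) := by
    simp only [WeierstrassCurve.Δ, WeierstrassCurve.b₂, WeierstrassCurve.b₄, WeierstrassCurve.b₆,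
      WeierstrassCurve.b₈, WW, io, map_mul, map_sub, map_pow, map_ofNat]
    ring
  rw [this]
  apply io_ne
  apply mul_ne_zero
  · rw [Ne, C_eq_zero]
    have : (16 : F) ≠ 0 := by
      rw [show (16 : F) = 2 ^ 4 by norm_num]; exact pow_ne_zero _ h2
    exact mul_ne_zero (mul_ne_zero this (pow_ne_zero _ hb)) hab
  · exact pow_ne_zero _ (ff_ne a b)

lemma ww_nonsing (h2 : (2 : F) ≠ 0) {a b : F} (hb : b ≠ 0) (hab : a ^ 2 - 4 * b ≠ 0) {x y : K}
    (h : y ^ 2 = x ^ 3 + io (ff a b * C a) * x ^ 2 + io (ff a b ^ 2 * C b) * x) :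
    (WW a b).Nonsingular x y :=
  (WeierstrassCurve.Affine.equation_iff_nonsingular_of_Δ_ne_zero (ww_disc h2 hb hab)).1
    ((ww_eq a b x y).2 h)

/-- `(u, v)` are projective coordinates for `x(P)/f`. -/
def Rep {a b : F} (P : (WW a b).Point) (u v : F[X]) : Prop :=
  match P with
  | .zero => v = 0
  | .some x _ _ => v ≠ 0 ∧ x * io v = io (ff a b * u)

/-- the degree of a point -/
def HasH {a b : F} (P : (WW a b).Point) (h : ℕ) : Prop :=
  ∃ u v, IsCoprime u v ∧ Rep P u v ∧ TopDeg u v h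

lemma exists_hasH {a b : F} (P : (WW a b).Point) : ∃ h, HasH P h := by
  classical
  have : ∃ u v, IsCoprime u v ∧ Rep P u v := by
    match P with
    | .zero => exact ⟨1, 0, isCoprime_one_left, rfl⟩
    | .some x y h =>
      obtain ⟨n, d, hd, hc, hx⟩ : ∃ n d : F[X], d ≠ 0 ∧ IsCoprime n d ∧
          x / io (ff a b) = io n / io d := by
        obtain ⟨n, d, hd, hx⟩ := IsFractionRing.div_surjective (A := F[X]) (x / io (ff a b))
        have hd0 := nonZeroDivisors.ne_zero hd
        obtain ⟨g, n', d', hg, hcop, hn', hd'⟩ :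
            ∃ g n' d' : F[X], g ≠ 0 ∧ IsCoprime n' d' ∧ n = g * n' ∧ d = g * d' := by
          obtain ⟨n', hn'⟩ := EuclideanDomain.gcd_dvd_left n d
          obtain ⟨d', hd'⟩ := EuclideanDomain.gcd_dvd_right n d
          have hg : EuclideanDomain.gcd n d ≠ 0 := by
            intro h0
            rw [EuclideanDomain.gcd_eq_zero_iff] at h0
            exact hd0 h0.2
          refine ⟨_, n', d', hg, ?_, hn', hd'⟩
          have := EuclideanDomain.gcd_eq_gcd_ab n d
          refine ⟨EuclideanDomain.gcdA n d, EuclideanDomain.gcdB n d, ?_⟩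
          apply mul_left_cancel₀ hg
          linear_combination (EuclideanDomain.gcdA n d) * (-hn') +
            (EuclideanDomain.gcdB n d) * (-hd') - this
        have hd'0 : d' ≠ 0 := by rintro rfl; simp at hd'; exact hd0 hd'
        refine ⟨n', d', hd'0, hcop, ?_⟩
        rw [← hx, hn', hd']
        have := io_ne hg
        have := io_ne hd'0
        simp only [io, map_mul] at *
        field_simp
      refine ⟨n, d, hc, hd, ?_⟩
      have h1 := io_ne hd
      have h2 := io_ne (ff_ne a b)
      rw [div_eq_div_iff h2 h1] at hx
      simp only [io, map_mul] at *
      linear_combination hx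
  obtain ⟨u, v, hc, hr⟩ := this
  obtain ⟨h, hh⟩ := exists_topDeg hc
  exact ⟨h, u, v, hc, hr, hh⟩

lemma hasH_le {a b : F} {x y : K} {hP : (WW a b).Nonsingular x y} {h n : ℕ}
    (hh : HasH (.some x y hP) h) (U V : F[X]) (hV : V ≠ 0) (he : x * io V = io (ff a b * U))
    (hU : U.natDegree ≤ n) (hVn : V.natDegree ≤ n) : h ≤ n := by
  obtain ⟨u, v, hc, ⟨hv, hr⟩, ht⟩ := hh
  have e : u * V = U * v := by
    have : io (ff a b * (u * V)) = io (ff a b * (U * v)) := by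
      simp only [io, map_mul] at *
      linear_combination (algebraMap F[X] (FractionRing F[X]) v) * he -
        (algebraMap F[X] (FractionRing F[X]) V) * hr
    exact mul_left_cancel₀ (ff_ne a b) (io_inj.1 this)
  obtain ⟨-, -, h0 | h0⟩ := ht
  · have hu0 : u ≠ 0 := by rintro rfl; simp at h0
    have hU0 : U ≠ 0 := by
      rintro rfl
      simp [hu0, hV] at e
    have : u ∣ U := hc.dvd_of_dvd_mul_right ⟨V, e.symm⟩
    exact (le_natDegree_of_ne_zero h0).trans ((natDegree_le_of_dvd this hU0).trans hU)
  · have : v ∣ V := hc.symm.dvd_of_dvd_mul_left ⟨U, by rw [e]; ring⟩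
    exact (le_natDegree_of_ne_zero h0).trans ((natDegree_le_of_dvd this hV).trans hVn)

lemma ww_negY (a b : F) (x y : K) : (WW a b).negY x y = -y := by
  simp [WeierstrassCurve.Affine.negY, WW]

lemma ww_addX (a b : F) (x₁ x₂ l : K) :
    (WW a b).addX x₁ x₂ l = l ^ 2 - io (ff a b * C a) - x₁ - x₂ := by
  simp [WeierstrassCurve.Affine.addX, WW]

lemma ww_add [DecidableEq (FractionRing F[X])] {a b : F} {x₁ y₁ x₂ y₂ : K} (h₁ : (WW a b).Nonsingular x₁ y₁)
    (h₂ : (WW a b).Nonsingular x₂ y₂) (hx : x₁ ≠ x₂) :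
    ∃ x y h, (WeierstrassCurve.Affine.Point.some x₁ y₁ h₁ + .some x₂ y₂ h₂ : (WW a b).Point)
      = .some x y h ∧
      x = ((y₁ - y₂) / (x₁ - x₂)) ^ 2 - io (ff a b * C a) - x₁ - x₂ := by
  rw [WeierstrassCurve.Affine.Point.add_of_X_ne hx]
  refine ⟨_, _, _, rfl, ?_⟩
  rw [ww_addX, WeierstrassCurve.Affine.slope_of_X_ne hx]

lemma ww_sub [DecidableEq (FractionRing F[X])] {a b : F} {x₁ y₁ x₂ y₂ : K} (h₁ : (WW a b).Nonsingular x₁ y₁)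
    (h₂ : (WW a b).Nonsingular x₂ y₂) (hx : x₁ ≠ x₂) :
    ∃ x y h, (WeierstrassCurve.Affine.Point.some x₁ y₁ h₁ - .some x₂ y₂ h₂ : (WW a b).Point)
      = .some x y h ∧
      x = ((y₁ + y₂) / (x₁ - x₂)) ^ 2 - io (ff a b * C a) - x₁ - x₂ := by
  rw [sub_eq_add_neg, WeierstrassCurve.Affine.Point.neg_some]
  have hn : (WW a b).Nonsingular x₂ ((WW a b).negY x₂ y₂) := by
    rwa [WeierstrassCurve.Affine.nonsingular_neg]
  obtain ⟨x, y, h, e1, e2⟩ := ww_add h₁ hn hx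
  refine ⟨x, y, h, e1, ?_⟩
  rw [e2, ww_negY, sub_neg_eq_add]

lemma ww_dbl [DecidableEq (FractionRing F[X])] {a b : F} {x y : K} (h : (WW a b).Nonsingular x y) (hy : y ≠ -y) :
    ∃ x' y' h', (WeierstrassCurve.Affine.Point.some x y h + .some x y h : (WW a b).Point)
      = .some x' y' h' ∧
      x' = ((3 * x ^ 2 + 2 * io (ff a b * C a) * x + io (ff a b ^ 2 * C b)) / (2 * y)) ^ 2
        - io (ff a b * C a) - x - x := by
  have hy' : y ≠ (WW a b).negY x y := by rwa [ww_negY]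
  rw [WeierstrassCurve.Affine.Point.add_self_of_Y_ne hy']
  refine ⟨_, _, _, rfl, ?_⟩
  rw [ww_addX, WeierstrassCurve.Affine.slope_of_Y_ne rfl hy', ww_negY]
  simp only [WW]
  ring_nf

end Curve
end APD

open Polynomial

namespace APD
section Par
variable {F : Type*} [Field F]

/-- the function field -/
local notation "K" => FractionRing F[X]

lemma qq_nonsing (h2 : (2 : F) ≠ 0) {a b : F} (hb : b ≠ 0) (hab : a ^ 2 - 4 * b ≠ 0) :
    (WW a b).Nonsingular (io (ff a b * X)) (io (ff a b ^ 2)) := by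
  apply ww_nonsing h2 hb hab
  simp only [io, ← map_mul, ← map_pow, ← map_add]
  congr 1
  have : ff a b = X ^ 3 + C a * X ^ 2 + C b * X := rfl
  linear_combination (ff a b) ^ 3 * this

lemma par_generic {a b : F} {u v u₁ v₁ u₂ v₂ : F[X]} {x y x₁ x₂ : K}
    (he : (WW a b).Equation x y)
    (hne : x ≠ io (ff a b * X))
    (h₁ : x₁ = ((y - io (ff a b ^ 2)) / (x - io (ff a b * X))) ^ 2 - io (ff a b * C a) - x
      - io (ff a b * X))
    (h₂ : x₂ = ((y + io (ff a b ^ 2)) / (x - io (ff a b * X))) ^ 2 - io (ff a b * C a) - x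
      - io (ff a b * X))
    (hv : v ≠ 0) (hr : x * io v = io (ff a b * u))
    (hr₁ : x₁ * io v₁ = io (ff a b * u₁))
    (hr₂ : x₂ * io v₂ = io (ff a b * u₂)) :
    ((u - v * X) ^ 2) * (u₁ * u₂) = (v₁ * v₂) * (u * X - C b * v) ^ 2 ∧
    ((u - v * X) ^ 2) * (u₁ * v₂ + u₂ * v₁) = (v₁ * v₂) *
      (2 * ((u * X + C b * v) * (u + v * X) + 2 * C a * u * v * X)) := by
  have hf := io_ne (ff_ne a b)
  have hV := io_ne hv
  rw [ww_eq] at he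
  have hfd : io (ff a b) = io X ^ 3 + io (C a) * io X ^ 2 + io (C b) * io X := by
    simp only [io, ← map_mul, ← map_pow, ← map_add]; rfl
  simp only [← io_inj]
  simp only [io, map_mul, map_pow, map_add, map_sub, map_ofNat] at *
  generalize algebraMap F[X] (FractionRing F[X]) (ff a b) = f at *
  generalize algebraMap F[X] (FractionRing F[X]) X = t at *
  generalize algebraMap F[X] (FractionRing F[X]) (C a) = A at *
  generalize algebraMap F[X] (FractionRing F[X]) (C b) = B at *
  generalize algebraMap F[X] (FractionRing F[X]) u = U at *
  generalize algebraMap F[X] (FractionRing F[X]) v = V at *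
  generalize algebraMap F[X] (FractionRing F[X]) u₁ = U₁ at *
  generalize algebraMap F[X] (FractionRing F[X]) v₁ = V₁ at *
  generalize algebraMap F[X] (FractionRing F[X]) u₂ = U₂ at *
  generalize algebraMap F[X] (FractionRing F[X]) v₂ = V₂ at *
  have hD : x - f * t ≠ 0 := sub_ne_zero.2 hne
  have hx : x = f * U / V := by field_simp; linear_combination hr
  have hU₁ : U₁ = x₁ * V₁ / f := by field_simp; linear_combination -hr₁
  have hU₂ : U₂ = x₂ * V₂ / f := by field_simp; linear_combination -hr₂
  have hU : U = x * V / f := by field_simp; linear_combination -hr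
  have hq : f ^ 4 = (f * t) ^ 3 + f * A * (f * t) ^ 2 + f ^ 2 * B * (f * t) := by
    linear_combination f ^ 3 * hfd
  have k1 : x₁ * x₂ * (x - f * t) ^ 2 = (x * (f * t) - f ^ 2 * B) ^ 2 := by
    apply mul_left_cancel₀ (pow_ne_zero 2 hD)
    have e1 : x₁ * (x - f * t) ^ 2 = (y - f ^ 2) ^ 2 - (f * A + x + f * t) * (x - f * t) ^ 2 := by
      rw [h₁]; field_simp; ring
    have e2 : x₂ * (x - f * t) ^ 2 = (y + f ^ 2) ^ 2 - (f * A + x + f * t) * (x - f * t) ^ 2 := by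
      rw [h₂]; field_simp; ring
    have : (x - f * t) ^ 2 * (x₁ * x₂ * (x - f * t) ^ 2) =
      (x₁ * (x - f * t) ^ 2) * (x₂ * (x - f * t) ^ 2) := by ring
    rw [this, e1, e2]
    have e3 : ((y - f ^ 2) ^ 2 - (f * A + x + f * t) * (x - f * t) ^ 2) *
      ((y + f ^ 2) ^ 2 - (f * A + x + f * t) * (x - f * t) ^ 2) =
      (y ^ 2 - f ^ 4) ^ 2 - 2 * (y ^ 2 + f ^ 4) * ((f * A + x + f * t) * (x - f * t) ^ 2)
        + ((f * A + x + f * t) * (x - f * t) ^ 2) ^ 2 := by ring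
    rw [e3, he, hq]
    ring
  have k2 : (x₁ + x₂) * (x - f * t) ^ 2 = 2 * ((x * (f * t) + f ^ 2 * B) * (x + f * t)
      + 2 * (f * A) * x * (f * t)) := by
    have e1 : (x₁ + x₂) * (x - f * t) ^ 2 = 2 * (y ^ 2 + f ^ 4)
        - 2 * (f * A + x + f * t) * (x - f * t) ^ 2 := by
      rw [h₁, h₂]; field_simp; ring
    rw [e1, he, hq]; ring
  constructor
  · rw [hU₁, hU₂, hU]
    field_simp
    linear_combination V₁ * V₂ * k1
  · rw [hU₁, hU₂, hU]
    field_simp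
    linear_combination V₁ * V₂ * k2

lemma dbl_formula {a b : F} (h2 : (2 : F) ≠ 0) {u v : F[X]} {x : K}
    (h : x = ((3 * io (ff a b * X) ^ 2 + 2 * io (ff a b * C a) * io (ff a b * X) +
      io (ff a b ^ 2 * C b)) / (2 * io (ff a b ^ 2))) ^ 2
        - io (ff a b * C a) - io (ff a b * X) - io (ff a b * X))
    (hr : x * io v = io (ff a b * u)) :
    4 * ff a b * u = (X ^ 2 - C b) ^ 2 * v := by
  have hf := io_ne (ff_ne a b)
  have hfd : io (ff a b) = io X ^ 3 + io (C a) * io X ^ 2 + io (C b) * io X := by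
    simp only [io, ← map_mul, ← map_pow, ← map_add]; rfl
  have h2' : (2 : K) ≠ 0 := by
    have : io (C (2 : F)) ≠ 0 := io_ne (by rwa [Ne, C_eq_zero])
    rwa [io, C_ofNat, map_ofNat] at this
  simp only [← io_inj]
  simp only [io, map_mul, map_pow, map_sub, map_ofNat] at *
  generalize algebraMap F[X] (FractionRing F[X]) (ff a b) = f at *
  generalize algebraMap F[X] (FractionRing F[X]) X = t at *
  generalize algebraMap F[X] (FractionRing F[X]) (C a) = A at *
  generalize algebraMap F[X] (FractionRing F[X]) (C b) = B at *
  generalize algebraMap F[X] (FractionRing F[X]) u = U at *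
  generalize algebraMap F[X] (FractionRing F[X]) v = V at *
  have e : 4 * x = (t ^ 2 - B) ^ 2 := by
    rw [h]
    field_simp
    rw [hfd]
    ring
  linear_combination -4 * hr + V * e

theorem parallelogram [DecidableEq (FractionRing F[X])] (h2 : (2 : F) ≠ 0) {a b : F} (hb : b ≠ 0) (hab : a ^ 2 - 4 * b ≠ 0)
    (P : (WW a b).Point) {h h₁ h₂ : ℕ} (hP : HasH P h)
    (hP₁ : HasH (P + .some _ _ (qq_nonsing h2 hb hab)) h₁)
    (hP₂ : HasH (P - .some _ _ (qq_nonsing h2 hb hab)) h₂) : h₁ + h₂ = 2 * h + 2 := by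
  obtain ⟨u, v, hc, hr, ht⟩ := hP
  obtain ⟨u₁, v₁, hc₁, hr₁, ht₁⟩ := hP₁
  obtain ⟨u₂, v₂, hc₂, hr₂, ht₂⟩ := hP₂
  have hf := ff_ne a b
  have h2K : (2 : F[X]) ≠ 0 := by
    rw [show (2 : F[X]) = C 2 from rfl, Ne, C_eq_zero]; exact h2
  have h2K' : (2 : K) ≠ 0 := by
    have := io_ne h2K
    rwa [io, map_ofNat] at this
  have hyn : io (ff a b ^ 2) ≠ - io (ff a b ^ 2) := by
    intro hh
    have : 2 * io (ff a b ^ 2) = 0 := by linear_combination hh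
    exact mul_ne_zero h2K' (io_ne (pow_ne_zero 2 hf)) this
  match P with
  | .zero =>
    change v = 0 at hr
    subst hr
    change Rep (0 + _) u₁ v₁ at hr₁
    change Rep (0 - _) u₂ v₂ at hr₂
    rw [zero_add] at hr₁
    rw [zero_sub, WeierstrassCurve.Affine.Point.neg_some] at hr₂
    obtain ⟨hv₁, e₁⟩ := hr₁
    obtain ⟨hv₂, e₂⟩ := hr₂
    have k₁ : u₁ = X * v₁ := by
      rw [io, ← map_mul] at e₁
      apply mul_left_cancel₀ hf
      rw [← io_inj.1 e₁]; ring
    have k₂ : u₂ = X * v₂ := by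
      rw [io, ← map_mul] at e₂
      apply mul_left_cancel₀ hf
      rw [← io_inj.1 e₂]; ring
    refine parallelogram_poly h2 hb hab hc hc₁ hc₂ ht ht₁ ht₂ (α := u ^ 2) (β := v₁ * v₂)
      (mul_ne_zero hv₁ hv₂) ?_ ?_ ?_
    · rw [k₁, k₂]; ring
    · rw [k₁, k₂]; ring
    · ring
  | .some x y hxy =>
    obtain ⟨hv, e⟩ := hr
    by_cases hx : x = io (ff a b * X)
    · have hu : u = v * X := by
        rw [hx, io, ← map_mul] at e
        apply mul_left_cancel₀ hf
        rw [← io_inj.1 e]; ring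
      have hy : y = io (ff a b ^ 2) ∨ y = - io (ff a b ^ 2) := by
        have q1 := (ww_eq a b _ _).1 hxy.1
        have q2 := (ww_eq a b _ _).1 (qq_nonsing h2 hb hab).1
        rw [hx, ← q2] at q1
        exact sq_eq_sq_iff_eq_or_eq_neg.1 q1
      obtain ⟨x', y', hn, ed, ex⟩ := ww_dbl (qq_nonsing h2 hb hab) hyn
      have h4f : 4 * ff a b * v ^ 2 ≠ 0 := by
        rw [show (4 : F[X]) = 2 * 2 by norm_num]
        exact mul_ne_zero (mul_ne_zero (mul_ne_zero h2K h2K) hf) (pow_ne_zero 2 hv)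
      have hfd : ff a b = X ^ 3 + C a * X ^ 2 + C b * X := rfl
      rcases hy with hy | hy
      · subst hx hy
        rw [ed] at hr₁
        rw [sub_self] at hr₂
        change v₂ = 0 at hr₂
        obtain ⟨hv₁, e₁⟩ := hr₁
        subst hr₂
        have hu₂ : u₂ ≠ 0 := by
          rintro rfl
          exact not_isCoprime_zero_zero hc₂
        have k := dbl_formula h2 ex e₁
        refine parallelogram_poly h2 hb hab hc hc₁ hc₂ ht ht₁ ht₂ (α := 4 * ff a b * v ^ 2)
          (β := u₂ * v₁) (mul_ne_zero hu₂ hv₁) ?_ ?_ ?_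
        · rw [hu]; linear_combination u₂ * v ^ 2 * k
        · rw [hu]; linear_combination 4 * v ^ 2 * u₂ * v₁ * hfd
        · rw [hu]; ring
      · have hP' : WeierstrassCurve.Affine.Point.some x y hxy
            = - .some _ _ (qq_nonsing h2 hb hab) := by
          rw [WeierstrassCurve.Affine.Point.neg_some]
          simp only [ww_negY, hx, hy]
        rw [hP', neg_add_cancel] at hr₁
        rw [hP', ← neg_add', ed, WeierstrassCurve.Affine.Point.neg_some] at hr₂
        change v₁ = 0 at hr₁
        obtain ⟨hv₁, e₁⟩ := hr₂
        subst hr₁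
        have hu₂ : u₁ ≠ 0 := by
          rintro rfl
          exact not_isCoprime_zero_zero hc₁
        have k := dbl_formula h2 ex e₁
        refine parallelogram_poly h2 hb hab hc hc₁ hc₂ ht ht₁ ht₂ (α := 4 * ff a b * v ^ 2)
          (β := u₁ * v₂) (mul_ne_zero hu₂ hv₁) ?_ ?_ ?_
        · rw [hu]; linear_combination u₁ * v ^ 2 * k
        · rw [hu]; linear_combination 4 * v ^ 2 * u₁ * v₂ * hfd
        · rw [hu]; ring
    · obtain ⟨x₁, y₁, hn₁, ed₁, ex₁⟩ := ww_add hxy (qq_nonsing h2 hb hab) hx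
      obtain ⟨x₂, y₂, hn₂, ed₂, ex₂⟩ := ww_sub hxy (qq_nonsing h2 hb hab) hx
      rw [ed₁] at hr₁
      rw [ed₂] at hr₂
      obtain ⟨hv₁, e₁⟩ := hr₁
      obtain ⟨hv₂, e₂⟩ := hr₂
      obtain ⟨k1, k2⟩ := par_generic hxy.1 hx ex₁ ex₂ hv e e₁ e₂
      exact parallelogram_poly h2 hb hab hc hc₁ hc₂ ht ht₁ ht₂ (α := (u - v * X) ^ 2)
        (β := v₁ * v₂) (mul_ne_zero hv₁ hv₂) k1 k2 (by ring)

end Par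
end APD

open Polynomial

namespace APD
section Count
set_option linter.unusedSectionVars false
variable {F : Type*} [Field F] [Fintype F] [DecidableEq F]

/-- the function field -/
local notation "K" => FractionRing F[X]

/-- multiplicities -/
noncomputable def mult (a b : F) (ε : ℤ) (x : F) : ℕ :=
  (1 + ε * quadraticChar F ((ff a b).eval x)).toNat

/-- common divisor -/
noncomputable def GG (a b : F) (ε : ℤ) : F[X] :=
  ∏ x : F, (X - C x) ^ mult a b ε x

lemma GG_monic (a b : F) (ε : ℤ) : (GG a b ε).Monic :=
  monic_prod_of_monic _ _ fun x _ => (monic_X_sub_C x).pow _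

/-- the character sum -/
noncomputable def SS (a b : F) : ℤ := ∑ x : F, quadraticChar F ((ff a b).eval x)

lemma mult_cast (a b : F) {ε : ℤ} (hε : ε = 1 ∨ ε = -1) (x : F) :
    (mult a b ε x : ℤ) = 1 + ε * quadraticChar F ((ff a b).eval x) := by
  rw [mult, Int.toNat_of_nonneg]
  have h := (quadraticChar_isQuadratic F) ((ff a b).eval x)
  rcases hε with rfl | rfl <;> rcases h with h | h | h <;> rw [h] <;> norm_num

lemma GG_natDegree (a b : F) {ε : ℤ} (hε : ε = 1 ∨ ε = -1) :
    ((GG a b ε).natDegree : ℤ) = Fintype.card F + ε * SS a b := by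
  rw [GG, natDegree_prod_of_monic _ _ (fun x _ => (monic_X_sub_C x).pow _)]
  push_cast
  simp only [natDegree_pow, natDegree_X_sub_C, mul_one, mult_cast a b hε]
  rw [Finset.sum_add_distrib, SS, Finset.mul_sum]
  simp

lemma GG_dvd (a b : F) (ε : ℤ) {Z : F[X]} (h : ∀ x, (X - C x) ^ mult a b ε x ∣ Z) :
    GG a b ε ∣ Z := by
  apply Finset.prod_dvd_of_coprime
  · intro x _ y _ hxy
    exact (pairwise_coprime_X_sub_C Function.injective_id hxy).pow
  · intro x _; exact h x

/-- Frobenius difference -/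
noncomputable def TX (F : Type*) [Field F] [Fintype F] : F[X] := X ^ Fintype.card F - X

lemma TX_dvd (x : F) : X - C x ∣ TX F := by
  rw [dvd_iff_isRoot, IsRoot, TX]
  simp [FiniteField.pow_card]

lemma mult_le_two (a b : F) {ε : ℤ} (hε : ε = 1 ∨ ε = -1) (x : F) : mult a b ε x ≤ 2 := by
  have := mult_cast a b hε x
  have h := (quadraticChar_isQuadratic F) ((ff a b).eval x)
  rcases hε with rfl | rfl <;> rcases h with h | h | h <;> rw [h] at this <;> omega

lemma GG_dvd_TX (a b : F) {ε : ℤ} (hε : ε = 1 ∨ ε = -1) : GG a b ε ∣ TX F ^ 2 := by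
  apply GG_dvd
  intro x
  exact (pow_dvd_pow _ (mult_le_two a b hε x)).trans (pow_dvd_pow_of_dvd (TX_dvd x) 2)

/-- numerators -/
noncomputable def RR (a b : F) (ε : ℤ) : F[X] :=
  ff a b * (ff a b ^ (Fintype.card F / 2) - C (ε : F)) ^ 2 -
    (C a + X ^ Fintype.card F + X) * TX F ^ 2

lemma GG_dvd_RR (hF : ringChar F ≠ 2) (a b : F) {ε : ℤ} (hε : ε = 1 ∨ ε = -1) :
    GG a b ε ∣ RR a b ε := by
  apply GG_dvd
  intro x
  apply dvd_sub
  · have hm := mult_cast a b hε x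
    have h := (quadraticChar_isQuadratic F) ((ff a b).eval x)
    have hpow := quadraticChar_eq_pow_of_char_ne_two' hF ((ff a b).eval x)
    by_cases h0 : quadraticChar F ((ff a b).eval x) = 0
    · rw [h0] at hm
      have : mult a b ε x = 1 := by omega
      rw [this, pow_one]
      apply Dvd.dvd.mul_right
      rw [dvd_iff_isRoot, IsRoot]
      exact quadraticChar_eq_zero_iff.1 h0
    · by_cases h1 : quadraticChar F ((ff a b).eval x) = ε
      · refine (pow_dvd_pow _ (mult_le_two a b hε x)).trans ?_
        apply Dvd.dvd.mul_left
        apply pow_dvd_pow_of_dvd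
        rw [dvd_iff_isRoot, IsRoot]
        rw [eval_sub, eval_pow, eval_C, ← hpow, h1, sub_self]
      · have : mult a b ε x = 0 := by
          rcases hε with rfl | rfl <;> rcases h with h | h | h <;> rw [h] at hm h0 h1 <;> omega
        rw [this, pow_zero]
        exact one_dvd _
  · apply Dvd.dvd.mul_left
    exact (pow_dvd_pow _ (mult_le_two a b hε x)).trans (pow_dvd_pow_of_dvd (TX_dvd x) 2)

lemma ff_frob (a b : F) : ff a b ^ Fintype.card F =
    (X ^ Fintype.card F) ^ 3 + C a * (X ^ Fintype.card F) ^ 2 + C b * X ^ Fintype.card F := by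
  rw [← FiniteField.expand_card, ff]
  simp

lemma card_odd (hF : ringChar F ≠ 2) : Fintype.card F = 2 * (Fintype.card F / 2) + 1 := by
  have := FiniteField.odd_card_of_char_ne_two hF
  omega

lemma ff_sq (hF : ringChar F ≠ 2) (a b : F) :
    ff a b * (ff a b ^ (Fintype.card F / 2)) ^ 2 =
    (X ^ Fintype.card F) ^ 3 + C a * (X ^ Fintype.card F) ^ 2 + C b * X ^ Fintype.card F := by
  rw [← ff_frob]
  conv_rhs => rw [card_odd hF]
  ring

lemma ff_natDegree (a b : F) : (ff a b).natDegree ≤ 3 := by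
  rw [ff]
  compute_degree

lemma RR_natDegree (hF : ringChar F ≠ 2) (a b : F) {ε : ℤ} (hε : ε = 1 ∨ ε = -1) :
    (RR a b ε).natDegree ≤ 2 * Fintype.card F + 1 := by
  have hq := card_odd hF
  have e : RR a b ε = X ^ (2 * Fintype.card F + 1) + X ^ (Fintype.card F + 2)
      + C (2 * a) * X ^ (Fintype.card F + 1) + C b * X ^ (Fintype.card F)
      + C b * X + C (-2 * (ε : F)) * (ff a b * ff a b ^ (Fintype.card F / 2)) := by
    have h := ff_sq hF a b
    have hfd : ff a b = X ^ 3 + C a * X ^ 2 + C b * X := rfl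
    have h1 : C (ε : F) ^ 2 = 1 := by
      rcases hε with rfl | rfl <;> simp
    simp only [RR, TX, C_mul, C_neg, C_ofNat]
    linear_combination h + ff a b * h1 + hfd
  rw [e]
  have t : (C (-2 * (ε : F)) * (ff a b * ff a b ^ (Fintype.card F / 2))).natDegree
      ≤ 2 * Fintype.card F + 1 := by
    refine (natDegree_C_mul_le _ _).trans ?_
    refine (natDegree_mul_le_of_le (ff_natDegree a b)
      (natDegree_pow_le_of_le _ (ff_natDegree a b))).trans ?_
    omega
  refine natDegree_add_le_of_degree_le ?_ t
  have hq1 : 1 ≤ Fintype.card F := by omega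
  refine natDegree_add_le_of_degree_le (natDegree_add_le_of_degree_le (natDegree_add_le_of_degree_le
    (natDegree_add_le_of_degree_le ?_ ?_) ?_) ?_) ?_
  · rw [natDegree_X_pow]
  · rw [natDegree_X_pow]; omega
  · refine (natDegree_C_mul_le _ _).trans ?_
    rw [natDegree_X_pow]; omega
  · refine (natDegree_C_mul_le _ _).trans ?_
    rw [natDegree_X_pow]; omega
  · refine (natDegree_C_mul_le _ _).trans ?_
    rw [natDegree_X]; omega

lemma TX_ne : TX F ≠ 0 := FiniteField.X_pow_card_sub_X_ne_zero F Fintype.one_lt_card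

lemma TX_natDegree : (TX F).natDegree = Fintype.card F :=
  FiniteField.X_pow_card_sub_X_natDegree_eq F Fintype.one_lt_card

lemma p0_nonsing (hF : ringChar F ≠ 2) (h2 : (2 : F) ≠ 0) {a b : F} (hb : b ≠ 0)
    (hab : a ^ 2 - 4 * b ≠ 0) :
    (WW a b).Nonsingular (io (ff a b * X ^ Fintype.card F))
      (io (ff a b ^ 2 * ff a b ^ (Fintype.card F / 2))) := by
  apply ww_nonsing h2 hb hab
  simp only [io, ← map_mul, ← map_pow, ← map_add]
  congr 1
  linear_combination (ff a b) ^ 3 * ff_sq hF a b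

lemma hasH_p0 (hF : ringChar F ≠ 2) (h2 : (2 : F) ≠ 0) {a b : F} (hb : b ≠ 0)
    (hab : a ^ 2 - 4 * b ≠ 0) :
    HasH (.some _ _ (p0_nonsing hF h2 hb hab)) (Fintype.card F) := by
  refine ⟨X ^ Fintype.card F, 1, isCoprime_one_right, ⟨one_ne_zero, ?_⟩, ?_, ?_, ?_⟩
  · simp [io]
  · simp
  · simp
  · left; simp

lemma hasH_bound (hF : ringChar F ≠ 2) {a b : F} {ε : ℤ} (hε : ε = 1 ∨ ε = -1) {x y : K}
    {hn : (WW a b).Nonsingular x y}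
    (hx : x = ((io (ff a b ^ 2 * ff a b ^ (Fintype.card F / 2)) - io (C (ε : F)) * io (ff a b ^ 2)) /
      (io (ff a b * X ^ Fintype.card F) - io (ff a b * X))) ^ 2 - io (ff a b * C a) -
      io (ff a b * X ^ Fintype.card F) - io (ff a b * X))
    {h : ℕ} (hh : HasH (.some x y hn) h) : (h : ℤ) ≤ Fintype.card F + 1 - ε * SS a b := by
  obtain ⟨U, hU⟩ := GG_dvd_RR hF a b hε
  obtain ⟨V, hV⟩ := GG_dvd_TX a b hε
  have hG := (GG_monic a b ε).ne_zero
  have hT := TX_ne (F := F)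
  have hV0 : V ≠ 0 := by
    rintro rfl
    rw [mul_zero] at hV
    exact pow_ne_zero 2 hT hV
  have hx1 : x * io (TX F ^ 2) = io (ff a b * RR a b ε) := by
    have hf := io_ne (ff_ne a b)
    have hT' := io_ne hT
    have e1 : io (ff a b * X ^ Fintype.card F) - io (ff a b * X) = io (ff a b) * io (TX F) := by
      simp only [io, ← map_mul, ← map_sub]
      congr 1
      rw [TX]; ring
    rw [hx, e1, RR]
    simp only [io, map_mul, map_pow, map_add, map_sub] at *
    field_simp
    ring
  have hx2 : x * io V = io (ff a b * U) := by
    rw [hV, hU] at hx1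
    apply mul_left_cancel₀ (io_ne hG)
    simp only [io, map_mul] at *
    linear_combination hx1
  have dG := GG_natDegree a b hε
  have dV : V.natDegree + (GG a b ε).natDegree = 2 * Fintype.card F := by
    rw [add_comm, ← natDegree_mul hG hV0, ← hV, natDegree_pow, TX_natDegree]
  have dU : U.natDegree + (GG a b ε).natDegree ≤ 2 * Fintype.card F + 1 := by
    by_cases hU0 : U = 0
    · rw [hU0, natDegree_zero]; omega
    · rw [add_comm, ← natDegree_mul hG hU0, ← hU]
      exact RR_natDegree hF a b hε
  have := hasH_le hh U V hV0 hx2 (n := 2 * Fintype.card F + 1 - (GG a b ε).natDegree)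
    (by omega) (by omega)
  omega

lemma quad_seq (d : ℤ → ℕ) (q s : ℤ) (h0 : d 0 = q) (h1 : d 1 = q + 1 - s)
    (hm1 : d (-1) = q + 1 + s)
    (h : ∀ n, (d (n + 1) : ℤ) + d (n - 1) = 2 * d n + 2) : s ^ 2 ≤ 4 * q + 1 := by
  have pos : ∀ n : ℕ, (d n : ℤ) = n ^ 2 - s * n + q ∧
      (d (n + 1) : ℤ) = (n + 1) ^ 2 - s * (n + 1) + q := by
    intro n
    induction n with
    | zero => simp [h0, h1]; ring
    | succ n ih =>
      refine ⟨by push_cast; exact ih.2, ?_⟩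
      have := h (n + 1)
      rw [show (n : ℤ) + 1 - 1 = n by ring] at this
      push_cast
      linear_combination this + 2 * ih.2 - ih.1
  have neg : ∀ n : ℕ, (d (-n) : ℤ) = n ^ 2 + s * n + q ∧
      (d (-n - 1) : ℤ) = (n + 1) ^ 2 + s * (n + 1) + q := by
    intro n
    induction n with
    | zero => simp [h0, hm1]; ring
    | succ n ih =>
      refine ⟨by push_cast; rw [neg_add']; exact ih.2, ?_⟩
      have := h (-n - 1)
      rw [show -(n : ℤ) - 1 + 1 = -n by ring] at this
      push_cast
      rw [neg_add']
      linear_combination this + 2 * ih.2 - ih.1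
  have all : ∀ n : ℤ, 0 ≤ n ^ 2 - s * n + q := by
    intro n
    obtain ⟨k, rfl | rfl⟩ := n.eq_nat_or_neg
    · rw [← (pos k).1]; positivity
    · have := (neg k).1
      have h' : (0 : ℤ) ≤ d (-k) := by positivity
      rw [this] at h'
      linarith
  rcases Int.even_or_odd' s with ⟨k, hk | hk⟩
  · have := all k
    rw [hk] at this ⊢; nlinarith
  · have := all k
    rw [hk] at this ⊢; nlinarith

theorem hasse (hF : ringChar F ≠ 2) {a b : F} (hb : b ≠ 0) (hab : a ^ 2 - 4 * b ≠ 0) :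
    SS a b ^ 2 ≤ 4 * (Fintype.card F : ℤ) + 1 := by
  classical
  have h2 : (2 : F) ≠ 0 := Ring.two_ne_zero hF
  obtain ⟨Q, hQ⟩ : ∃ Q : (WW a b).Point, Q = .some _ _ (qq_nonsing h2 hb hab) := ⟨_, rfl⟩
  obtain ⟨P, hP⟩ : ∃ P : (WW a b).Point, P = .some _ _ (p0_nonsing hF h2 hb hab) := ⟨_, rfl⟩
  have parQ : ∀ (R : (WW a b).Point) (h h₁ h₂ : ℕ), HasH R h → HasH (R + Q) h₁ →
      HasH (R - Q) h₂ → h₁ + h₂ = 2 * h + 2 := by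
    intro R h h₁ h₂ e1 e2 e3
    rw [hQ] at e2 e3
    exact parallelogram h2 hb hab R e1 e2 e3
  have hHP : HasH P (Fintype.card F) := by
    rw [hP]; exact hasH_p0 hF h2 hb hab
  choose d hd using fun n : ℤ => exists_hasH (P + n • Q)
  have par : ∀ n, (d (n + 1) : ℤ) + d (n - 1) = 2 * d n + 2 := by
    intro n
    have i1 : HasH (P + n • Q + Q) (d (n + 1)) := by
      have := hd (n + 1)
      rwa [add_zsmul, one_zsmul, ← add_assoc] at this
    have i2 : HasH (P + n • Q - Q) (d (n - 1)) := by
      have := hd (n - 1)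
      rwa [sub_zsmul, one_zsmul, ← sub_eq_add_neg, ← add_sub_assoc] at this
    have := parQ (P + n • Q) _ _ _ (hd n) i1 i2
    exact_mod_cast this
  have d1 : HasH (P + Q) (d 1) := by
    have := hd 1
    rwa [one_zsmul] at this
  have dm1 : HasH (P - Q) (d (-1)) := by
    have := hd (-1)
    rwa [neg_one_zsmul, ← sub_eq_add_neg] at this
  have hp := parQ P _ _ _ hHP d1 dm1
  have p0 := par 0
  rw [zero_add, zero_sub] at p0
  have hne : io (ff a b * X ^ Fintype.card F) ≠ io (ff a b * X) := by
    intro h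
    have := mul_left_cancel₀ (ff_ne a b) (io_inj.1 h)
    exact TX_ne (F := F) (by rw [TX, this, sub_self])
  have b1 : (d 1 : ℤ) ≤ Fintype.card F + 1 - 1 * SS a b := by
    obtain ⟨x, y, hn, e, ex⟩ := ww_add (p0_nonsing hF h2 hb hab) (qq_nonsing h2 hb hab) hne
    rw [← hP, ← hQ] at e
    rw [e] at d1
    refine hasH_bound hF (Or.inl rfl) ?_ d1
    rw [ex]; simp [io]
  have bm1 : (d (-1) : ℤ) ≤ Fintype.card F + 1 - (-1) * SS a b := by
    obtain ⟨x, y, hn, e, ex⟩ := ww_sub (p0_nonsing hF h2 hb hab) (qq_nonsing h2 hb hab) hne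
    rw [← hP, ← hQ] at e
    rw [e] at dm1
    refine hasH_bound hF (Or.inr rfl) ?_ dm1
    rw [ex]; simp [io]
  exact quad_seq d _ _ (by omega) (by omega) (by omega) par

end Count
end APD

open Polynomial

namespace APD
section Sums
set_option linter.unusedSectionVars false
variable {F : Type*} [Field F] [Fintype F] [DecidableEq F]

/-- shifted quadratic character -/
noncomputable def gg (r x : F) : ℤ := quadraticChar F (x - r)

lemma qc_cases (x : F) : quadraticChar F x = 0 ∨ quadraticChar F x = 1 ∨ quadraticChar F x = -1 :=
  quadraticChar_isQuadratic F x

lemma sum_gg (hF : ringChar F ≠ 2) (r : F) : ∑ x, gg r x = 0 := by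
  rw [← quadraticChar_sum_zero hF]
  exact Equiv.sum_comp (Equiv.subRight r) (fun x => quadraticChar F x)

lemma sum_lin (hF : ringChar F ≠ 2) {r : F} (hr : r ≠ 0) :
    ∑ x, quadraticChar F (1 - r * x) = 0 := by
  have : ∀ x, quadraticChar F (1 - r * x) = quadraticChar F (-r) * gg r⁻¹ x := by
    intro x
    rw [gg, ← map_mul]
    congr 1
    field_simp
    ring
  simp only [this]
  rw [← Finset.mul_sum, sum_gg hF, mul_zero]

lemma qc_sq_mul {t : F} (ht : t ≠ 0) (x : F) :
    quadraticChar F (t ^ 2 * x) = quadraticChar F x := by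
  rw [map_mul, quadraticChar_sq_one' ht, one_mul]

lemma sum_quad (hF : ringChar F ≠ 2) {r s : F} (hrs : r ≠ s) : ∑ x, gg r x * gg s x = -1 := by
  have hd : s - r ≠ 0 := sub_ne_zero.2 hrs.symm
  have e1 : ∑ x, gg r x * gg s x = ∑ x, quadraticChar F (x * (x - (s - r))) := by
    rw [← Equiv.sum_comp (Equiv.addRight r) (fun x => gg r x * gg s x)]
    apply Finset.sum_congr rfl
    intro x _
    simp only [gg, Equiv.coe_addRight, ← map_mul]
    congr 1; ring
  rw [e1, ← Equiv.sum_comp (Equiv.inv F) (fun x => quadraticChar F (x * (x - (s - r))))]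
  have e2 : ∀ x : F, quadraticChar F (x⁻¹ * (x⁻¹ - (s - r))) =
      quadraticChar F (1 - (s - r) * x) - if x = 0 then 1 else 0 := by
    intro x
    by_cases hx : x = 0
    · subst hx; simp
    · rw [if_neg hx, sub_zero, ← qc_sq_mul hx]
      congr 1
      field_simp
  simp only [Equiv.inv_apply, e2]
  rw [Finset.sum_sub_distrib, sum_lin hF hd]
  simp

lemma sum_quad_ge (hF : ringChar F ≠ 2) (r s : F) : -1 ≤ ∑ x, gg r x * gg s x := by
  by_cases h : r = s
  · subst h
    have : 0 ≤ ∑ x, gg r x * gg r x := Finset.sum_nonneg fun x _ => mul_self_nonneg _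
    omega
  · rw [sum_quad hF h]

lemma sum_cubic (hF : ringChar F ≠ 2) {r s t : F} (hrs : r ≠ s) (hrt : r ≠ t) :
    (∑ x, gg r x * gg s x * gg t x) ^ 2 ≤ 4 * (Fintype.card F : ℤ) + 1 := by
  have hs : s - r ≠ 0 := sub_ne_zero.2 hrs.symm
  have ht : t - r ≠ 0 := sub_ne_zero.2 hrt.symm
  have e1 : ∑ x, gg r x * gg s x * gg t x =
      SS (-((s - r) + (t - r))) ((s - r) * (t - r)) := by
    rw [SS, ← Equiv.sum_comp (Equiv.addRight r) (fun x => gg r x * gg s x * gg t x)]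
    apply Finset.sum_congr rfl
    intro x _
    simp only [gg, Equiv.coe_addRight, ← map_mul, ff, eval_add, eval_mul, eval_pow, eval_X, eval_C]
    congr 1; ring
  by_cases hst : s = t
  · subst hst
    have e2 : ∀ x, gg r x * gg s x * gg s x = gg r x - if x = s then gg r s else 0 := by
      intro x
      by_cases hx : x = s
      · subst hx; simp [gg]
      · rw [if_neg hx, sub_zero, mul_assoc, gg, gg, ← sq,
          quadraticChar_sq_one (sub_ne_zero.2 hx), mul_one]
    simp only [e2]
    rw [Finset.sum_sub_distrib, sum_gg hF]
    simp only [Finset.sum_ite_eq', Finset.mem_univ, if_true]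
    rcases qc_cases (s - r) with h | h | h <;> rw [gg, h] <;> norm_num
    positivity
  · rw [e1]
    apply hasse hF (mul_ne_zero hs ht)
    have : (-((s - r) + (t - r))) ^ 2 - 4 * ((s - r) * (t - r)) = (s - t) ^ 2 := by ring
    rw [this]
    exact pow_ne_zero 2 (sub_ne_zero.2 hst)

lemma bound_of_sq {C q : ℤ} (hq : 1307 ≤ q) (h : C ^ 2 ≤ 4 * q + 1) : 18 * |C| ≤ q := by
  by_contra! hc
  have h' : |C| ^ 2 ≤ 4 * q + 1 := by rwa [sq_abs]
  nlinarith

lemma sum_quartic (hF : ringChar F ≠ 2) (hq : (1307 : ℤ) ≤ Fintype.card F) {r s t : F}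
    (hr : r ≠ 0) (hs : s ≠ 0) (ht : t ≠ 0) (hrs : r ≠ s) (hrt : r ≠ t) :
    18 * |∑ x, gg 0 x * gg r x * gg s x * gg t x| ≤ Fintype.card F + 18 := by
  have e2 : ∀ x : F, gg 0 x⁻¹ * gg r x⁻¹ * gg s x⁻¹ * gg t x⁻¹ =
      quadraticChar F (-(r * s * t)) * ((gg r⁻¹ x * gg s⁻¹ x * gg t⁻¹ x) -
        if x = 0 then gg r⁻¹ 0 * gg s⁻¹ 0 * gg t⁻¹ 0 else 0) := by
    intro x
    by_cases hx : x = 0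
    · subst hx; simp [gg]
    · rw [if_neg hx, sub_zero]
      simp only [gg, ← map_mul]
      rw [← qc_sq_mul (pow_ne_zero 2 hx)]
      congr 1
      field_simp
      ring
  rw [← Equiv.sum_comp (Equiv.inv F) (fun x => gg 0 x * gg r x * gg s x * gg t x)]
  simp only [Equiv.inv_apply, e2]
  rw [← Finset.mul_sum, Finset.sum_sub_distrib, abs_mul]
  simp only [Finset.sum_ite_eq', Finset.mem_univ, if_true]
  have b := bound_of_sq hq (sum_cubic hF (inv_injective.ne hrs) (inv_injective.ne hrt))
  have qb : ∀ x : F, |quadraticChar F x| ≤ 1 := by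
    intro x
    rcases qc_cases x with h | h | h <;> rw [h] <;> norm_num
  have b2 : |gg r⁻¹ 0 * gg s⁻¹ 0 * gg t⁻¹ 0| ≤ 1 := by
    simp only [gg, ← map_mul]; exact qb _
  have b1 := qb (-(r * s * t))
  have tri := abs_sub (∑ x, gg r⁻¹ x * gg s⁻¹ x * gg t⁻¹ x) (gg r⁻¹ 0 * gg s⁻¹ 0 * gg t⁻¹ 0)
  have := mul_le_mul b1 tri (abs_nonneg _) (by norm_num)
  omega

/-- good parameters -/
noncomputable def VV (F : Type*) [Field F] [Fintype F] [DecidableEq F] : Finset F :=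
  Finset.univ.filter fun w => quadraticChar F (-w) = 1 ∧ quadraticChar F (1 - w) = -1 ∧
    quadraticChar F (1 - 9 * w) = 1 ∧ quadraticChar F (9 - w) = 1

theorem card_VV (h2 : (2 : F) ≠ 0) (h3 : (3 : F) ≠ 0) (hq : 1307 ≤ Fintype.card F) :
    55 ≤ (VV F).card := by
  have hF : ringChar F ≠ 2 := fun h => h2 (by
    have : ((ringChar F : ℕ) : F) = 0 := ringChar.Nat.cast_ringChar
    rw [h] at this; exact_mod_cast this)
  have hqz : (1307 : ℤ) ≤ Fintype.card F := by exact_mod_cast hq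
  have h9 : (9 : F) ≠ 0 := by
    rw [show (9 : F) = 3 * 3 by norm_num]; exact mul_ne_zero h3 h3
  have h91 : (1 : F) ≠ 9 := by
    intro h
    have : (2 : F) ^ 3 = 0 := by linear_combination -h
    exact pow_ne_zero 3 h2 this
  have h19 : (1 : F) ≠ 9⁻¹ := by
    intro h
    apply h91
    field_simp at h
    exact h.symm
  have hi : (9 : F)⁻¹ ≠ 0 := inv_ne_zero h9
  have hc : quadraticChar F (-1) = 1 ∨ quadraticChar F (-1) = -1 :=
    quadraticChar_dichotomy (neg_ne_zero.2 one_ne_zero)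
  set c := quadraticChar F (-1) with hcdef
  have hcc : c ^ 2 = 1 := by rcases hc with h | h <;> rw [h] <;> norm_num
  have ha : ∀ w : F, quadraticChar F (-w) = c * gg 0 w := by
    intro w; rw [hcdef, gg, ← map_mul]; congr 1; ring
  have hb : ∀ w : F, quadraticChar F (1 - w) = c * gg 1 w := by
    intro w; rw [hcdef, gg, ← map_mul]; congr 1; ring
  have hd : ∀ w : F, quadraticChar F (9 - w) = c * gg 9 w := by
    intro w; rw [hcdef, gg, ← map_mul]; congr 1; ring
  have hg : ∀ w : F, quadraticChar F (1 - 9 * w) = c * gg 9⁻¹ w := by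
    intro w; rw [hcdef, gg, ← map_mul, ← qc_sq_mul h3 (-1 * (w - 9⁻¹))]; congr 1
    field_simp; ring
  -- upper bound
  have up : ∑ w : F, (1 + quadraticChar F (-w)) * (1 - quadraticChar F (1 - w)) *
      (1 + quadraticChar F (1 - 9 * w)) * (1 + quadraticChar F (9 - w)) ≤
      16 * (VV F).card + 16 * 4 := by
    have pt : ∀ w : F, (1 + quadraticChar F (-w)) * (1 - quadraticChar F (1 - w)) *
      (1 + quadraticChar F (1 - 9 * w)) * (1 + quadraticChar F (9 - w)) ≤
      16 * (if w ∈ VV F then 1 else 0) + 16 * (if w ∈ ({0, 1, 9⁻¹, 9} : Finset F) then 1 else 0) := by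
      intro w
      by_cases hw : w ∈ ({0, 1, 9⁻¹, 9} : Finset F)
      · rw [if_pos hw]
        have : (0 : ℤ) ≤ if w ∈ VV F then 1 else 0 := by split_ifs <;> norm_num
        rcases qc_cases (-w) with h1 | h1 | h1 <;> rcases qc_cases (1 - w) with h2 | h2 | h2 <;>
        rcases qc_cases (1 - 9 * w) with h3 | h3 | h3 <;>
        rcases qc_cases (9 - w) with h4 | h4 | h4 <;> rw [h1, h2, h3, h4] <;> linarith
      · rw [if_neg hw]
        simp only [Finset.mem_insert, Finset.mem_singleton, not_or] at hw
        obtain ⟨n1, n2, n3, n4⟩ := hw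
        have m1 := quadraticChar_dichotomy (neg_ne_zero.2 n1)
        have m2 := quadraticChar_dichotomy (sub_ne_zero.2 (Ne.symm n2))
        have m4 := quadraticChar_dichotomy (sub_ne_zero.2 (Ne.symm n4))
        have m3 := quadraticChar_dichotomy (F := F) (a := 1 - 9 * w) (by
          intro h; apply n3; field_simp; linear_combination -h)
        have mem : w ∈ VV F ↔ quadraticChar F (-w) = 1 ∧ quadraticChar F (1 - w) = -1 ∧
            quadraticChar F (1 - 9 * w) = 1 ∧ quadraticChar F (9 - w) = 1 := by
          simp [VV]
        rcases m1 with h1 | h1 <;> rcases m2 with h2 | h2 <;> rcases m3 with h3 | h3 <;>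
          rcases m4 with h4 | h4 <;> simp only [mem, h1, h2, h3, h4] <;> norm_num
    refine (Finset.sum_le_sum fun w _ => pt w).trans ?_
    rw [Finset.sum_add_distrib, ← Finset.mul_sum, ← Finset.mul_sum]
    simp only [Finset.sum_ite_mem, Finset.univ_inter, Finset.sum_const, nsmul_eq_mul, mul_one]
    have : ({0, 1, 9⁻¹, 9} : Finset F).card ≤ 4 := Finset.card_le_four
    have : ((({0, 1, 9⁻¹, 9} : Finset F).card : ℕ) : ℤ) ≤ 4 := by exact_mod_cast this
    linarith
  -- expansion
  have ex : ∑ w : F, (1 + quadraticChar F (-w)) * (1 - quadraticChar F (1 - w)) *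
      (1 + quadraticChar F (1 - 9 * w)) * (1 + quadraticChar F (9 - w)) =
      ∑ w : F, (1 + c * gg 0 w + (-c) * gg 1 w + c * gg 9⁻¹ w + c * gg 9 w
        + (-1) * (gg 0 w * gg 1 w) + gg 0 w * gg 9⁻¹ w + gg 0 w * gg 9 w
        + (-1) * (gg 1 w * gg 9⁻¹ w) + (-1) * (gg 1 w * gg 9 w) + gg 9⁻¹ w * gg 9 w
        + (-c) * (gg 0 w * gg 1 w * gg 9⁻¹ w) + (-c) * (gg 0 w * gg 1 w * gg 9 w)
        + c * (gg 0 w * gg 9⁻¹ w * gg 9 w) + (-c) * (gg 1 w * gg 9⁻¹ w * gg 9 w)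
        + (-1) * (gg 0 w * gg 1 w * gg 9⁻¹ w * gg 9 w)) := by
    apply Finset.sum_congr rfl
    intro w _
    rw [ha, hb, hg, hd]
    generalize gg 0 w = A
    generalize gg 1 w = B
    generalize gg 9⁻¹ w = D
    generalize gg 9 w = E
    linear_combination (-A * B + A * D + A * E - B * D - B * E + D * E
      + c * (-A * B * D - A * B * E + A * D * E - B * D * E) - A * B * D * E * (c ^ 2 + 1)) * hcc
  rw [ex] at up
  simp only [Finset.sum_add_distrib, ← Finset.mul_sum] at up
  rw [sum_gg hF, sum_gg hF, sum_gg hF, sum_gg hF, sum_quad hF zero_ne_one, sum_quad hF hi.symm,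
    sum_quad hF h9.symm, sum_quad hF h19, sum_quad hF h91] at up
  have q1 := sum_quad_ge hF (9⁻¹ : F) 9
  have k1 := bound_of_sq hqz (sum_cubic hF (zero_ne_one (α := F)) hi.symm)
  have k2 := bound_of_sq hqz (sum_cubic hF (zero_ne_one (α := F)) h9.symm)
  have k3 := bound_of_sq hqz (sum_cubic hF hi.symm h9.symm)
  have k4 := bound_of_sq hqz (sum_cubic hF h19 h91)
  have k5 := sum_quartic hF hqz one_ne_zero hi h9 h19 h91
  simp only [Finset.sum_const, Finset.card_univ, nsmul_eq_mul, mul_one] at up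
  generalize ∑ x : F, gg 0 x * gg 1 x * gg 9⁻¹ x = C1 at *
  generalize ∑ x : F, gg 0 x * gg 1 x * gg 9 x = C2 at *
  generalize ∑ x : F, gg 0 x * gg 9⁻¹ x * gg 9 x = C3 at *
  generalize ∑ x : F, gg 1 x * gg 9⁻¹ x * gg 9 x = C4 at *
  generalize ∑ x : F, gg 0 x * gg 1 x * gg 9⁻¹ x * gg 9 x = C5 at *
  have a1 := neg_abs_le C1
  have a1' := le_abs_self C1
  have a2 := neg_abs_le C2
  have a2' := le_abs_self C2
  have a3 := neg_abs_le C3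
  have a3' := le_abs_self C3
  have a4 := neg_abs_le C4
  have a4' := le_abs_self C4
  have a5' := le_abs_self C5
  rcases hc with h | h <;> rw [h] at up <;> omega

end Sums
end APD

namespace APD
/-- The nondegeneracy conditions on the parameter. -/
structure Good {F : Type*} [Field F] (w : F) : Prop where
  h2 : (2 : F) ≠ 0
  h3 : (3 : F) ≠ 0
  w0 : w ≠ 0
  e1 : -1 + 1 * w ≠ 0
  e2 : -9 + 1 * w ≠ 0
  e3 : -1 + 9 * w ≠ 0
  f1 : -17 + 9 * w ≠ 0
  f2 : -11 + 3 * w ≠ 0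
  f3 : -10 + 3 * w ≠ 0
  f4 : -5 + 3 * w ≠ 0
  f5 : -5 + 9 * w ≠ 0
  f6 : -5 + 12 * w ≠ 0
  f7 : -4 + 1 * w ≠ 0
  f8 : -4 + 7 * w ≠ 0
  f9 : -2 + 3 * w ≠ 0
  f10 : -2 + 9 * w ≠ 0
  f11 : -1 + 2 * w ≠ 0
  f12 : -1 + 3 * w ≠ 0
  f13 : -1 + 4 * w ≠ 0
  f14 : -1 + 5 * w ≠ 0
  f15 : -1 + 7 * w ≠ 0
  f16 : -1 + 17 * w ≠ 0
  f17 : -1 + 18 * w ≠ 0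
  f18 : 1 + 2 * w ≠ 0
  f19 : 1 + 3 * w ≠ 0
  f20 : 1 + 5 * w ≠ 0
  f21 : 1 + 6 * w ≠ 0
  f22 : 1 + 7 * w ≠ 0
  f23 : 1 + 15 * w ≠ 0
  f24 : 2 + 3 * w ≠ 0
  f25 : 7 + 9 * w ≠ 0
  f26 : -34 + 9 * w + 153 * w ^ 2 ≠ 0
  f27 : -7 + 9 * w + 126 * w ^ 2 ≠ 0
  f28 : -2 + 9 * w ^ 2 ≠ 0
  f29 : -1 + 18 * w ^ 2 ≠ 0
  f30 : 2 - 45 * w + 171 * w ^ 2 ≠ 0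
  f31 : 5 - 18 * w + 45 * w ^ 2 ≠ 0
  f32 : 11 - 45 * w + 162 * w ^ 2 ≠ 0

lemma Good.cw {F : Type*} [Field F] {w : F} (g : Good w) (a b c : ℕ) :
    (2 : F) ^ a * 3 ^ b * w ^ c ≠ 0 :=
  mul_ne_zero (mul_ne_zero (pow_ne_zero a g.h2) (pow_ne_zero b g.h3)) (pow_ne_zero c g.w0)

/-- exceptional points, scaled by `3 * w` -/
def px {F : Type*} [Field F] (w : F) : Fin 6 → F
  | 0 => 0 | 1 => 3 * w | 2 => 9 * w | 3 => 9 * w ^ 2 | 4 => w | 5 => 1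

/-- values at exceptional points, scaled by `3 * w` -/
def pv {F : Type*} [Field F] (w : F) : Fin 6 → F
  | 0 => 3 * w | 1 => 0 | 2 => 1 | 3 => w | 4 => 9 * w ^ 2 | 5 => 9 * w

section Cases
variable {F : Type*} [Field F] {w : F}

lemma two_end (g : Good w) (i j : Fin 6) (hij : i ≠ j)
    (H : (2 * px w j - px w i) * (2 * pv w j - pv w i) = 9 * w ^ 2) : False := by
  fin_cases i <;> fin_cases j <;> first | exact hij rfl | skip
  · have h : (2 * (3 * w) - (0)) * (2 * (0) - (3 * w)) = 9 * w ^ 2 := H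
    exact (g.cw 0 3 2) (by linear_combination -h)
  · have h : (2 * (9 * w) - (0)) * (2 * (1) - (3 * w)) = 9 * w ^ 2 := H
    exact (mul_ne_zero (g.cw 0 2 1) g.f8) (by linear_combination -h)
  · have h : (2 * (9 * w ^ 2) - (0)) * (2 * (w) - (3 * w)) = 9 * w ^ 2 := H
    exact (mul_ne_zero (g.cw 0 2 2) g.f18) (by linear_combination -h)
  · have h : (2 * (w) - (0)) * (2 * (9 * w ^ 2) - (3 * w)) = 9 * w ^ 2 := H
    exact (mul_ne_zero (g.cw 0 1 2) g.f6) (by linear_combination h)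
  · have h : (2 * (1) - (0)) * (2 * (9 * w) - (3 * w)) = 9 * w ^ 2 := H
    exact (mul_ne_zero (g.cw 0 1 1) g.f3) (by linear_combination -h)
  · have h : (2 * (0) - (3 * w)) * (2 * (3 * w) - (0)) = 9 * w ^ 2 := H
    exact (g.cw 0 3 2) (by linear_combination -h)
  · have h : (2 * (9 * w) - (3 * w)) * (2 * (1) - (0)) = 9 * w ^ 2 := H
    exact (mul_ne_zero (g.cw 0 1 1) g.f3) (by linear_combination -h)
  · have h : (2 * (9 * w ^ 2) - (3 * w)) * (2 * (w) - (0)) = 9 * w ^ 2 := H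
    exact (mul_ne_zero (g.cw 0 1 2) g.f6) (by linear_combination h)
  · have h : (2 * (w) - (3 * w)) * (2 * (9 * w ^ 2) - (0)) = 9 * w ^ 2 := H
    exact (mul_ne_zero (g.cw 0 2 2) g.f18) (by linear_combination -h)
  · have h : (2 * (1) - (3 * w)) * (2 * (9 * w) - (0)) = 9 * w ^ 2 := H
    exact (mul_ne_zero (g.cw 0 2 1) g.f8) (by linear_combination -h)
  · have h : (2 * (0) - (9 * w)) * (2 * (3 * w) - (1)) = 9 * w ^ 2 := H
    exact (mul_ne_zero (g.cw 0 2 1) g.f15) (by linear_combination -h)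
  · have h : (2 * (3 * w) - (9 * w)) * (2 * (0) - (1)) = 9 * w ^ 2 := H
    exact (mul_ne_zero (g.cw 0 1 1) g.f12) (by linear_combination -h)
  · have h : (2 * (9 * w ^ 2) - (9 * w)) * (2 * (w) - (1)) = 9 * w ^ 2 := H
    exact (mul_ne_zero (mul_ne_zero (g.cw 0 2 1) g.f13) g.e1) (by linear_combination h)
  · have h : (2 * (w) - (9 * w)) * (2 * (9 * w ^ 2) - (1)) = 9 * w ^ 2 := H
    exact (mul_ne_zero (g.cw 0 0 1) g.f27) (by linear_combination -h)
  · have h : (2 * (1) - (9 * w)) * (2 * (9 * w) - (1)) = 9 * w ^ 2 := H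
    exact (mul_ne_zero (g.cw 0 0 0) g.f30) (by linear_combination -h)
  · have h : (2 * (0) - (9 * w ^ 2)) * (2 * (3 * w) - (w)) = 9 * w ^ 2 := H
    exact (mul_ne_zero (g.cw 0 2 2) g.f20) (by linear_combination -h)
  · have h : (2 * (3 * w) - (9 * w ^ 2)) * (2 * (0) - (w)) = 9 * w ^ 2 := H
    exact (mul_ne_zero (g.cw 0 1 2) g.f4) (by linear_combination h)
  · have h : (2 * (9 * w) - (9 * w ^ 2)) * (2 * (1) - (w)) = 9 * w ^ 2 := H
    exact (mul_ne_zero (mul_ne_zero (g.cw 0 2 1) g.f7) g.e1) (by linear_combination h)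
  · have h : (2 * (w) - (9 * w ^ 2)) * (2 * (9 * w ^ 2) - (w)) = 9 * w ^ 2 := H
    exact (mul_ne_zero (g.cw 0 0 2) g.f32) (by linear_combination -h)
  · have h : (2 * (1) - (9 * w ^ 2)) * (2 * (9 * w) - (w)) = 9 * w ^ 2 := H
    exact (mul_ne_zero (g.cw 0 0 1) g.f26) (by linear_combination -h)
  · have h : (2 * (0) - (w)) * (2 * (3 * w) - (9 * w ^ 2)) = 9 * w ^ 2 := H
    exact (mul_ne_zero (g.cw 0 1 2) g.f4) (by linear_combination h)
  · have h : (2 * (3 * w) - (w)) * (2 * (0) - (9 * w ^ 2)) = 9 * w ^ 2 := H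
    exact (mul_ne_zero (g.cw 0 2 2) g.f20) (by linear_combination -h)
  · have h : (2 * (9 * w) - (w)) * (2 * (1) - (9 * w ^ 2)) = 9 * w ^ 2 := H
    exact (mul_ne_zero (g.cw 0 0 1) g.f26) (by linear_combination -h)
  · have h : (2 * (9 * w ^ 2) - (w)) * (2 * (w) - (9 * w ^ 2)) = 9 * w ^ 2 := H
    exact (mul_ne_zero (g.cw 0 0 2) g.f32) (by linear_combination -h)
  · have h : (2 * (1) - (w)) * (2 * (9 * w) - (9 * w ^ 2)) = 9 * w ^ 2 := H
    exact (mul_ne_zero (mul_ne_zero (g.cw 0 2 1) g.f7) g.e1) (by linear_combination h)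
  · have h : (2 * (0) - (1)) * (2 * (3 * w) - (9 * w)) = 9 * w ^ 2 := H
    exact (mul_ne_zero (g.cw 0 1 1) g.f12) (by linear_combination -h)
  · have h : (2 * (3 * w) - (1)) * (2 * (0) - (9 * w)) = 9 * w ^ 2 := H
    exact (mul_ne_zero (g.cw 0 2 1) g.f15) (by linear_combination -h)
  · have h : (2 * (9 * w) - (1)) * (2 * (1) - (9 * w)) = 9 * w ^ 2 := H
    exact (mul_ne_zero (g.cw 0 0 0) g.f30) (by linear_combination -h)
  · have h : (2 * (9 * w ^ 2) - (1)) * (2 * (w) - (9 * w)) = 9 * w ^ 2 := H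
    exact (mul_ne_zero (g.cw 0 0 1) g.f27) (by linear_combination -h)
  · have h : (2 * (w) - (1)) * (2 * (9 * w ^ 2) - (9 * w)) = 9 * w ^ 2 := H
    exact (mul_ne_zero (mul_ne_zero (g.cw 0 2 1) g.f13) g.e1) (by linear_combination h)

lemma two_mid_lt (g : Good w) (i j : Fin 6) (hij : i < j)
    (H : (px w i + px w j) * (pv w i + pv w j) = 36 * w ^ 2) : False := by
  fin_cases i <;> fin_cases j <;> first | exact absurd hij (by decide) | skip
  · have h : (0 + 3 * w) * (3 * w + 0) = 36 * w ^ 2 := H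
    exact (g.cw 0 3 2) (by linear_combination -h)
  · have h : (0 + 9 * w) * (3 * w + 1) = 36 * w ^ 2 := H
    exact (mul_ne_zero (g.cw 0 2 1) g.e1) (by linear_combination -h)
  · have h : (0 + 9 * w ^ 2) * (3 * w + w) = 36 * w ^ 2 := H
    exact (mul_ne_zero (g.cw 2 2 2) g.e1) (by linear_combination h)
  · have h : (0 + w) * (3 * w + 9 * w ^ 2) = 36 * w ^ 2 := H
    exact (mul_ne_zero (g.cw 0 1 2) g.f2) (by linear_combination h)
  · have h : (0 + 1) * (3 * w + 9 * w) = 36 * w ^ 2 := H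
    exact (mul_ne_zero (g.cw 2 1 1) g.f12) (by linear_combination -h)
  · have h : (3 * w + 9 * w) * (0 + 1) = 36 * w ^ 2 := H
    exact (mul_ne_zero (g.cw 2 1 1) g.f12) (by linear_combination -h)
  · have h : (3 * w + 9 * w ^ 2) * (0 + w) = 36 * w ^ 2 := H
    exact (mul_ne_zero (g.cw 0 1 2) g.f2) (by linear_combination h)
  · have h : (3 * w + w) * (0 + 9 * w ^ 2) = 36 * w ^ 2 := H
    exact (mul_ne_zero (g.cw 2 2 2) g.e1) (by linear_combination h)
  · have h : (3 * w + 1) * (0 + 9 * w) = 36 * w ^ 2 := H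
    exact (mul_ne_zero (g.cw 0 2 1) g.e1) (by linear_combination -h)
  · have h : (9 * w + 9 * w ^ 2) * (1 + w) = 36 * w ^ 2 := H
    exact (mul_ne_zero (mul_ne_zero (g.cw 0 2 1) g.e1) g.e1) (by linear_combination h)
  · have h : (9 * w + w) * (1 + 9 * w ^ 2) = 36 * w ^ 2 := H
    exact (mul_ne_zero (g.cw 1 0 1) g.f31) (by linear_combination h)
  · have h : (9 * w + 1) * (1 + 9 * w) = 36 * w ^ 2 := H
    exact (mul_ne_zero (mul_ne_zero (g.cw 0 0 0) g.f19) g.f23) (by linear_combination h)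
  · have h : (9 * w ^ 2 + w) * (w + 9 * w ^ 2) = 36 * w ^ 2 := H
    exact (mul_ne_zero (mul_ne_zero (g.cw 0 0 2) g.f5) g.f25) (by linear_combination h)
  · have h : (9 * w ^ 2 + 1) * (w + 9 * w) = 36 * w ^ 2 := H
    exact (mul_ne_zero (g.cw 1 0 1) g.f31) (by linear_combination h)
  · have h : (w + 1) * (9 * w ^ 2 + 9 * w) = 36 * w ^ 2 := H
    exact (mul_ne_zero (mul_ne_zero (g.cw 0 2 1) g.e1) g.e1) (by linear_combination h)

lemma three_lt (g : Good w) (i k j : Fin 6) (hik : i < k) (hij : i ≠ j) (hkj : k ≠ j)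
    (H : px w i + px w k = 2 * px w j) (H' : pv w i + pv w k = 2 * pv w j) : False := by
  fin_cases i <;> fin_cases k <;> first | exact absurd hik (by decide) | skip
  all_goals fin_cases j <;> first | exact hij rfl | exact hkj rfl | skip
  · have h : 3 * w + 0 = 2 * (1) := H'
    exact (mul_ne_zero (g.cw 0 0 0) g.f9) (by linear_combination h)
  · have h : 3 * w + 0 = 2 * (w) := H'
    exact (g.cw 0 0 1) (by linear_combination h)
  · have h : 0 + 3 * w = 2 * (w) := H
    exact (g.cw 0 0 1) (by linear_combination h)
  · have h : 0 + 3 * w = 2 * (1) := H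
    exact (mul_ne_zero (g.cw 0 0 0) g.f9) (by linear_combination h)
  · have h : 0 + 9 * w = 2 * (3 * w) := H
    exact (g.cw 0 1 1) (by linear_combination h)
  · have h : 0 + 9 * w = 2 * (9 * w ^ 2) := H
    exact (mul_ne_zero (g.cw 0 2 1) g.f11) (by linear_combination -h)
  · have h : 3 * w + 1 = 2 * (9 * w ^ 2) := H'
    exact (mul_ne_zero (mul_ne_zero (g.cw 0 0 0) g.f12) g.f21) (by linear_combination -h)
  · have h : 0 + 9 * w = 2 * (1) := H
    exact (mul_ne_zero (g.cw 0 0 0) g.f10) (by linear_combination h)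
  · have h : 3 * w + w = 2 * (0) := H'
    exact (g.cw 2 0 1) (by linear_combination h)
  · have h : 3 * w + w = 2 * (1) := H'
    exact (mul_ne_zero (g.cw 1 0 0) g.f11) (by linear_combination h)
  · have h : 0 + 9 * w ^ 2 = 2 * (w) := H
    exact (mul_ne_zero (g.cw 0 0 1) g.f10) (by linear_combination h)
  · have h : 0 + 9 * w ^ 2 = 2 * (1) := H
    exact (mul_ne_zero (g.cw 0 0 0) g.f28) (by linear_combination h)
  · have h : 3 * w + 9 * w ^ 2 = 2 * (0) := H'
    exact (mul_ne_zero (g.cw 0 1 1) g.f19) (by linear_combination h)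
  · have h : 3 * w + 9 * w ^ 2 = 2 * (1) := H'
    exact (mul_ne_zero (mul_ne_zero (g.cw 0 0 0) g.f12) g.f24) (by linear_combination h)
  · have h : 0 + w = 2 * (9 * w ^ 2) := H
    exact (mul_ne_zero (g.cw 0 0 1) g.f17) (by linear_combination -h)
  · have h : 3 * w + 9 * w ^ 2 = 2 * (9 * w) := H'
    exact (mul_ne_zero (g.cw 0 1 1) g.f4) (by linear_combination h)
  · have h : 3 * w + 9 * w = 2 * (0) := H'
    exact (g.cw 2 1 1) (by linear_combination h)
  · have h : 0 + 1 = 2 * (9 * w) := H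
    exact (mul_ne_zero (g.cw 0 0 0) g.f17) (by linear_combination -h)
  · have h : 0 + 1 = 2 * (9 * w ^ 2) := H
    exact (mul_ne_zero (g.cw 0 0 0) g.f29) (by linear_combination -h)
  · have h : 3 * w + 9 * w = 2 * (9 * w ^ 2) := H'
    exact (mul_ne_zero (g.cw 1 1 1) g.f9) (by linear_combination -h)
  · have h : 3 * w + 9 * w = 2 * (0) := H
    exact (g.cw 2 1 1) (by linear_combination h)
  · have h : 3 * w + 9 * w = 2 * (9 * w ^ 2) := H
    exact (mul_ne_zero (g.cw 1 1 1) g.f9) (by linear_combination -h)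
  · have h : 0 + 1 = 2 * (9 * w ^ 2) := H'
    exact (mul_ne_zero (g.cw 0 0 0) g.f29) (by linear_combination -h)
  · have h : 0 + 1 = 2 * (9 * w) := H'
    exact (mul_ne_zero (g.cw 0 0 0) g.f17) (by linear_combination -h)
  · have h : 3 * w + 9 * w ^ 2 = 2 * (0) := H
    exact (mul_ne_zero (g.cw 0 1 1) g.f19) (by linear_combination h)
  · have h : 3 * w + 9 * w ^ 2 = 2 * (9 * w) := H
    exact (mul_ne_zero (g.cw 0 1 1) g.f4) (by linear_combination h)
  · have h : 0 + w = 2 * (9 * w ^ 2) := H'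
    exact (mul_ne_zero (g.cw 0 0 1) g.f17) (by linear_combination -h)
  · have h : 3 * w + 9 * w ^ 2 = 2 * (1) := H
    exact (mul_ne_zero (mul_ne_zero (g.cw 0 0 0) g.f12) g.f24) (by linear_combination h)
  · have h : 3 * w + w = 2 * (0) := H
    exact (g.cw 2 0 1) (by linear_combination h)
  · have h : 0 + 9 * w ^ 2 = 2 * (1) := H'
    exact (mul_ne_zero (g.cw 0 0 0) g.f28) (by linear_combination h)
  · have h : 0 + 9 * w ^ 2 = 2 * (w) := H'
    exact (mul_ne_zero (g.cw 0 0 1) g.f10) (by linear_combination h)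
  · have h : 3 * w + w = 2 * (1) := H
    exact (mul_ne_zero (g.cw 1 0 0) g.f11) (by linear_combination h)
  · have h : 0 + 9 * w = 2 * (3 * w) := H'
    exact (g.cw 0 1 1) (by linear_combination h)
  · have h : 0 + 9 * w = 2 * (1) := H'
    exact (mul_ne_zero (g.cw 0 0 0) g.f10) (by linear_combination h)
  · have h : 3 * w + 1 = 2 * (9 * w ^ 2) := H
    exact (mul_ne_zero (mul_ne_zero (g.cw 0 0 0) g.f12) g.f21) (by linear_combination -h)
  · have h : 0 + 9 * w = 2 * (9 * w ^ 2) := H'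
    exact (mul_ne_zero (g.cw 0 2 1) g.f11) (by linear_combination -h)
  · have h : 1 + w = 2 * (3 * w) := H'
    exact (mul_ne_zero (g.cw 0 0 0) g.f14) (by linear_combination -h)
  · have h : 9 * w + 9 * w ^ 2 = 2 * (3 * w) := H
    exact (mul_ne_zero (g.cw 0 1 1) g.f19) (by linear_combination h)
  · have h : 9 * w + 9 * w ^ 2 = 2 * (w) := H
    exact (mul_ne_zero (g.cw 0 0 1) g.f25) (by linear_combination h)
  · have h : 1 + w = 2 * (9 * w) := H'
    exact (mul_ne_zero (g.cw 0 0 0) g.f16) (by linear_combination -h)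
  · have h : 1 + 9 * w ^ 2 = 2 * (3 * w) := H'
    exact (mul_ne_zero (mul_ne_zero (g.cw 0 0 0) g.f12) g.f12) (by linear_combination h)
  · have h : 9 * w + w = 2 * (3 * w) := H
    exact (g.cw 2 0 1) (by linear_combination h)
  · have h : 9 * w + w = 2 * (9 * w ^ 2) := H
    exact (mul_ne_zero (g.cw 1 0 1) g.f5) (by linear_combination -h)
  · have h : 9 * w + w = 2 * (1) := H
    exact (mul_ne_zero (g.cw 1 0 0) g.f14) (by linear_combination h)
  · have h : 1 + 9 * w = 2 * (3 * w) := H'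
    exact (mul_ne_zero (g.cw 0 0 0) g.f19) (by linear_combination h)
  · have h : 9 * w + 1 = 2 * (3 * w) := H
    exact (mul_ne_zero (g.cw 0 0 0) g.f19) (by linear_combination h)
  · have h : 1 + 9 * w = 2 * (w) := H'
    exact (mul_ne_zero (g.cw 0 0 0) g.f22) (by linear_combination h)
  · have h : 9 * w + 1 = 2 * (w) := H
    exact (mul_ne_zero (g.cw 0 0 0) g.f22) (by linear_combination h)
  · have h : w + 9 * w ^ 2 = 2 * (3 * w) := H'
    exact (mul_ne_zero (g.cw 0 0 1) g.f5) (by linear_combination h)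
  · have h : 9 * w ^ 2 + w = 2 * (3 * w) := H
    exact (mul_ne_zero (g.cw 0 0 1) g.f5) (by linear_combination h)
  · have h : 9 * w ^ 2 + w = 2 * (9 * w) := H
    exact (mul_ne_zero (g.cw 0 0 1) g.f1) (by linear_combination h)
  · have h : w + 9 * w ^ 2 = 2 * (9 * w) := H'
    exact (mul_ne_zero (g.cw 0 0 1) g.f1) (by linear_combination h)
  · have h : w + 9 * w = 2 * (3 * w) := H'
    exact (g.cw 2 0 1) (by linear_combination h)
  · have h : 9 * w ^ 2 + 1 = 2 * (3 * w) := H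
    exact (mul_ne_zero (mul_ne_zero (g.cw 0 0 0) g.f12) g.f12) (by linear_combination h)
  · have h : w + 9 * w = 2 * (1) := H'
    exact (mul_ne_zero (g.cw 1 0 0) g.f14) (by linear_combination h)
  · have h : w + 9 * w = 2 * (9 * w ^ 2) := H'
    exact (mul_ne_zero (g.cw 1 0 1) g.f5) (by linear_combination -h)
  · have h : 9 * w ^ 2 + 9 * w = 2 * (3 * w) := H'
    exact (mul_ne_zero (g.cw 0 1 1) g.f19) (by linear_combination h)
  · have h : w + 1 = 2 * (3 * w) := H
    exact (mul_ne_zero (g.cw 0 0 0) g.f14) (by linear_combination -h)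
  · have h : w + 1 = 2 * (9 * w) := H
    exact (mul_ne_zero (g.cw 0 0 0) g.f16) (by linear_combination -h)
  · have h : 9 * w ^ 2 + 9 * w = 2 * (w) := H'
    exact (mul_ne_zero (g.cw 0 0 1) g.f25) (by linear_combination h)

end Cases
end APD

open Polynomial

namespace APD
section Final
variable {F : Type*} [Field F]

/-- quadratic polynomial with integer coefficients -/
noncomputable def pq (F : Type*) [Field F] (t : ℤ × ℤ × ℤ) : F[X] :=
  C (t.1 : F) + C (t.2.1 : F) * X + C (t.2.2 : F) * X ^ 2

lemma int_ne (h2 : (2 : F) ≠ 0) (h3 : (3 : F) ≠ 0) {c : ℤ} (a b : ℕ)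
    (h : c.natAbs = 2 ^ a * 3 ^ b) : (c : F) ≠ 0 := by
  have h' : ((c.natAbs : ℕ) : F) ≠ 0 := by
    rw [h]; push_cast
    exact mul_ne_zero (pow_ne_zero a h2) (pow_ne_zero b h3)
  intro h0
  apply h'
  rcases Int.natAbs_eq c with e | e
  · have e2 := congrArg (Int.cast : ℤ → F) e
    rw [h0, Int.cast_natCast] at e2
    exact e2.symm
  · have e2 := congrArg (Int.cast : ℤ → F) e
    rw [h0, Int.cast_neg, Int.cast_natCast] at e2
    exact neg_eq_zero.1 e2.symm

/-- the exclusion list: coefficient triples -/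
def excl : List (ℤ × ℤ × ℤ) := [
  (-17, 9, 0), (-11, 3, 0), (-10, 3, 0), (-5, 3, 0), (-5, 9, 0), (-5, 12, 0),
  (-4, 1, 0), (-4, 7, 0), (-2, 3, 0), (-2, 9, 0), (-1, 2, 0), (-1, 3, 0),
  (-1, 4, 0), (-1, 5, 0), (-1, 7, 0), (-1, 17, 0), (-1, 18, 0), (1, 2, 0),
  (1, 3, 0), (1, 5, 0), (1, 6, 0), (1, 7, 0), (1, 15, 0), (2, 3, 0),
  (7, 9, 0), (-34, 9, 153), (-7, 9, 126), (-2, 0, 9), (-1, 0, 18), (2, -45, 171),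
  (5, -18, 45), (11, -45, 162)]

lemma pq_coeffs (t : ℤ × ℤ × ℤ) (h : pq F t = 0) :
    (t.1 : F) = 0 ∧ (t.2.1 : F) = 0 ∧ (t.2.2 : F) = 0 := by
  unfold pq at h
  generalize (t.1 : F) = a at *
  generalize (t.2.1 : F) = b at *
  generalize (t.2.2 : F) = c at *
  refine ⟨?_, ?_, ?_⟩
  · have := congrArg (fun p => coeff p 0) h
    simpa using this
  · have := congrArg (fun p => coeff p 1) h
    simpa [coeff_C, coeff_X_pow] using this
  · have := congrArg (fun p => coeff p 2) h
    simpa [coeff_C, coeff_X] using this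

lemma pq_natDegree (t : ℤ × ℤ × ℤ) :
    (pq F t).natDegree ≤ if t.2.2 = 0 then 1 else 2 := by
  split_ifs with h
  · rw [pq, h, Int.cast_zero, C_0, zero_mul, add_zero]
    compute_degree
  · rw [pq]
    compute_degree

lemma excl_ne (h2 : (2 : F) ≠ 0) (h3 : (3 : F) ≠ 0) : ∀ t ∈ excl, pq F t ≠ 0 := by
  have key : ∀ t ∈ excl, ∃ c ∈ [t.1, t.2.1, t.2.2], ∃ a ∈ List.range 5, ∃ b ∈ List.range 5,
      c.natAbs = 2 ^ a * 3 ^ b := by decide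
  intro t ht h
  obtain ⟨c, hc, a, -, b, -, e⟩ := key t ht
  have h0 := int_ne h2 h3 a b e
  obtain ⟨k1, k2, k3⟩ := pq_coeffs t h
  simp only [List.mem_cons, List.not_mem_nil, or_false] at hc
  rcases hc with rfl | rfl | rfl
  · exact h0 k1
  · exact h0 k2
  · exact h0 k3

lemma excl_deg : ((excl.map (pq F)).prod).natDegree ≤ 39 := by
  refine (natDegree_list_prod_le _).trans ?_
  rw [List.map_map]
  refine (List.sum_le_sum (f := natDegree ∘ pq F) (g := fun t => if t.2.2 = 0 then 1 else 2)
    (fun t _ => pq_natDegree t)).trans ?_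
  decide

variable [Fintype F] [DecidableEq F]

lemma exists_good (h2 : (2 : F) ≠ 0) (h3 : (3 : F) ≠ 0) (hq : 1307 ≤ Fintype.card F) :
    ∃ w ∈ VV F, Good w := by
  have hV := card_VV h2 h3 hq
  set p : F[X] := (excl.map (pq F)).prod with hp
  have hp0 : p ≠ 0 := by
    rw [hp]
    apply List.prod_ne_zero
    intro h
    obtain ⟨t, ht, e⟩ := List.mem_map.1 h
    exact excl_ne h2 h3 t ht e
  obtain ⟨w, hw, hwp⟩ : ∃ w ∈ VV F, w ∉ p.roots.toFinset := by
    apply Finset.exists_mem_notMem_of_card_lt_card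
    have := (Multiset.toFinset_card_le p.roots).trans (card_roots' p)
    have h39 : p.natDegree ≤ 39 := excl_deg (F := F)
    omega
  have hev : ∀ t ∈ excl, (t.1 : F) + t.2.1 * w + t.2.2 * w ^ 2 ≠ 0 := by
    intro t ht h0
    apply hwp
    rw [Multiset.mem_toFinset, mem_roots hp0, IsRoot, hp, eval_list_prod]
    apply List.prod_eq_zero
    rw [List.map_map]
    refine List.mem_map.2 ⟨t, ht, ?_⟩
    simpa [pq] using h0
  refine ⟨w, hw, ?_⟩
  simp only [VV, Finset.mem_filter, Finset.mem_univ, true_and] at hw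
  obtain ⟨m1, m2, m3, m4⟩ := hw
  have qn : ∀ x : F, quadraticChar F x = 1 ∨ quadraticChar F x = -1 → x ≠ 0 := by
    rintro x hx rfl
    simp at hx
  have n1 := qn _ (Or.inl m1)
  have n2 := qn _ (Or.inr m2)
  have n3 := qn _ (Or.inl m3)
  have n4 := qn _ (Or.inl m4)
  constructor
  · exact h2
  · exact h3
  · exact fun h => n1 (by rw [h, neg_zero])
  · exact fun h => n2 (by linear_combination -h)
  · exact fun h => n4 (by linear_combination -h)
  · exact fun h => n3 (by linear_combination -h)
  all_goals
    intro h
  · exact hev (-17, 9, 0) (by simp [excl]) (by push_cast; linear_combination h)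
  · exact hev (-11, 3, 0) (by simp [excl]) (by push_cast; linear_combination h)
  · exact hev (-10, 3, 0) (by simp [excl]) (by push_cast; linear_combination h)
  · exact hev (-5, 3, 0) (by simp [excl]) (by push_cast; linear_combination h)
  · exact hev (-5, 9, 0) (by simp [excl]) (by push_cast; linear_combination h)
  · exact hev (-5, 12, 0) (by simp [excl]) (by push_cast; linear_combination h)
  · exact hev (-4, 1, 0) (by simp [excl]) (by push_cast; linear_combination h)
  · exact hev (-4, 7, 0) (by simp [excl]) (by push_cast; linear_combination h)
  · exact hev (-2, 3, 0) (by simp [excl]) (by push_cast; linear_combination h)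
  · exact hev (-2, 9, 0) (by simp [excl]) (by push_cast; linear_combination h)
  · exact hev (-1, 2, 0) (by simp [excl]) (by push_cast; linear_combination h)
  · exact hev (-1, 3, 0) (by simp [excl]) (by push_cast; linear_combination h)
  · exact hev (-1, 4, 0) (by simp [excl]) (by push_cast; linear_combination h)
  · exact hev (-1, 5, 0) (by simp [excl]) (by push_cast; linear_combination h)
  · exact hev (-1, 7, 0) (by simp [excl]) (by push_cast; linear_combination h)
  · exact hev (-1, 17, 0) (by simp [excl]) (by push_cast; linear_combination h)
  · exact hev (-1, 18, 0) (by simp [excl]) (by push_cast; linear_combination h)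
  · exact hev (1, 2, 0) (by simp [excl]) (by push_cast; linear_combination h)
  · exact hev (1, 3, 0) (by simp [excl]) (by push_cast; linear_combination h)
  · exact hev (1, 5, 0) (by simp [excl]) (by push_cast; linear_combination h)
  · exact hev (1, 6, 0) (by simp [excl]) (by push_cast; linear_combination h)
  · exact hev (1, 7, 0) (by simp [excl]) (by push_cast; linear_combination h)
  · exact hev (1, 15, 0) (by simp [excl]) (by push_cast; linear_combination h)
  · exact hev (2, 3, 0) (by simp [excl]) (by push_cast; linear_combination h)
  · exact hev (7, 9, 0) (by simp [excl]) (by push_cast; linear_combination h)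
  · exact hev (-34, 9, 153) (by simp [excl]) (by push_cast; linear_combination h)
  · exact hev (-7, 9, 126) (by simp [excl]) (by push_cast; linear_combination h)
  · exact hev (-2, 0, 9) (by simp [excl]) (by push_cast; linear_combination h)
  · exact hev (-1, 0, 18) (by simp [excl]) (by push_cast; linear_combination h)
  · exact hev (2, -45, 171) (by simp [excl]) (by push_cast; linear_combination h)
  · exact hev (5, -18, 45) (by simp [excl]) (by push_cast; linear_combination h)
  · exact hev (11, -45, 162) (by simp [excl]) (by push_cast; linear_combination h)

/-- classification of a point with its value (scaled by `3 * w`) -/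
def Gen (w A A' : F) : Prop := A * A' = 9 * w ^ 2 ∧ ∀ i, A ≠ px w i

lemma sq_contra {x s z : F} (hz : quadraticChar F z = -1) (hs : s ≠ 0)
    (h : x ^ 2 = s ^ 2 * z) : False := by
  rw [quadraticChar_neg_one_iff_not_isSquare] at hz
  apply hz
  refine ⟨x / s, ?_⟩
  field_simp
  linear_combination -h

lemma mid_id {w A A' C C' S V : F} (hA : A * A' = 9 * w ^ 2) (hC : C * C' = 9 * w ^ 2)
    (e : A + C = 2 * S) (e' : A' + C' = 2 * V) (h2 : (2 : F) ≠ 0) :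
    (V * (A - S)) ^ 2 = (S * V) * (S * V - 9 * w ^ 2) := by
  have k : A * C * V = 9 * w ^ 2 * S := by
    apply mul_left_cancel₀ h2
    linear_combination A * hC + C * hA - A * C * e' - (-1) * (9 * w ^ 2) * e - (9 * w ^ 2) * e + (9 * w ^ 2) * e
  have hC' : C = 2 * S - A := by linear_combination e
  rw [hC'] at k
  linear_combination -V * k

lemma end_id {w B B' C C' S V : F} (hB : B * B' = 9 * w ^ 2) (hC : C * C' = 9 * w ^ 2)
    (e : S + C = 2 * B) (e' : V + C' = 2 * B') :
    (4 * V * B - (S * V + 27 * w ^ 2)) ^ 2 = (S * V - 9 * w ^ 2) * (S * V - 81 * w ^ 2) := by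
  have hc : C = 2 * B - S := by linear_combination e
  have hc' : C' = 2 * B' - V := by linear_combination e'
  rw [hc, hc'] at hC
  have k : 2 * V * B ^ 2 - (S * V + 27 * w ^ 2) * B + 18 * S * w ^ 2 = 0 := by
    linear_combination -B * hC + (4 * B - 2 * S) * hB
  linear_combination 8 * V * k

lemma one_mid {w : F} (hw : w ∈ VV F) (g : Good w) (i : Fin 6) {A A' C C' : F}
    (hA : Gen w A A') (hC : Gen w C C')
    (e : A + C = 2 * px w i) (e' : A' + C' = 2 * pv w i) : False := by
  simp only [VV, Finset.mem_filter, Finset.mem_univ, true_and] at hw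
  obtain ⟨m1, m2, m3, m4⟩ := hw
  have H := mid_id hA.1 hC.1 e e' g.h2
  have c1 : quadraticChar F (-w * (1 - w)) = -1 := by rw [map_mul, m1, m2]; norm_num
  have s1 : 9 * w ^ 2 ≠ 0 := by
    have := g.cw 0 2 2
    norm_num at this ⊢; exact this
  have s2 : 9 * w ≠ 0 := by
    have := g.cw 0 2 1
    norm_num at this ⊢; exact this
  fin_cases i
  · have e : A + C = 2 * 0 := e
    have e' : A' + C' = 2 * (3 * w) := e'
    have hCA : C = -A := by linear_combination e
    have h1 := hA.1
    have h2 := hC.1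
    rw [hCA] at h2
    have : A * (6 * w) = 0 := by linear_combination h1 - h2 - A * e'
    rcases mul_eq_zero.1 this with h | h
    · exact hA.2 0 h
    · exact g.cw 1 1 1 (by linear_combination h)
  · have e : A + C = 2 * (3 * w) := e
    have e' : A' + C' = 2 * 0 := e'
    have hCA : C' = -A' := by linear_combination e'
    have h1 := hA.1
    have h2 := hC.1
    rw [hCA] at h2
    have : A' * (6 * w) = 0 := by linear_combination h1 - h2 - A' * e
    rcases mul_eq_zero.1 this with h | h
    · rw [h, mul_zero] at h1
      exact s1 h1.symm
    · exact g.cw 1 1 1 (by linear_combination h)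
  · have H : (1 * (A - 9 * w)) ^ 2 = (9 * w * 1) * (9 * w * 1 - 9 * w ^ 2) := H
    exact sq_contra m2 s2 (H.trans (by ring))
  · have H : (w * (A - 9 * w ^ 2)) ^ 2 = (9 * w ^ 2 * w) * (9 * w ^ 2 * w - 9 * w ^ 2) := H
    exact sq_contra c1 s1 (H.trans (by ring))
  · have H : (9 * w ^ 2 * (A - w)) ^ 2 = (w * (9 * w ^ 2)) * (w * (9 * w ^ 2) - 9 * w ^ 2) := H
    exact sq_contra c1 s1 (H.trans (by ring))
  · have H : (9 * w * (A - 1)) ^ 2 = (1 * (9 * w)) * (1 * (9 * w) - 9 * w ^ 2) := H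
    exact sq_contra m2 s2 (H.trans (by ring))

lemma one_end {w : F} (hw : w ∈ VV F) (g : Good w) (i : Fin 6) {B B' C C' : F}
    (hB : Gen w B B') (hC : Gen w C C')
    (e : px w i + C = 2 * B) (e' : pv w i + C' = 2 * B') : False := by
  simp only [VV, Finset.mem_filter, Finset.mem_univ, true_and] at hw
  obtain ⟨m1, m2, m3, m4⟩ := hw
  have H := end_id hB.1 hC.1 e e'
  have c1 : quadraticChar F ((1 - w) * (9 - w)) = -1 := by rw [map_mul, m2, m4]; norm_num
  have c2 : quadraticChar F ((1 - w) * (1 - 9 * w)) = -1 := by rw [map_mul, m2, m3]; norm_num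
  have s1 : 9 * w ^ 2 ≠ 0 := by
    have := g.cw 0 2 2
    norm_num at this ⊢; exact this
  have s2 : 9 * w ≠ 0 := by
    have := g.cw 0 2 1
    norm_num at this ⊢; exact this
  fin_cases i
  · have e : 0 + C = 2 * B := e
    have e' : 3 * w + C' = 2 * B' := e'
    have h1 := hB.1
    have h2 := hC.1
    apply hC.2 2
    change C = 9 * w
    apply mul_left_cancel₀ (g.cw 0 1 1)
    linear_combination C * e' - h2 + 2 * B' * e + 4 * h1
  · have e : 3 * w + C = 2 * B := e
    have e' : 0 + C' = 2 * B' := e'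
    have h1 := hB.1
    have h2 := hC.1
    apply hC.2 4
    change C = w
    have hB0 : B' ≠ 0 := by
      intro h; rw [h, mul_zero] at h1; exact s1 h1.symm
    have k : 2 * C = B := by
      apply mul_left_cancel₀ hB0
      linear_combination h2 - h1 - C * e'
    apply mul_left_cancel₀ (g.cw 0 1 0)
    linear_combination 2 * k - e
  · have H : (4 * 1 * B - (9 * w * 1 + 27 * w ^ 2)) ^ 2
      = (9 * w * 1 - 9 * w ^ 2) * (9 * w * 1 - 81 * w ^ 2) := H
    exact sq_contra c2 s2 (H.trans (by ring))
  · have H : (4 * w * B - (9 * w ^ 2 * w + 27 * w ^ 2)) ^ 2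
      = (9 * w ^ 2 * w - 9 * w ^ 2) * (9 * w ^ 2 * w - 81 * w ^ 2) := H
    exact sq_contra c1 s1 (H.trans (by ring))
  · have H : (4 * (9 * w ^ 2) * B - (w * (9 * w ^ 2) + 27 * w ^ 2)) ^ 2
      = (w * (9 * w ^ 2) - 9 * w ^ 2) * (w * (9 * w ^ 2) - 81 * w ^ 2) := H
    exact sq_contra c1 s1 (H.trans (by ring))
  · have H : (4 * (9 * w) * B - (1 * (9 * w) + 27 * w ^ 2)) ^ 2
      = (1 * (9 * w) - 9 * w ^ 2) * (1 * (9 * w) - 81 * w ^ 2) := H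
    exact sq_contra c2 s2 (H.trans (by ring))

/-- a scaled pair is exceptional or generic -/
def Cls (w A A' : F) : Prop := (∃ i, A = px w i ∧ A' = pv w i) ∨ Gen w A A'

theorem core {w : F} (hw : w ∈ VV F) (g : Good w) {A A' B B' C C' : F}
    (hA : Cls w A A') (hB : Cls w B B') (hC : Cls w C C')
    (e : A + C = 2 * B) (e' : A' + C' = 2 * B') (hne : A ≠ B) : False := by
  have hne' : C ≠ B := by
    intro h; apply hne; rw [h] at e; linear_combination e
  have hAC : A ≠ C := by
    intro h; apply hne; rw [← h] at e
    apply mul_left_cancel₀ g.h2; linear_combination e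
  have esym : C + A = 2 * B := by rw [add_comm]; exact e
  have esym' : C' + A' = 2 * B' := by rw [add_comm]; exact e'
  rcases hA with ⟨i, rfl, rfl⟩ | gA <;> rcases hB with ⟨j, rfl, rfl⟩ | gB <;>
    rcases hC with ⟨k, rfl, rfl⟩ | gC
  · have hij : i ≠ j := fun h => hne (by rw [h])
    have hkj : k ≠ j := fun h => hne' (by rw [h])
    have hik : i ≠ k := fun h => hAC (by rw [h])
    rcases lt_or_gt_of_ne hik with h | h
    · exact three_lt g i k j h hij hkj e e'
    · exact three_lt g k i j h hkj hij esym esym'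
  · have hij : i ≠ j := fun h => hne (by rw [h])
    refine two_end g i j hij ?_
    rw [← gC.1]
    rw [← e, ← e']; ring
  · have hik : i ≠ k := fun h => hAC (by rw [h])
    have H : (px w i + px w k) * (pv w i + pv w k) = 36 * w ^ 2 := by
      rw [e, e']; linear_combination 4 * gB.1
    rcases lt_or_gt_of_ne hik with h | h
    · exact two_mid_lt g i k h H
    · exact two_mid_lt g k i h (by rw [← H]; ring)
  · exact one_end hw g i gB gC e e'
  · have hkj : k ≠ j := fun h => hne' (by rw [h])
    refine two_end g k j hkj ?_
    rw [← gA.1]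
    rw [← e, ← e']; ring
  · exact one_mid hw g j gA gC e e'
  · exact one_end hw g k gB gA esym esym'
  · apply hne
    have h := mid_id gA.1 gC.1 e e' g.h2
    rw [gB.1, sub_self, mul_zero] at h
    have h := pow_eq_zero_iff (two_ne_zero) |>.1 h
    rcases mul_eq_zero.1 h with h | h
    · exfalso
      have := gB.1
      rw [h, mul_zero] at this
      exact g.cw 0 2 2 (by linear_combination -this)
    · exact sub_eq_zero.1 h

/-- the permutation -/
noncomputable def perm (w : F) : Equiv.Perm F :=
  ((Equiv.swap 0 1).trans ((Equiv.swap 3 (3 * w)).trans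
    (Equiv.swap 3⁻¹ (3 * w)⁻¹))).trans (Equiv.inv F)

lemma perm_cls {w : F} (g : Good w) (x : F) : Cls w (3 * w * x) (3 * w * perm w x) := by
  have h3 := g.h3
  have hw := g.w0
  have h3w : 3 * w ≠ 0 := mul_ne_zero h3 hw
  have a1 : (3 : F) ≠ 1 := fun h => g.h2 (by linear_combination h)
  have a2 : 3 * w ≠ 1 := fun h => g.f12 (by linear_combination h)
  have a3 : (3 : F)⁻¹ ≠ 1 := fun h => a1 (inv_eq_one.1 h)
  have a4 : (3 * w)⁻¹ ≠ 1 := fun h => a2 (inv_eq_one.1 h)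
  have b1 : (3 : F) ≠ 3⁻¹ := by
    intro h
    field_simp at h
    exact pow_ne_zero 3 g.h2 (by linear_combination h)
  have b2 : (3 : F) ≠ (3 * w)⁻¹ := by
    intro h
    field_simp at h
    exact g.e3 (by linear_combination h)
  have b3 : 3 * w ≠ 3⁻¹ := by
    intro h
    field_simp at h
    exact g.e3 (by linear_combination h)
  have b4 : 3 * w ≠ (3 * w)⁻¹ := by
    intro h
    field_simp at h
    have : (-1 + 3 * w) * (1 + 3 * w) = 0 := by linear_combination h
    exact mul_ne_zero g.f12 g.f19 this
  by_cases c0 : x = 0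
  · left; refine ⟨0, ?_, ?_⟩
    · rw [c0, mul_zero]; rfl
    · have : perm w x = 1 := by
        simp only [perm, Equiv.trans_apply]
        rw [c0, Equiv.swap_apply_left, Equiv.swap_apply_of_ne_of_ne a1.symm a2.symm,
          Equiv.swap_apply_of_ne_of_ne a3.symm a4.symm, Equiv.inv_apply, inv_one]
      rw [this, mul_one]; rfl
  by_cases c1 : x = 1
  · left; refine ⟨1, ?_, ?_⟩
    · rw [c1, mul_one]; rfl
    · have : perm w x = 0 := by
        simp [perm, c1, Equiv.swap_apply_of_ne_of_ne, h3, hw, h3.symm, hw.symm, h3w.symm]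
      rw [this, mul_zero]; rfl
  have sw0 : Equiv.swap (0 : F) 1 x = x := Equiv.swap_apply_of_ne_of_ne c0 c1
  by_cases c2 : x = 3
  · left; refine ⟨2, ?_, ?_⟩
    · rw [c2]; change _ = 9 * w; ring
    · have : perm w x = (3 * w)⁻¹ := by
        simp only [perm, Equiv.trans_apply, sw0]
        rw [c2, Equiv.swap_apply_left, Equiv.swap_apply_of_ne_of_ne b3 b4]; rfl
      rw [this, mul_inv_cancel₀ h3w]; rfl
  by_cases c3 : x = 3 * w
  · left; refine ⟨3, ?_, ?_⟩
    · rw [c3]; change _ = 9 * w ^ 2; ring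
    · have : perm w x = 3⁻¹ := by
        simp only [perm, Equiv.trans_apply, sw0]
        rw [c3, Equiv.swap_apply_right, Equiv.swap_apply_of_ne_of_ne b1 b2]; rfl
      rw [this]; change _ = w; field_simp
  have sw1 : Equiv.swap (3 : F) (3 * w) x = x := Equiv.swap_apply_of_ne_of_ne c2 c3
  by_cases c4 : x = 3⁻¹
  · left; refine ⟨4, ?_, ?_⟩
    · rw [c4]; change _ = w; field_simp
    · have : perm w x = 3 * w := by
        simp only [perm, Equiv.trans_apply, sw0, sw1]
        rw [c4, Equiv.swap_apply_left, Equiv.inv_apply, inv_inv]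
      rw [this]; change _ = 9 * w ^ 2; ring
  by_cases c5 : x = (3 * w)⁻¹
  · left; refine ⟨5, ?_, ?_⟩
    · rw [c5, mul_inv_cancel₀ h3w]; rfl
    · have : perm w x = 3 := by
        simp only [perm, Equiv.trans_apply, sw0, sw1]
        rw [c5, Equiv.swap_apply_right, Equiv.inv_apply, inv_inv]
      rw [this]; change _ = 9 * w; ring
  right
  have hp : perm w x = x⁻¹ := by
    simp only [perm, Equiv.trans_apply, sw0, sw1]
    rw [Equiv.swap_apply_of_ne_of_ne c4 c5]; rfl
  refine ⟨?_, ?_⟩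
  · rw [hp]; field_simp; ring
  · intro i hi
    fin_cases i
    · have h : 3 * w * x = 0 := hi
      exact (mul_ne_zero h3w c0) h
    · have h : 3 * w * x = 3 * w := hi
      exact c1 (mul_left_cancel₀ h3w (by rw [h, mul_one]))
    · have h : 3 * w * x = 9 * w := hi
      exact c2 (mul_left_cancel₀ h3w (by rw [h]; ring))
    · have h : 3 * w * x = 9 * w ^ 2 := hi
      exact c3 (mul_left_cancel₀ h3w (by rw [h]; ring))
    · have h : 3 * w * x = w := hi
      exact c4 (mul_left_cancel₀ h3w (by rw [h]; field_simp))
    · have h : 3 * w * x = 1 := hi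
      exact c5 (mul_left_cancel₀ h3w (by rw [h, mul_inv_cancel₀ h3w]))

end Final
end APD

/-- Every finite field of order at least 1307 and characteristic greater than 3
admits an AP-destroying permutation of its additive group. -/
theorem exists_ap_destroying_perm_of_large_field
    (F : Type*) [Field F] [Fintype F]
    (p : ℕ) [CharP F p] (hp : 3 < p)
    (hq : 1307 ≤ Fintype.card F) :
    ∃ π : Equiv.Perm F,
      ∀ a b c : F, b - a = c - b → b - a ≠ 0 → π b - π a ≠ π c - π b := by
  classical
  have h2 : (2 : F) ≠ 0 := by
    intro h
    have h' : ((2 : ℕ) : F) = 0 := by exact_mod_cast h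
    have := Nat.le_of_dvd (by norm_num) ((CharP.cast_eq_zero_iff F p 2).1 h')
    omega
  have h3 : (3 : F) ≠ 0 := by
    intro h
    have h' : ((3 : ℕ) : F) = 0 := by exact_mod_cast h
    have := Nat.le_of_dvd (by norm_num) ((CharP.cast_eq_zero_iff F p 3).1 h')
    omega
  obtain ⟨w, hw, g⟩ := APD.exists_good h2 h3 hq
  refine ⟨APD.perm w, ?_⟩
  intro a b c h hne h'
  refine APD.core hw g (APD.perm_cls g a) (APD.perm_cls g b) (APD.perm_cls g c) ?_ ?_ ?_
  · linear_combination -3 * w * h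
  · linear_combination -3 * w * h'
  · intro e
    apply hne
    rw [mul_left_cancel₀ (mul_ne_zero h3 g.w0) e, sub_self]
end
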